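/- Let U ⊆ ℂ^m be a domain (nonempty connected open set), let Ω ⊆ ℂ^n be a pseudoconvex open set, let φ be a smooth real-valued function on U × Ω, let η be a smooth real-valued function on Ω, and let δ > 0. Assume Ξ_{δ,η}(e^{−φ}) ≥ 0 at every point of U × Ω. For t ∈ U let K_t denote the diagonal Bergman kernel of H²(Ω, φ(t,·)) (with respect to Lebesgue measure). Then for every z ∈ Ω, the function U ∋ t ↦ log K_t(z) is plurisubharmonic or identically −∞. -/

import Mathlib

open MeasureTheory Set
open scoped ENNReal ComplexOrder

noncomputable section

/-- The squared weighted `L²` norm `∫_Ω ‖f‖² e^{−φ} dμ`. -/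
def bergNormSq {n : ℕ} (Ω : Set (Fin n → ℂ)) (φ : (Fin n → ℂ) → ℝ)
    (μ : Measure (Fin n → ℂ)) (f : (Fin n → ℂ) → ℂ) : ℝ≥0∞ :=
  ∫⁻ z in Ω, ENNReal.ofReal (‖f z‖ ^ 2 * Real.exp (-(φ z))) ∂μ

/-- The diagonal Bergman kernel of the weighted Bergman space `H²(Ω,μ,φ)`. -/
def bergKernel {n : ℕ} (Ω : Set (Fin n → ℂ)) (φ : (Fin n → ℂ) → ℝ)
    (μ : Measure (Fin n → ℂ)) (z : Fin n → ℂ) : ℝ≥0∞ :=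
  ⨆ (f : (Fin n → ℂ) → ℂ) (_ : DifferentiableOn ℂ f Ω)
    (_ : bergNormSq Ω φ μ f ≠ 0) (_ : bergNormSq Ω φ μ f ≠ ⊤),
    ENNReal.ofReal (‖f z‖ ^ 2) / bergNormSq Ω φ μ f

/-- Extended logarithm `ℝ≥0∞ → EReal`, with `elog 0 = ⊥`. -/
def elog (x : ℝ≥0∞) : EReal :=
  if x = 0 then ⊥ else if x = ⊤ then ⊤ else ((Real.log x.toReal : ℝ) : EReal)

/-- Directional Wirtinger derivative `∂_v f` at `x`. -/
def wder {E : Type*} [NormedAddCommGroup E] [NormedSpace ℂ E]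
    (f : E → ℂ) (v x : E) : ℂ :=
  (1 / 2 : ℂ) * (fderiv ℝ f x v - Complex.I * fderiv ℝ f x (Complex.I • v))

/-- Directional conjugate Wirtinger derivative `∂̄_v f` at `x`. -/
def wderBar {E : Type*} [NormedAddCommGroup E] [NormedSpace ℂ E]
    (f : E → ℂ) (v x : E) : ℂ :=
  (1 / 2 : ℂ) * (fderiv ℝ f x v + Complex.I * fderiv ℝ f x (Complex.I • v))

/-- The complex Hessian (Levi form) of `u` is positive semidefinite on `W`. -/
def LeviPSD {E : Type*} [NormedAddCommGroup E] [NormedSpace ℂ E]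
    (W : Set E) (u : E → ℝ) : Prop :=
  ∀ x ∈ W, ∀ v : E, 0 ≤ (wder (fun y => wderBar (fun q => (u q : ℂ)) v y) v x).re

/-- Pseudoconvexity of an open set via a smooth psh exhaustion function. -/
def Pseudoconvex {n : ℕ} (Ω : Set (Fin n → ℂ)) : Prop :=
  IsOpen Ω ∧ ∃ u : (Fin n → ℂ) → ℝ, ContDiffOn ℝ (⊤ : ℕ∞) u Ω ∧ LeviPSD Ω u ∧
    ∀ c : ℝ, IsCompact {z ∈ Ω | u z ≤ c}

/-- Plurisubharmonicity (with values in `EReal`): upper semicontinuity plus the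
sub-mean-value inequality on complex lines, expressed via continuous majorants. -/
def PshOn {E : Type*} [NormedAddCommGroup E] [NormedSpace ℂ E]
    (D : Set E) (u : E → EReal) : Prop :=
  UpperSemicontinuousOn u D ∧
  ∀ a ∈ D, ∀ w : E, ∀ r : ℝ, 0 < r →
    (∀ τ : ℂ, ‖τ‖ ≤ r → a + τ • w ∈ D) →
    ∀ g : ℝ → ℝ, Continuous g →
      (∀ θ : ℝ, u (a + (((r : ℂ) * Complex.exp (θ * Complex.I)) • w)) ≤ ((g θ : ℝ) : EReal)) →
      u a ≤ (((1 / (2 * Real.pi)) * ∫ θ in (0:ℝ)..(2 * Real.pi), g θ : ℝ) : EReal)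

/-- The twisted curvature positivity condition `Ξ_{δ,η}(e^{−φ}) ≥ 0` on `U × Ω`. -/
def XiNonneg {m n : ℕ} (U : Set (Fin m → ℂ)) (Ω : Set (Fin n → ℂ))
    (φ : (Fin m → ℂ) × (Fin n → ℂ) → ℝ) (η : (Fin n → ℂ) → ℝ) (δ : ℝ) : Prop :=
  ∀ p ∈ U ×ˢ Ω, ∀ vt : Fin m → ℂ, ∀ vz : Fin n → ℂ,
    0 ≤ (wder (fun y => wderBar (fun q => (φ q : ℂ))
            ((vt, 0) : (Fin m → ℂ) × (Fin n → ℂ)) y) ((vt, 0)) p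
      + wder (fun y => wderBar (fun q => (φ q : ℂ))
            (((0 : Fin m → ℂ), vz)) y) ((vt, 0)) p
      + wder (fun y => wderBar (fun q => (φ q : ℂ))
            ((vt, 0)) y) (((0 : Fin m → ℂ), vz)) p
      + ((δ / (1 + δ) : ℝ) : ℂ) *
        (wder (fun y => wderBar (fun q => (φ q : ℂ))
            (((0 : Fin m → ℂ), vz)) y) (((0 : Fin m → ℂ), vz)) p
          + 2 * wder (fun y => wderBar (fun w => (η w : ℂ)) vz y) vz p.2
          - ((1 + δ : ℝ) : ℂ) * (Complex.normSq (wder (fun w => (η w : ℂ)) vz p.2) : ℂ))).re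
noncomputable section
open MeasureTheory Set
open scoped ENNReal ComplexOrder ContDiff

section wirt
variable {E : Type*} [NormedAddCommGroup E] [NormedSpace ℂ E]

theorem wder_mul {f g : E → ℂ} {x : E} (v : E) (hf : DifferentiableAt ℝ f x)
    (hg : DifferentiableAt ℝ g x) :
    wder (fun y => f y * g y) v x = wder f v x * g x + f x * wder g v x := by
  simp only [wder]
  rw [fderiv_fun_mul hf hg]
  simp
  ring

theorem wderBar_mul {f g : E → ℂ} {x : E} (v : E) (hf : DifferentiableAt ℝ f x)
    (hg : DifferentiableAt ℝ g x) :
    wderBar (fun y => f y * g y) v x = wderBar f v x * g x + f x * wderBar g v x := by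
  simp only [wderBar]
  rw [fderiv_fun_mul hf hg]
  simp
  ring

theorem wder_add {f g : E → ℂ} {x : E} (v : E) (hf : DifferentiableAt ℝ f x)
    (hg : DifferentiableAt ℝ g x) :
    wder (fun y => f y + g y) v x = wder f v x + wder g v x := by
  simp only [wder]
  rw [fderiv_fun_add hf hg]
  simp
  ring

theorem wderBar_add {f g : E → ℂ} {x : E} (v : E) (hf : DifferentiableAt ℝ f x)
    (hg : DifferentiableAt ℝ g x) :
    wderBar (fun y => f y + g y) v x = wderBar f v x + wderBar g v x := by
  simp only [wderBar]
  rw [fderiv_fun_add hf hg]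
  simp
  ring

theorem wder_sub {f g : E → ℂ} {x : E} (v : E) (hf : DifferentiableAt ℝ f x)
    (hg : DifferentiableAt ℝ g x) :
    wder (fun y => f y - g y) v x = wder f v x - wder g v x := by
  simp only [wder]
  rw [fderiv_fun_sub hf hg]
  simp
  ring

theorem wderBar_sub {f g : E → ℂ} {x : E} (v : E) (hf : DifferentiableAt ℝ f x)
    (hg : DifferentiableAt ℝ g x) :
    wderBar (fun y => f y - g y) v x = wderBar f v x - wderBar g v x := by
  simp only [wderBar]
  rw [fderiv_fun_sub hf hg]
  simp
  ring

theorem wder_neg {f : E → ℂ} {x : E} (v : E) :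
    wder (fun y => - f y) v x = - wder f v x := by
  simp only [wder]
  rw [fderiv_fun_neg]
  simp
  ring

theorem wderBar_neg {f : E → ℂ} {x : E} (v : E) :
    wderBar (fun y => - f y) v x = - wderBar f v x := by
  simp only [wderBar]
  rw [fderiv_fun_neg]
  simp
  ring

theorem wder_const_mul {f : E → ℂ} {x : E} (v : E) (c : ℂ) (hf : DifferentiableAt ℝ f x) :
    wder (fun y => c * f y) v x = c * wder f v x := by
  simp only [wder]
  rw [fderiv_const_mul hf]
  simp
  ring

theorem wderBar_const_mul {f : E → ℂ} {x : E} (v : E) (c : ℂ) (hf : DifferentiableAt ℝ f x) :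
    wderBar (fun y => c * f y) v x = c * wderBar f v x := by
  simp only [wderBar]
  rw [fderiv_const_mul hf]
  simp
  ring

theorem wder_conj {f : E → ℂ} {x : E} (v : E) (hf : DifferentiableAt ℝ f x) :
    wder (fun y => (starRingEnd ℂ) (f y)) v x = (starRingEnd ℂ) (wderBar f v x) := by
  have h : fderiv ℝ (fun y => (starRingEnd ℂ) (f y)) x
      = (Complex.conjCLE : ℂ →L[ℝ] ℂ).comp (fderiv ℝ f x) :=
    ((Complex.conjCLE : ℂ →L[ℝ] ℂ).hasFDerivAt.comp x hf.hasFDerivAt).fderiv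
  simp only [wder, wderBar, h]
  simp [map_ofNat]
  ring

theorem wderBar_conj {f : E → ℂ} {x : E} (v : E) (hf : DifferentiableAt ℝ f x) :
    wderBar (fun y => (starRingEnd ℂ) (f y)) v x = (starRingEnd ℂ) (wder f v x) := by
  have h : fderiv ℝ (fun y => (starRingEnd ℂ) (f y)) x
      = (Complex.conjCLE : ℂ →L[ℝ] ℂ).comp (fderiv ℝ f x) :=
    ((Complex.conjCLE : ℂ →L[ℝ] ℂ).hasFDerivAt.comp x hf.hasFDerivAt).fderiv
  simp only [wder, wderBar, h]
  simp [map_ofNat]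

theorem fderiv_ofReal' {f : E → ℝ} {x : E} (v : E) (hf : DifferentiableAt ℝ f x) :
    fderiv ℝ (fun y => (f y : ℂ)) x v = (fderiv ℝ f x v : ℂ) := by
  have h : fderiv ℝ (fun y => (f y : ℂ)) x = Complex.ofRealCLM.comp (fderiv ℝ f x) :=
    (Complex.ofRealCLM.hasFDerivAt.comp x hf.hasFDerivAt).fderiv
  rw [h]; simp

theorem wder_ofReal_eq {f : E → ℝ} {x : E} (v : E) (hf : DifferentiableAt ℝ f x) :
    wder (fun y => (f y : ℂ)) v x
      = (1 / 2 : ℂ) * ((fderiv ℝ f x v : ℂ) - Complex.I * (fderiv ℝ f x (Complex.I • v) : ℂ)) := by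
  simp only [wder]; rw [fderiv_ofReal' _ hf, fderiv_ofReal' _ hf]

theorem wderBar_ofReal_eq {f : E → ℝ} {x : E} (v : E) (hf : DifferentiableAt ℝ f x) :
    wderBar (fun y => (f y : ℂ)) v x
      = (1 / 2 : ℂ) * ((fderiv ℝ f x v : ℂ) + Complex.I * (fderiv ℝ f x (Complex.I • v) : ℂ)) := by
  simp only [wderBar]; rw [fderiv_ofReal' _ hf, fderiv_ofReal' _ hf]

theorem conj_wderBar_ofReal {f : E → ℝ} {x : E} (v : E) (hf : DifferentiableAt ℝ f x) :
    (starRingEnd ℂ) (wderBar (fun y => (f y : ℂ)) v x) = wder (fun y => (f y : ℂ)) v x := by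
  rw [wder_ofReal_eq v hf, wderBar_ofReal_eq v hf]
  simp [map_ofNat]
  ring

theorem conj_wder_ofReal {f : E → ℝ} {x : E} (v : E) (hf : DifferentiableAt ℝ f x) :
    (starRingEnd ℂ) (wder (fun y => (f y : ℂ)) v x) = wderBar (fun y => (f y : ℂ)) v x := by
  rw [← conj_wderBar_ofReal v hf, Complex.conj_conj]

theorem wder_smul_dir {f : E → ℂ} {x : E} (v : E) (c : ℂ) :
    wder f (c • v) x = c * wder f v x := by
  simp only [wder]
  have h1 : c • v = c.re • v + c.im • (Complex.I • v) := by
    conv_lhs => rw [← Complex.re_add_im c]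
    rw [add_smul, mul_smul]; simp
  have h2 : Complex.I • (c • v) = c.re • (Complex.I • v) - c.im • v := by
    rw [h1, smul_add, smul_comm, smul_comm (Complex.I) c.im (Complex.I • v), smul_smul Complex.I]
    simp [sub_eq_add_neg]
  rw [h2, h1]
  simp only [map_add, map_sub, map_smul, Complex.real_smul]
  conv_rhs => rw [← Complex.re_add_im c]
  linear_combination (1/2 * c.im * fderiv ℝ f x (Complex.I • v)) * Complex.I_sq

theorem wderBar_smul_dir {f : E → ℂ} {x : E} (v : E) (c : ℂ) :
    wderBar f (c • v) x = (starRingEnd ℂ) c * wderBar f v x := by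
  simp only [wderBar]
  have h1 : c • v = c.re • v + c.im • (Complex.I • v) := by
    conv_lhs => rw [← Complex.re_add_im c]
    rw [add_smul, mul_smul]; simp
  have h2 : Complex.I • (c • v) = c.re • (Complex.I • v) - c.im • v := by
    rw [h1, smul_add, smul_comm, smul_comm (Complex.I) c.im (Complex.I • v), smul_smul Complex.I]
    simp [sub_eq_add_neg]
  rw [h2, h1]
  simp only [map_add, map_sub, map_smul, Complex.real_smul]
  have h3 : (starRingEnd ℂ) c = c.re - c.im * Complex.I := by
    apply Complex.ext <;> simp
  rw [h3]
  linear_combination (1/2 * c.im * fderiv ℝ f x (Complex.I • v)) * Complex.I_sq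

theorem wder_add_dir {f : E → ℂ} {x : E} (v w : E) :
    wder f (v + w) x = wder f v x + wder f w x := by
  simp only [wder, smul_add, map_add]; ring

theorem wderBar_add_dir {f : E → ℂ} {x : E} (v w : E) :
    wderBar f (v + w) x = wderBar f v x + wderBar f w x := by
  simp only [wderBar, smul_add, map_add]; ring

theorem wder_zero_dir {f : E → ℂ} {x : E} : wder f 0 x = 0 := by
  simp [wder]

theorem wderBar_zero_dir {f : E → ℂ} {x : E} : wderBar f 0 x = 0 := by
  simp [wderBar]

theorem wder_sum_dir {ι : Type*} {f : E → ℂ} {x : E} (s : Finset ι) (v : ι → E) (c : ι → ℂ) :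
    wder f (∑ i ∈ s, c i • v i) x = ∑ i ∈ s, c i * wder f (v i) x := by
  classical
  induction s using Finset.induction_on with
  | empty => simp [wder_zero_dir]
  | insert a s ha ih => rw [Finset.sum_insert ha, Finset.sum_insert ha, wder_add_dir, ih,
      wder_smul_dir]

theorem wderBar_sum_dir {ι : Type*} {f : E → ℂ} {x : E} (s : Finset ι) (v : ι → E) (c : ι → ℂ) :
    wderBar f (∑ i ∈ s, c i • v i) x = ∑ i ∈ s, (starRingEnd ℂ) (c i) * wderBar f (v i) x := by
  classical
  induction s using Finset.induction_on with
  | empty => simp [wderBar_zero_dir]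
  | insert a s ha ih => rw [Finset.sum_insert ha, Finset.sum_insert ha, wderBar_add_dir, ih,
      wderBar_smul_dir]

theorem wder_congr {f g : E → ℂ} {x : E} (v : E) (h : f =ᶠ[nhds x] g) :
    wder f v x = wder g v x := by
  simp only [wder, h.fderiv_eq]

theorem wderBar_congr {f g : E → ℂ} {x : E} (v : E) (h : f =ᶠ[nhds x] g) :
    wderBar f v x = wderBar g v x := by
  simp only [wderBar, h.fderiv_eq]

theorem contDiffOn_fderiv_apply {F : Type*} [NormedAddCommGroup F] [NormedSpace ℝ F]
    {f : E → F} {S : Set E} (hS : IsOpen S)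
    (hf : ContDiffOn ℝ ∞ f S) (v : E) : ContDiffOn ℝ ∞ (fun x => fderiv ℝ f x v) S :=
  (hf.fderiv_of_isOpen hS (m := ∞) (by simp)).clm_apply contDiffOn_const

theorem contDiffOn_wder {f : E → ℂ} {S : Set E} (hS : IsOpen S)
    (hf : ContDiffOn ℝ ∞ f S) (v : E) : ContDiffOn ℝ ∞ (fun x => wder f v x) S :=
  contDiffOn_const.mul ((contDiffOn_fderiv_apply hS hf v).sub
    (contDiffOn_const.mul (contDiffOn_fderiv_apply hS hf _)))

theorem contDiffOn_wderBar {f : E → ℂ} {S : Set E} (hS : IsOpen S)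
    (hf : ContDiffOn ℝ ∞ f S) (v : E) : ContDiffOn ℝ ∞ (fun x => wderBar f v x) S :=
  contDiffOn_const.mul ((contDiffOn_fderiv_apply hS hf v).add
    (contDiffOn_const.mul (contDiffOn_fderiv_apply hS hf _)))

theorem contDiff_wder {f : E → ℂ} (hf : ContDiff ℝ ∞ f) (v : E) :
    ContDiff ℝ ∞ (fun x => wder f v x) := by
  rw [← contDiffOn_univ] at *; exact contDiffOn_wder isOpen_univ hf v

theorem contDiff_wderBar {f : E → ℂ} (hf : ContDiff ℝ ∞ f) (v : E) :
    ContDiff ℝ ∞ (fun x => wderBar f v x) := by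
  rw [← contDiffOn_univ] at *; exact contDiffOn_wderBar isOpen_univ hf v

theorem contDiffOn_ofReal {f : E → ℝ} {S : Set E} (hf : ContDiffOn ℝ ∞ f S) :
    ContDiffOn ℝ ∞ (fun x => (f x : ℂ)) S :=
  Complex.ofRealCLM.contDiff.comp_contDiffOn hf

theorem diffAt_of_contDiffOn {F : Type*} [NormedAddCommGroup F] [NormedSpace ℝ F]
    {f : E → F} {S : Set E} {x : E} (hS : IsOpen S) (hx : x ∈ S)
    (hf : ContDiffOn ℝ ∞ f S) : DifferentiableAt ℝ f x :=
  ((hf.contDiffAt (hS.mem_nhds hx)).differentiableAt (by simp))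

/-- Second real derivative. -/
def hess {F : Type*} [NormedAddCommGroup F] [NormedSpace ℝ F] (f : E → F) (x v w : E) : F :=
  fderiv ℝ (fun y => fderiv ℝ f y w) x v

theorem hess_symm {F : Type*} [NormedAddCommGroup F] [NormedSpace ℝ F]
    {f : E → F} {S : Set E} {x : E} (hS : IsOpen S) (hx : x ∈ S)
    (hf : ContDiffOn ℝ ∞ f S) (v w : E) : hess f x v w = hess f x w v := by
  have h1 : DifferentiableAt ℝ (fderiv ℝ f) x :=
    diffAt_of_contDiffOn hS hx (hf.fderiv_of_isOpen hS (m := ∞) (by simp))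
  have e : ∀ a b, hess f x a b = fderiv ℝ (fderiv ℝ f) x a b := by
    intro a b
    simp only [hess]
    rw [fderiv_clm_apply h1 (by fun_prop)]
    simp
  rw [e, e]
  have := (hf.contDiffAt (hS.mem_nhds hx)).isSymmSndFDerivAt (n := ∞) (by simp; norm_cast)
  exact this v w

theorem hess_add_left {F : Type*} [NormedAddCommGroup F] [NormedSpace ℝ F]
    {f : E → F} {x : E} (v v' w : E) : hess f x (v + v') w = hess f x v w + hess f x v' w := by
  simp [hess]

theorem hess_smul_left {F : Type*} [NormedAddCommGroup F] [NormedSpace ℝ F]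
    {f : E → F} {x : E} (c : ℝ) (v w : E) : hess f x (c • v) w = c • hess f x v w := by
  simp [hess]

theorem wder_wderBar_eq_hess {f : E → ℂ} {S : Set E} {x : E} (hS : IsOpen S) (hx : x ∈ S)
    (hf : ContDiffOn ℝ ∞ f S) (a b : E) :
    wder (fun y => wderBar f b y) a x = (1/4 : ℂ) * (hess f x a b + Complex.I * hess f x a (Complex.I • b)
      - Complex.I * hess f x (Complex.I • a) b + hess f x (Complex.I • a) (Complex.I • b)) := by
  have d1 : ∀ w, DifferentiableAt ℝ (fun y => fderiv ℝ f y w) x := fun w =>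
    diffAt_of_contDiffOn hS hx (contDiffOn_fderiv_apply hS hf w)
  simp only [wder, wderBar, hess]
  rw [fderiv_const_mul (.fun_add (d1 _) ((d1 _).const_mul _)), fderiv_fun_add (d1 _) ((d1 _).const_mul _),
    fderiv_const_mul (d1 _)]
  simp
  linear_combination (-1/4 * fderiv ℝ (fun y => fderiv ℝ f y (Complex.I • b)) x (Complex.I • a)) * Complex.I_sq

theorem wderBar_wder_eq_hess {f : E → ℂ} {S : Set E} {x : E} (hS : IsOpen S) (hx : x ∈ S)
    (hf : ContDiffOn ℝ ∞ f S) (a b : E) :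
    wderBar (fun y => wder f b y) a x = (1/4 : ℂ) * (hess f x a b - Complex.I * hess f x a (Complex.I • b)
      + Complex.I * hess f x (Complex.I • a) b + hess f x (Complex.I • a) (Complex.I • b)) := by
  have d1 : ∀ w, DifferentiableAt ℝ (fun y => fderiv ℝ f y w) x := fun w =>
    diffAt_of_contDiffOn hS hx (contDiffOn_fderiv_apply hS hf w)
  simp only [wder, wderBar, hess]
  rw [fderiv_const_mul (.fun_sub (d1 _) ((d1 _).const_mul _)), fderiv_fun_sub (d1 _) ((d1 _).const_mul _),
    fderiv_const_mul (d1 _)]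
  simp
  linear_combination (-1/4 * fderiv ℝ (fun y => fderiv ℝ f y (Complex.I • b)) x (Complex.I • a)) * Complex.I_sq

theorem wderBar_wderBar_eq_hess {f : E → ℂ} {S : Set E} {x : E} (hS : IsOpen S) (hx : x ∈ S)
    (hf : ContDiffOn ℝ ∞ f S) (a b : E) :
    wderBar (fun y => wderBar f b y) a x = (1/4 : ℂ) * (hess f x a b + Complex.I * hess f x a (Complex.I • b)
      + Complex.I * hess f x (Complex.I • a) b - hess f x (Complex.I • a) (Complex.I • b)) := by
  have d1 : ∀ w, DifferentiableAt ℝ (fun y => fderiv ℝ f y w) x := fun w =>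
    diffAt_of_contDiffOn hS hx (contDiffOn_fderiv_apply hS hf w)
  simp only [wderBar, hess]
  rw [fderiv_const_mul (.fun_add (d1 _) ((d1 _).const_mul _)), fderiv_fun_add (d1 _) ((d1 _).const_mul _),
    fderiv_const_mul (d1 _)]
  simp
  linear_combination (1/4 * fderiv ℝ (fun y => fderiv ℝ f y (Complex.I • b)) x (Complex.I • a)) * Complex.I_sq

theorem wder_wderBar_comm {f : E → ℂ} {S : Set E} {x : E} (hS : IsOpen S) (hx : x ∈ S)
    (hf : ContDiffOn ℝ ∞ f S) (a b : E) :
    wder (fun y => wderBar f b y) a x = wderBar (fun y => wder f a y) b x := by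
  rw [wder_wderBar_eq_hess hS hx hf, wderBar_wder_eq_hess hS hx hf, hess_symm hS hx hf b a,
    hess_symm hS hx hf b, hess_symm hS hx hf _ a, hess_symm hS hx hf (Complex.I • b)]
  ring

theorem wderBar_wderBar_comm {f : E → ℂ} {S : Set E} {x : E} (hS : IsOpen S) (hx : x ∈ S)
    (hf : ContDiffOn ℝ ∞ f S) (a b : E) :
    wderBar (fun y => wderBar f b y) a x = wderBar (fun y => wderBar f a y) b x := by
  rw [wderBar_wderBar_eq_hess hS hx hf, wderBar_wderBar_eq_hess hS hx hf, hess_symm hS hx hf b a,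
    hess_symm hS hx hf b, hess_symm hS hx hf _ a, hess_symm hS hx hf (Complex.I • b)]
  ring

theorem wderBar_holo {f : E → ℂ} {x : E} (v : E) (hf : DifferentiableAt ℂ f x) :
    wderBar f v x = 0 := by
  have h : fderiv ℝ f x = (fderiv ℂ f x).restrictScalars ℝ :=
    (hf.hasFDerivAt.restrictScalars ℝ).fderiv
  simp only [wderBar, h]
  simp
  linear_combination (fderiv ℂ f x v) * Complex.I_sq

theorem holo_of_wderBar {f : E → ℂ} {x : E} (hf : DifferentiableAt ℝ f x)
    (h : ∀ v, wderBar f v x = 0) : DifferentiableAt ℂ f x := by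
  rw [differentiableAt_iff_restrictScalars ℝ hf]
  have hI : ∀ v, fderiv ℝ f x (Complex.I • v) = Complex.I * fderiv ℝ f x v := by
    intro v
    have := h v
    simp only [wderBar] at this
    linear_combination (-2 * Complex.I) * this + (fderiv ℝ f x (Complex.I • v)) * Complex.I_sq
  refine ⟨{ toFun := fun v => fderiv ℝ f x v, map_add' := by simp, map_smul' := ?_,
            cont := (fderiv ℝ f x).cont }, ?_⟩
  · intro c v
    have h1 : c • v = c.re • v + c.im • (Complex.I • v) := by
      conv_lhs => rw [← Complex.re_add_im c]
      rw [add_smul, mul_smul]; simp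
    rw [h1, map_add, map_smul, map_smul, hI]
    simp only [Complex.real_smul, RingHom.id_apply, smul_eq_mul]
    conv_rhs => rw [← Complex.re_add_im c]
    ring
  · ext v; rfl

end wirt
end

noncomputable section
open MeasureTheory Set
open scoped ENNReal ComplexOrder ContDiff

section testf
variable {n : ℕ}

/-- Test functions on `D`. -/
def IsTest (D : Set (Fin n → ℂ)) (θ : (Fin n → ℂ) → ℂ) : Prop :=
  ContDiff ℝ ∞ θ ∧ HasCompactSupport θ ∧ tsupport θ ⊆ D

variable {D : Set (Fin n → ℂ)} {θ θ' : (Fin n → ℂ) → ℂ}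

theorem IsTest.add (h : IsTest D θ) (h' : IsTest D θ') : IsTest D (fun x => θ x + θ' x) :=
  ⟨h.1.add h'.1, h.2.1.add h'.2.1, (tsupport_add θ θ').trans (union_subset h.2.2 h'.2.2)⟩

theorem IsTest.mul_left (hD : IsOpen D) {a : (Fin n → ℂ) → ℂ} (ha : ContDiffOn ℝ ∞ a D)
    (h : IsTest D θ) : IsTest D (fun x => a x * θ x) := by
  refine ⟨?_, h.2.1.mul_left, (tsupport_mul_subset_right (f := a) (g := θ)).trans h.2.2⟩
  rw [contDiff_iff_contDiffAt]
  intro x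
  by_cases hx : x ∈ D
  · exact (ha.contDiffAt (hD.mem_nhds hx)).mul h.1.contDiffAt
  · have : (fun x => a x * θ x) =ᶠ[nhds x] fun _ => 0 := by
      have hx' : x ∉ tsupport θ := fun h' => hx (h.2.2 h')
      filter_upwards [notMem_tsupport_iff_eventuallyEq.1 hx'] with y hy
      simp [hy]
    exact contDiffAt_const.congr_of_eventuallyEq this

theorem IsTest.const_mul (c : ℂ) (h : IsTest D θ) : IsTest D (fun x => c * θ x) :=
  ⟨contDiff_const.mul h.1, h.2.1.mul_left,
    (tsupport_mul_subset_right (f := fun _ => c) (g := θ)).trans h.2.2⟩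

theorem IsTest.neg (h : IsTest D θ) : IsTest D (fun x => - θ x) := by
  simpa using h.const_mul (-1)

theorem IsTest.sub (h : IsTest D θ) (h' : IsTest D θ') : IsTest D (fun x => θ x - θ' x) := by
  simpa [sub_eq_add_neg] using h.add h'.neg

theorem IsTest.zero : IsTest D (fun _ => (0:ℂ)) := by
  refine ⟨contDiff_const, HasCompactSupport.zero, ?_⟩
  have : tsupport (fun _ : Fin n → ℂ => (0:ℂ)) = ∅ := by
    rw [tsupport_eq_empty_iff]; rfl
  rw [this]; simp

theorem IsTest.sum {ι : Type*} (s : Finset ι) {f : ι → (Fin n → ℂ) → ℂ} (h : ∀ i, IsTest D (f i)) :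
    IsTest D (fun x => ∑ i ∈ s, f i x) := by
  classical
  induction s using Finset.induction_on with
  | empty => simpa using IsTest.zero
  | insert a s ha ih => simp only [Finset.sum_insert ha]; exact (h a).add ih

theorem IsTest.mul (h : IsTest D θ) (h' : IsTest D θ') : IsTest D (fun x => θ x * θ' x) :=
  ⟨h.1.mul h'.1, h'.2.1.mul_left, (tsupport_mul_subset_right (f := θ) (g := θ')).trans h'.2.2⟩

theorem IsTest.conj (h : IsTest D θ) : IsTest D (fun x => (starRingEnd ℂ) (θ x)) := by
  refine ⟨Complex.conjCLE.contDiff.comp h.1, h.2.1.comp_left (g := starRingEnd ℂ) (by simp), ?_⟩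
  exact (tsupport_comp_subset (g := starRingEnd ℂ) (by simp) θ).trans h.2.2

theorem tsupport_wder (v : Fin n → ℂ) : tsupport (fun x => wder θ v x) ⊆ tsupport θ := by
  refine closure_minimal ?_ isClosed_closure
  intro x hx
  by_contra hc
  apply hx
  have h0 : θ =ᶠ[nhds x] fun _ => 0 := notMem_tsupport_iff_eventuallyEq.1 hc
  show _root_.wder θ v x = 0
  rw [wder_congr v h0]
  simp [wder]

theorem tsupport_wderBar (v : Fin n → ℂ) : tsupport (fun x => wderBar θ v x) ⊆ tsupport θ := by
  refine closure_minimal ?_ isClosed_closure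
  intro x hx
  by_contra hc
  apply hx
  have h0 : θ =ᶠ[nhds x] fun _ => 0 := notMem_tsupport_iff_eventuallyEq.1 hc
  show _root_.wderBar θ v x = 0
  rw [wderBar_congr v h0]
  simp [wderBar]

theorem IsTest.wder (h : IsTest D θ) (v : Fin n → ℂ) : IsTest D (fun x => wder θ v x) :=
  ⟨contDiff_wder h.1 v, h.2.1.of_isClosed_subset isClosed_closure (tsupport_wder v),
    (tsupport_wder v).trans h.2.2⟩

theorem IsTest.wderBar (h : IsTest D θ) (v : Fin n → ℂ) : IsTest D (fun x => wderBar θ v x) :=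
  ⟨contDiff_wderBar h.1 v, h.2.1.of_isClosed_subset isClosed_closure (tsupport_wderBar v),
    (tsupport_wderBar v).trans h.2.2⟩

theorem IsTest.integrable (h : IsTest D θ) : Integrable θ volume :=
  h.1.continuous.integrable_of_hasCompactSupport h.2.1

theorem IsTest.diff (h : IsTest D θ) (x) : DifferentiableAt ℝ θ x :=
  h.1.differentiable (by simp) x

theorem integral_fderiv_test (h : IsTest D θ) (v : Fin n → ℂ) :
    ∫ x, fderiv ℝ θ x v = 0 := by
  have hc : HasCompactSupport (fun x => fderiv ℝ θ x v) := h.2.1.fderiv_apply ℝ v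
  have hcont : Continuous (fun x => fderiv ℝ θ x v) :=
    (h.1.continuous_fderiv (by simp)).clm_apply continuous_const
  have := integral_mul_fderiv_eq_neg_fderiv_mul_of_integrable (μ := (volume : Measure (Fin n → ℂ)))
    (f := fun _ => (1:ℂ)) (g := θ) (v := v) (by simp) (by simpa using hcont.integrable_of_hasCompactSupport hc)
    (by simpa using h.integrable) (fun _ _ => by fun_prop) (fun _ _ => h.diff _)
  simpa using this

theorem integral_wder_test (h : IsTest D θ) (v : Fin n → ℂ) : ∫ x, wder θ v x = 0 := by
  have hc : ∀ v, Integrable (fun x => fderiv ℝ θ x v) := fun v =>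
    ((h.1.continuous_fderiv (by simp)).clm_apply continuous_const).integrable_of_hasCompactSupport
      (h.2.1.fderiv_apply ℝ v)
  simp only [_root_.wder]
  rw [integral_const_mul, integral_sub (hc _) ((hc _).const_mul _), integral_const_mul,
    integral_fderiv_test h, integral_fderiv_test h]
  simp

theorem integral_wderBar_test (h : IsTest D θ) (v : Fin n → ℂ) : ∫ x, wderBar θ v x = 0 := by
  have hc : ∀ v, Integrable (fun x => fderiv ℝ θ x v) := fun v =>
    ((h.1.continuous_fderiv (by simp)).clm_apply continuous_const).integrable_of_hasCompactSupport
      (h.2.1.fderiv_apply ℝ v)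
  simp only [_root_.wderBar]
  rw [integral_const_mul, integral_add (hc _) ((hc _).const_mul _), integral_const_mul,
    integral_fderiv_test h, integral_fderiv_test h]
  simp

end testf
end

noncomputable section
open MeasureTheory Set
open scoped ENNReal ComplexOrder ContDiff

section bk
variable {n : ℕ}

/-- coordinate vector -/
def ev (j : Fin n) : Fin n → ℂ := Pi.single j 1

/-- weak `∂̄`-type operator in the unweighted picture. -/
def Zb (ψ : (Fin n → ℂ) → ℝ) (j : Fin n) (F : (Fin n → ℂ) → ℂ) (x : Fin n → ℂ) : ℂ :=
  wderBar F (ev j) x + (1 / 2) * wderBar (fun q => (ψ q : ℂ)) (ev j) x * F x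

/-- formal adjoint of `Zb`. -/
def Zs (ψ : (Fin n → ℂ) → ℝ) (j : Fin n) (F : (Fin n → ℂ) → ℂ) (x : Fin n → ℂ) : ℂ :=
  - wder F (ev j) x + (1 / 2) * wder (fun q => (ψ q : ℂ)) (ev j) x * F x

/-- Levi form coefficient -/
def Lv (ψ : (Fin n → ℂ) → ℝ) (v w : Fin n → ℂ) (x : Fin n → ℂ) : ℂ :=
  wder (fun y => wderBar (fun q => (ψ q : ℂ)) w y) v x

variable {D : Set (Fin n → ℂ)} {ψ : (Fin n → ℂ) → ℝ} {F G : (Fin n → ℂ) → ℂ}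

theorem IsTest.Zb (hD : IsOpen D) (hψ : ContDiffOn ℝ ∞ ψ D) (h : IsTest D F) (j : Fin n) :
    IsTest D (fun x => Zb ψ j F x) := by
  refine (h.wderBar (ev j)).add (IsTest.mul_left hD ?_ h)
  exact contDiffOn_const.mul (contDiffOn_wderBar hD (contDiffOn_ofReal hψ) _)

theorem IsTest.Zs (hD : IsOpen D) (hψ : ContDiffOn ℝ ∞ ψ D) (h : IsTest D F) (j : Fin n) :
    IsTest D (fun x => Zs ψ j F x) := by
  refine (h.wder (ev j)).neg.add (IsTest.mul_left hD ?_ h)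
  exact contDiffOn_const.mul (contDiffOn_wder hD (contDiffOn_ofReal hψ) _)

theorem IsTest.eq_zero (h : IsTest D F) {x} (hx : x ∉ D) : F x = 0 :=
  image_eq_zero_of_notMem_tsupport fun h' => hx (h.2.2 h')

theorem Zs_adj (hD : IsOpen D) (hψ : ContDiffOn ℝ ∞ ψ D) (hF : IsTest D F) (hG : IsTest D G)
    (j : Fin n) :
    ∫ x, Zs ψ j F x * (starRingEnd ℂ) (G x) = ∫ x, F x * (starRingEnd ℂ) (Zb ψ j G x) := by
  have hi1 := ((hF.Zs hD hψ j).mul hG.conj).integrable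
  have hi2 := (hF.mul (hG.Zb hD hψ j).conj).integrable
  rw [← sub_eq_zero, ← integral_sub hi1 hi2]
  have h0 := integral_wder_test (hF.mul hG.conj).neg (ev j)
  rw [← h0]
  congr 1
  ext x
  rw [wder_neg, wder_mul _ (hF.diff x) (hG.conj.diff x), wder_conj _ (hG.diff x)]
  simp only [Zs, Zb]
  by_cases hx : x ∈ D
  · have h1 := conj_wderBar_ofReal (ev j) (diffAt_of_contDiffOn hD hx hψ)
    simp only [map_add, map_mul, h1]
    simp [map_ofNat]
    ring
  · rw [hF.eq_zero hx]; simp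

theorem Z_comm (hD : IsOpen D) (hψ : ContDiffOn ℝ ∞ ψ D) (hF : IsTest D F) (j k : Fin n)
    {x : Fin n → ℂ} (hx : x ∈ D) :
    Zb ψ k (fun y => Zs ψ j F y) x = Zs ψ j (fun y => Zb ψ k F y) x + Lv ψ (ev j) (ev k) x * F x := by
  have hc := contDiffOn_ofReal hψ
  have hFd := hF.diff x
  have hw := (hF.wder (ev j)).diff x
  have hwb := (hF.wderBar (ev k)).diff x
  have ha : DifferentiableAt ℝ (fun y => wder (fun q => (ψ q : ℂ)) (ev j) y) x :=
    diffAt_of_contDiffOn hD hx (contDiffOn_wder hD hc _)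
  have hb : DifferentiableAt ℝ (fun y => wderBar (fun q => (ψ q : ℂ)) (ev k) y) x :=
    diffAt_of_contDiffOn hD hx (contDiffOn_wderBar hD hc _)
  have e1 : wderBar (fun y => Zs ψ j F y) (ev k) x =
      - wderBar (fun y => wder F (ev j) y) (ev k) x
      + (1/2) * (Lv ψ (ev j) (ev k) x * F x + wder (fun q => (ψ q : ℂ)) (ev j) x * wderBar F (ev k) x) := by
    simp only [Zs, mul_assoc]
    rw [wderBar_add _ hw.fun_neg ((ha.fun_mul hFd).const_mul _), wderBar_neg, wderBar_const_mul _ _ (ha.fun_mul hFd),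
      wderBar_mul _ ha hFd, Lv, wder_wderBar_comm hD hx hc]
  have e2 : wder (fun y => Zb ψ k F y) (ev j) x =
      wder (fun y => wderBar F (ev k) y) (ev j) x
      + (1/2) * (Lv ψ (ev j) (ev k) x * F x + wderBar (fun q => (ψ q : ℂ)) (ev k) x * wder F (ev j) x) := by
    simp only [Zb, mul_assoc]
    rw [wder_add _ hwb ((hb.fun_mul hFd).const_mul _), wder_const_mul _ _ (hb.fun_mul hFd),
      wder_mul _ hb hFd, Lv]
  have e3 : wder (fun y => wderBar F (ev k) y) (ev j) x = wderBar (fun y => wder F (ev j) y) (ev k) x :=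
    wder_wderBar_comm isOpen_univ (mem_univ x) hF.1.contDiffOn _ _
  unfold Zb Zs at *
  rw [e1, e2, e3]
  ring

theorem contDiffOn_Lv (hD : IsOpen D) (hψ : ContDiffOn ℝ ∞ ψ D) (v w : Fin n → ℂ) :
    ContDiffOn ℝ ∞ (fun x => Lv ψ v w x) D :=
  contDiffOn_wder hD (contDiffOn_wderBar hD (contDiffOn_ofReal hψ) _) _

/-- one term of the Bochner-Kodaira identity -/
theorem bk_term (hD : IsOpen D) (hψ : ContDiffOn ℝ ∞ ψ D) (hF : IsTest D F) (hG : IsTest D G)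
    (j k : Fin n) :
    ∫ x, Zs ψ j F x * (starRingEnd ℂ) (Zs ψ k G x)
      = (∫ x, Zb ψ k F x * (starRingEnd ℂ) (Zb ψ j G x))
        + ∫ x, F x * (starRingEnd ℂ) (Lv ψ (ev k) (ev j) x * G x) := by
  rw [Zs_adj hD hψ hF (hG.Zs hD hψ k) j]
  have e : ∀ x, F x * (starRingEnd ℂ) (Zb ψ j (fun y => Zs ψ k G y) x)
      = F x * (starRingEnd ℂ) (Zs ψ k (fun y => Zb ψ j G y) x)
        + F x * (starRingEnd ℂ) (Lv ψ (ev k) (ev j) x * G x) := by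
    intro x
    by_cases hx : x ∈ D
    · rw [Z_comm hD hψ hG k j hx, map_add, mul_add]
    · rw [hF.eq_zero hx]; simp
  simp_rw [e]
  have hL := IsTest.mul_left hD (contDiffOn_Lv hD hψ (ev k) (ev j)) hG
  rw [integral_add (hF.mul ((hG.Zb hD hψ j).Zs hD hψ k).conj).integrable (hF.mul hL.conj).integrable]
  congr 1
  have := Zs_adj hD hψ (hG.Zb hD hψ j) hF k
  have h2 := congrArg (starRingEnd ℂ) this
  rw [← integral_conj, ← integral_conj] at h2
  simp only [map_mul, Complex.conj_conj] at h2
  calc _ = ∫ x, (starRingEnd ℂ) (Zs ψ k (fun y => Zb ψ j G y) x) * F x := by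
        congr 1; ext x; ring
    _ = _ := by rw [h2]; congr 1; ext x; ring

theorem re_sum_sum_mul_conj {ι : Type*} [Fintype ι] (a : ι → ℂ) :
    ‖∑ j, a j‖ ^ 2 = (∑ j, ∑ k, a j * (starRingEnd ℂ) (a k)).re := by
  rw [← Finset.sum_mul_sum, ← map_sum, Complex.mul_conj, Complex.ofReal_re, Complex.normSq_eq_norm_sq]

theorem norm_sub_sq_c (a b : ℂ) :
    ‖a - b‖ ^ 2 = ‖a‖^2 + ‖b‖^2 - 2 * (a * (starRingEnd ℂ) b).re := by
  rw [← Complex.normSq_eq_norm_sq, ← Complex.normSq_eq_norm_sq, ← Complex.normSq_eq_norm_sq,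
    Complex.normSq_sub]

theorem bk_ineq (hD : IsOpen D) (hψ : ContDiffOn ℝ ∞ ψ D) (γ : Fin n → (Fin n → ℂ) → ℂ)
    (hγ : ∀ j, IsTest D (γ j)) :
    ∫ x, (∑ j, ∑ k, Lv ψ (ev j) (ev k) x * γ j x * (starRingEnd ℂ) (γ k x)).re
      ≤ (∫ x, ‖∑ j, Zs ψ j (γ j) x‖ ^ 2)
        + (1/2) * ∑ j, ∑ k, ∫ x, ‖Zb ψ j (γ k) x - Zb ψ k (γ j) x‖ ^ 2 := by
  have iS : ∀ j k, Integrable fun x => Zs ψ j (γ j) x * (starRingEnd ℂ) (Zs ψ k (γ k) x) := fun j k =>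
    (((hγ j).Zs hD hψ j).mul ((hγ k).Zs hD hψ k).conj).integrable
  have iB : ∀ j k, Integrable fun x => Zb ψ k (γ j) x * (starRingEnd ℂ) (Zb ψ j (γ k) x) := fun j k =>
    (((hγ j).Zb hD hψ k).mul ((hγ k).Zb hD hψ j).conj).integrable
  have iL : ∀ j k, Integrable fun x => Lv ψ (ev j) (ev k) x * γ j x * (starRingEnd ℂ) (γ k x) := fun j k =>
    ((IsTest.mul_left hD (contDiffOn_Lv hD hψ _ _) (hγ j)).mul (hγ k).conj).integrable
  have iN : ∀ j k, Integrable fun x => ‖Zb ψ j (γ k) x‖ ^ 2 := by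
    intro j k
    have := (((hγ k).Zb hD hψ j).mul ((hγ k).Zb hD hψ j).conj).integrable.re
    refine this.congr (Filter.Eventually.of_forall fun x => ?_)
    show (_ : ℂ).re = _
    rw [Complex.mul_conj, Complex.ofReal_re, Complex.normSq_eq_norm_sq]
  have iSr : ∀ j k, Integrable fun x => (Zs ψ j (γ j) x * (starRingEnd ℂ) (Zs ψ k (γ k) x)).re :=
    fun j k => (iS j k).re
  have iBr : ∀ j k, Integrable fun x => (Zb ψ k (γ j) x * (starRingEnd ℂ) (Zb ψ j (γ k) x)).re :=
    fun j k => (iB j k).re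
  have iLr : ∀ j k, Integrable fun x => (Lv ψ (ev j) (ev k) x * γ j x * (starRingEnd ℂ) (γ k x)).re :=
    fun j k => (iL j k).re
  have h1 : ∫ x, ‖∑ j, Zs ψ j (γ j) x‖ ^ 2
      = ∑ j, ∑ k, (∫ x, Zs ψ j (γ j) x * (starRingEnd ℂ) (Zs ψ k (γ k) x)).re := by
    simp_rw [re_sum_sum_mul_conj, Complex.re_sum]
    rw [integral_finsetSum _ fun j _ => integrable_finsetSum _ fun k _ => iSr j k]
    refine Finset.sum_congr rfl fun j _ => ?_
    rw [integral_finsetSum _ fun k _ => iSr j k]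
    exact Finset.sum_congr rfl fun k _ => integral_re (iS j k)
  have h2 : ∫ x, (∑ j, ∑ k, Lv ψ (ev j) (ev k) x * γ j x * (starRingEnd ℂ) (γ k x)).re
      = ∑ j, ∑ k, (∫ x, Lv ψ (ev j) (ev k) x * γ j x * (starRingEnd ℂ) (γ k x)).re := by
    simp_rw [Complex.re_sum]
    rw [integral_finsetSum _ fun j _ => integrable_finsetSum _ fun k _ => iLr j k]
    refine Finset.sum_congr rfl fun j _ => ?_
    rw [integral_finsetSum _ fun k _ => iLr j k]
    exact Finset.sum_congr rfl fun k _ => integral_re (iL j k)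
  have h3 : ∀ j k, ∫ x, ‖Zb ψ j (γ k) x - Zb ψ k (γ j) x‖ ^ 2
      = (∫ x, ‖Zb ψ j (γ k) x‖ ^ 2) + (∫ x, ‖Zb ψ k (γ j) x‖ ^ 2)
        - 2 * (∫ x, Zb ψ j (γ k) x * (starRingEnd ℂ) (Zb ψ k (γ j) x)).re := by
    intro j k
    simp_rw [norm_sub_sq_c]
    have hre : ∫ x, (Zb ψ j (γ k) x * (starRingEnd ℂ) (Zb ψ k (γ j) x)).re
        = (∫ x, Zb ψ j (γ k) x * (starRingEnd ℂ) (Zb ψ k (γ j) x)).re := integral_re (iB k j)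
    rw [integral_sub (by exact (iN j k).add (iN k j)) ((iBr k j).const_mul 2), integral_add (iN j k) (iN k j),
      integral_const_mul, hre]
  have h4 : ∀ j k, (∫ x, γ j x * (starRingEnd ℂ) (Lv ψ (ev k) (ev j) x * γ k x)).re
      = (∫ x, Lv ψ (ev k) (ev j) x * γ k x * (starRingEnd ℂ) (γ j x)).re := by
    intro j k
    rw [← Complex.conj_re, ← integral_conj]
    congr 2; ext x; simp; ring
  have h5 : ∫ x, ‖∑ j, Zs ψ j (γ j) x‖ ^ 2
      = (∑ j, ∑ k, (∫ x, Zb ψ k (γ j) x * (starRingEnd ℂ) (Zb ψ j (γ k) x)).re)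
        + ∫ x, (∑ j, ∑ k, Lv ψ (ev j) (ev k) x * γ j x * (starRingEnd ℂ) (γ k x)).re := by
    rw [h1, h2]
    simp_rw [bk_term hD hψ (hγ _) (hγ _), Complex.add_re, h4, Finset.sum_add_distrib]
    congr 1
    rw [Finset.sum_comm]
  have h6 : (1/2 : ℝ) * ∑ j, ∑ k, ∫ x, ‖Zb ψ j (γ k) x - Zb ψ k (γ j) x‖ ^ 2
      = (∑ j, ∑ k, ∫ x, ‖Zb ψ j (γ k) x‖ ^ 2)
        - ∑ j, ∑ k, (∫ x, Zb ψ k (γ j) x * (starRingEnd ℂ) (Zb ψ j (γ k) x)).re := by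
    simp_rw [h3, Finset.sum_sub_distrib, Finset.sum_add_distrib, ← Finset.mul_sum]
    rw [Finset.sum_comm (f := fun j k => ∫ x, ‖Zb ψ k (γ j) x‖ ^ 2),
      Finset.sum_comm (f := fun j k => (∫ x, Zb ψ j (γ k) x * (starRingEnd ℂ) (Zb ψ k (γ j) x)).re)]
    ring
  rw [h5, h6]
  have : 0 ≤ ∑ j, ∑ k, ∫ x, ‖Zb ψ j (γ k) x‖ ^ 2 :=
    Finset.sum_nonneg fun j _ => Finset.sum_nonneg fun k _ => integral_nonneg fun x => by positivity
  linarith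

end bk
end

noncomputable section
open MeasureTheory Set
open scoped ENNReal ComplexOrder ContDiff Topology

section moll
variable {n : ℕ}

/-- unnormalised radial bump. -/
def rho0 (n : ℕ) (ε : ℝ) (w : Fin n → ℂ) : ℝ :=
  Real.smoothTransition (1 - ∑ j, Complex.normSq (w j) / ε ^ 2)

/-- normalised radial bump. -/
def rho (n : ℕ) (ε : ℝ) (w : Fin n → ℂ) : ℝ :=
  (∫ y, rho0 n ε y)⁻¹ * rho0 n ε w

/-- complex-valued version -/
def rhoC (n : ℕ) (ε : ℝ) (w : Fin n → ℂ) : ℂ := (rho n ε w : ℂ)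

theorem contDiff_normSq : ContDiff ℝ ∞ Complex.normSq := by
  have : (Complex.normSq : ℂ → ℝ) = fun z => z.re * z.re + z.im * z.im := by
    ext z; exact Complex.normSq_apply z
  rw [this]
  exact (Complex.reCLM.contDiff.mul Complex.reCLM.contDiff).add
    (Complex.imCLM.contDiff.mul Complex.imCLM.contDiff)

theorem rho0_contDiff (ε : ℝ) : ContDiff ℝ ∞ (rho0 n ε) := by
  refine Real.smoothTransition.contDiff.comp (contDiff_const.sub ?_)
  refine ContDiff.sum fun j _ => ContDiff.div_const ?_ _
  exact contDiff_normSq.comp (contDiff_apply ℝ ℂ j)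

theorem rho0_nonneg (ε : ℝ) (w : Fin n → ℂ) : 0 ≤ rho0 n ε w := Real.smoothTransition.nonneg _

theorem rho0_eq_zero {ε : ℝ} (hε : 0 < ε) {w : Fin n → ℂ} (h : w ∉ Metric.ball 0 ε) :
    rho0 n ε w = 0 := by
  apply Real.smoothTransition.zero_of_nonpos
  have h1 : ε ≤ ‖w‖ := by simpa using h
  have h2 : ∃ j, ε ≤ ‖w j‖ := by
    by_contra hc
    push Not at hc
    exact absurd ((pi_norm_lt_iff hε).2 hc) (not_lt.2 h1)
  obtain ⟨j, hj⟩ := h2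
  have h3 : 1 ≤ Complex.normSq (w j) / ε ^ 2 := by
    rw [le_div_iff₀ (by positivity), Complex.normSq_eq_norm_sq, one_mul]
    gcongr
  have h4 : Complex.normSq (w j) / ε ^ 2 ≤ ∑ j, Complex.normSq (w j) / ε ^ 2 :=
    Finset.single_le_sum (f := fun j => Complex.normSq (w j) / ε ^ 2)
      (fun i _ => div_nonneg (Complex.normSq_nonneg _) (by positivity)) (Finset.mem_univ j)
  linarith

theorem rho0_tsupport {ε : ℝ} (hε : 0 < ε) : tsupport (rho0 n ε) ⊆ Metric.closedBall 0 ε := by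
  refine closure_minimal (fun x hx => ?_) Metric.isClosed_closedBall
  by_contra hc
  exact hx (rho0_eq_zero hε fun h => hc (Metric.ball_subset_closedBall h))

theorem rho0_hcs {ε : ℝ} (hε : 0 < ε) : HasCompactSupport (rho0 n ε) :=
  (isCompact_closedBall _ _).of_isClosed_subset isClosed_closure (rho0_tsupport hε)

theorem rho0_int_pos {ε : ℝ} (hε : 0 < ε) : 0 < ∫ y, rho0 n ε y := by
  refine (rho0_contDiff ε).continuous.integral_pos_of_hasCompactSupport_nonneg_nonzero
    (rho0_hcs hε) (rho0_nonneg ε) (x := 0) ?_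
  simp [rho0]

theorem rho_contDiff (ε : ℝ) : ContDiff ℝ ∞ (rho n ε) := contDiff_const.mul (rho0_contDiff ε)

theorem rho_nonneg {ε : ℝ} (hε : 0 < ε) (w : Fin n → ℂ) : 0 ≤ rho n ε w :=
  mul_nonneg (inv_nonneg.2 (rho0_int_pos hε).le) (rho0_nonneg _ _)

theorem rho_eq_zero {ε : ℝ} (hε : 0 < ε) {w : Fin n → ℂ} (h : w ∉ Metric.ball 0 ε) :
    rho n ε w = 0 := by rw [rho, rho0_eq_zero hε h, mul_zero]

theorem rho_hcs {ε : ℝ} (hε : 0 < ε) : HasCompactSupport (rho n ε) := (rho0_hcs hε).mul_left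

theorem rho_int {ε : ℝ} (hε : 0 < ε) : ∫ y, rho n ε y = 1 := by
  simp only [rho]
  rw [integral_const_mul, inv_mul_cancel₀ (rho0_int_pos hε).ne']

theorem rho_neg (ε : ℝ) (w : Fin n → ℂ) : rho n ε (-w) = rho n ε w := by
  simp [rho, rho0]

theorem rho_rot (ε θ : ℝ) (w : Fin n → ℂ) :
    rho n ε (Complex.exp (θ * Complex.I) • w) = rho n ε w := by
  have : Complex.normSq (Complex.exp (θ * Complex.I)) = 1 := by
    rw [Complex.normSq_eq_norm_sq, Complex.norm_exp_ofReal_mul_I]; simp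
  simp [rho, rho0, this]

theorem rhoC_contDiff (ε : ℝ) : ContDiff ℝ ∞ (rhoC n ε) :=
  Complex.ofRealCLM.contDiff.comp (rho_contDiff ε)

theorem rhoC_eq_zero {ε : ℝ} (hε : 0 < ε) {w : Fin n → ℂ} (h : w ∉ Metric.ball 0 ε) :
    rhoC n ε w = 0 := by rw [rhoC, rho_eq_zero hε h]; simp

theorem rhoC_hcs {ε : ℝ} (hε : 0 < ε) : HasCompactSupport (rhoC n ε) :=
  (rho_hcs hε).comp_left (g := fun x : ℝ => (x : ℂ)) (by simp)

theorem rhoC_neg (ε : ℝ) (w : Fin n → ℂ) : rhoC n ε (-w) = rhoC n ε w := by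
  rw [rhoC, rho_neg, rhoC]

theorem rhoC_int {ε : ℝ} (hε : 0 < ε) : ∫ y, rhoC n ε y = 1 := by
  simp only [rhoC]; rw [integral_complex_ofReal, rho_int hε]; simp

theorem measurePreserving_rot (θ : ℝ) :
    MeasurePreserving (fun w : Fin n → ℂ => Complex.exp (θ * Complex.I) • w) volume volume := by
  have h : ∀ _ : Fin n, MeasurePreserving (fun w : ℂ => Complex.exp (θ * Complex.I) * w) volume volume := by
    intro _
    have := (rotation (Circle.exp θ)).measurePreserving
    exact this
  have h2 := volume_preserving_pi h
  exact h2

/-- test function `y ↦ ρ_ε(x-y)` -/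
theorem rhoC_test {ε : ℝ} (hε : 0 < ε) (x : Fin n → ℂ) {D : Set (Fin n → ℂ)}
    (h : Metric.closedBall x ε ⊆ D) : IsTest D (fun y => rhoC n ε (x - y)) := by
  have hts : tsupport (fun y => rhoC n ε (x - y)) ⊆ Metric.closedBall x ε := by
    refine closure_minimal (fun y hy => ?_) Metric.isClosed_closedBall
    by_contra hc
    apply hy
    apply rhoC_eq_zero hε
    intro h'
    apply hc
    rw [mem_ball_zero_iff] at h'
    rw [mem_closedBall_iff_norm, norm_sub_rev]
    exact h'.le
  exact ⟨(rhoC_contDiff ε).comp (contDiff_const.sub contDiff_id),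
    (isCompact_closedBall _ _).of_isClosed_subset isClosed_closure hts, hts.trans h⟩

/-- mollification -/
def mo (ε : ℝ) (F : (Fin n → ℂ) → ℂ) (x : Fin n → ℂ) : ℂ :=
  ∫ y, F y * rhoC n ε (x - y)

theorem mo_eq_conv (ε : ℝ) (F : (Fin n → ℂ) → ℂ) :
    mo ε F = convolution F (rhoC n ε) (ContinuousLinearMap.mul ℝ ℂ) volume := by
  ext x; simp [mo, convolution_def]

theorem mo_mean_value {ε : ℝ} (hε : 0 < ε) {f : (Fin n → ℂ) → ℂ} {S : Set (Fin n → ℂ)}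
    (hS : IsOpen S) (hf : DifferentiableOn ℂ f S) {x : Fin n → ℂ} (hx : Metric.closedBall x ε ⊆ S) :
    mo ε f x = f x := by
  set B : Set (Fin n → ℂ) := Metric.closedBall 0 ε
  set h : (Fin n → ℂ) → ℂ := fun w => f (x - w) * rhoC n ε w with hh
  have e1 : mo ε f x = ∫ w, h w := by
    have := integral_sub_left_eq_self (fun y => f y * rhoC n ε (x - y)) volume x
    rw [mo, ← this]; simp [hh]
  have hmem : ∀ (θ : ℝ) (w), w ∈ B → x - Complex.exp (θ * Complex.I) • w ∈ Metric.closedBall x ε := by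
    intro θ w hw
    rw [mem_closedBall_iff_norm]
    simp only [sub_sub_cancel_left, norm_neg, norm_smul, Complex.norm_exp_ofReal_mul_I, one_mul]
    simpa [B] using hw
  have e2 : ∀ θ : ℝ, ∫ w, h w = ∫ w in B, f (x - Complex.exp (θ * Complex.I) • w) * rhoC n ε w := by
    intro θ
    have hm := (measurePreserving_rot (n := n) θ).integral_comp
      (Homeomorph.smulOfNeZero _ (Complex.exp_ne_zero (θ * Complex.I))).measurableEmbedding h
    rw [← hm, setIntegral_eq_integral_of_forall_compl_eq_zero]
    · refine integral_congr_ae (Filter.Eventually.of_forall fun w => ?_)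
      simp only [hh, rhoC, rho_rot]
    · intro w hw
      rw [rhoC_eq_zero hε (fun h' => hw (Metric.ball_subset_closedBall h')), mul_zero]
  have hfc : ContinuousOn f S := hf.continuousOn
  have hcont : ContinuousOn (fun p : ℝ × (Fin n → ℂ) =>
      f (x - Complex.exp (p.1 * Complex.I) • p.2) * rhoC n ε p.2) (Icc 0 (2 * Real.pi) ×ˢ B) := by
    refine ContinuousOn.mul (hfc.comp (by fun_prop) ?_) ?_
    · intro p hp
      exact hx (hmem _ _ hp.2)
    · exact ((rhoC_contDiff ε).continuous.comp continuous_snd).continuousOn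
  have hintg : Integrable (Function.uncurry fun (θ : ℝ) (w : Fin n → ℂ) =>
      f (x - Complex.exp (θ * Complex.I) • w) * rhoC n ε w)
      ((volume.restrict (Ioc 0 (2 * Real.pi))).prod (volume.restrict B)) := by
    rw [Measure.prod_restrict]
    have := hcont.integrableOn_compact (μ := volume.prod volume)
      (isCompact_Icc.prod (isCompact_closedBall _ _))
    exact this.mono_set (prod_mono Ioc_subset_Icc_self le_rfl)
  have e3 := integral_integral_swap hintg
  have e4 : ∫ θ in Ioc 0 (2 * Real.pi), ∫ w in B, f (x - Complex.exp (θ * Complex.I) • w) * rhoC n ε w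
      = (2 * Real.pi) • ∫ w, h w := by
    rw [← integral_congr_ae (Filter.Eventually.of_forall e2)]
    simp [Real.pi_pos.le]
  have e5 : ∀ w ∈ B, ∫ θ in Ioc 0 (2 * Real.pi), f (x - Complex.exp (θ * Complex.I) • w) * rhoC n ε w
      = (2 * Real.pi) • (f x * rhoC n ε w) := by
    intro w hw
    rw [integral_mul_const]
    have hd : DiffContOnCl ℂ (fun ζ : ℂ => f (x - ζ • w)) (Metric.ball 0 |1|) := by
      have : DifferentiableOn ℂ (fun ζ : ℂ => f (x - ζ • w)) (closure (Metric.ball 0 |1|)) := by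
        refine hf.comp (by fun_prop) ?_
        intro ζ hζ
        have hζ' : ‖ζ‖ ≤ 1 := by
          have := Metric.closure_ball_subset_closedBall hζ
          simpa using this
        apply hx
        rw [mem_closedBall_iff_norm]
        simp only [sub_sub_cancel_left, norm_neg, norm_smul]
        have : ‖w‖ ≤ ε := by simpa [B] using hw
        nlinarith [norm_nonneg ζ, norm_nonneg w]
      exact this.diffContOnCl
    have := hd.circleAverage
    rw [Real.circleAverage_def] at this
    simp only [circleMap, Complex.ofReal_one, one_mul, zero_add, zero_smul, sub_zero] at this
    rw [intervalIntegral.integral_of_le (by positivity)] at this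
    rw [← this]
    generalize (∫ (a : ℝ) in Ioc 0 (2 * Real.pi), f (x - Complex.exp (a * Complex.I) • w)) = J
    simp only [Complex.real_smul]
    have : (Real.pi : ℂ) ≠ 0 := by exact_mod_cast Real.pi_ne_zero
    push_cast
    field_simp
  have e6 : ∫ w in B, ∫ θ in Ioc 0 (2 * Real.pi), f (x - Complex.exp (θ * Complex.I) • w) * rhoC n ε w
      = (2 * Real.pi) • f x := by
    rw [setIntegral_congr_fun Metric.isClosed_closedBall.measurableSet e5, integral_smul,
      integral_const_mul, setIntegral_eq_integral_of_forall_compl_eq_zero, rhoC_int hε, mul_one]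
    intro w hw
    exact rhoC_eq_zero hε (fun h' => hw (Metric.ball_subset_closedBall h'))
  rw [e4, e6] at e3
  rw [e1]
  exact smul_right_injective ℂ (by positivity : (2 * Real.pi) ≠ 0) e3

end moll
end

noncomputable section
open MeasureTheory Set Filter
open scoped ENNReal ComplexOrder ContDiff Topology

section moll2
variable {n : ℕ}

theorem mo_contDiff {ε : ℝ} (hε : 0 < ε) {F : (Fin n → ℂ) → ℂ} (hF : LocallyIntegrable F volume) :
    ContDiff ℝ ∞ (mo ε F) := by
  rw [mo_eq_conv]
  exact (rhoC_hcs hε).contDiff_convolution_right (n := (⊤ : ℕ∞)) _ hF (rhoC_contDiff ε)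

theorem conv_integrable {ε : ℝ} (hε : 0 < ε) {F : (Fin n → ℂ) → ℂ} (hF : LocallyIntegrable F volume)
    {θ : (Fin n → ℂ) → ℂ} (hθ : Continuous θ) (hc : HasCompactSupport θ) :
    Integrable (fun y => F y * θ y) := by
  have := hF.integrable_smul_left_of_hasCompactSupport hθ hc
  simpa [mul_comm] using this

theorem fderiv_mo {ε : ℝ} (hε : 0 < ε) {F : (Fin n → ℂ) → ℂ} (hF : LocallyIntegrable F volume)
    (v x : Fin n → ℂ) :
    fderiv ℝ (mo ε F) x v = ∫ y, F y * (- fderiv ℝ (fun y => rhoC n ε (x - y)) y v) := by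
  have h := (rhoC_hcs (n := n) hε).hasFDerivAt_convolution_right (ContinuousLinearMap.mul ℝ ℂ) hF
    ((rhoC_contDiff ε).of_le (by norm_cast)) x
  rw [mo_eq_conv, h.fderiv, convolution_precompR_apply]
  · simp only [convolution_def, ContinuousLinearMap.mul_apply']
    refine integral_congr_ae (Eventually.of_forall fun y => ?_)
    have : HasFDerivAt (fun y => rhoC n ε (x - y)) ((fderiv ℝ (rhoC n ε) (x - y)).comp
        (-(ContinuousLinearMap.id ℝ (Fin n → ℂ)))) y := by
      refine HasFDerivAt.comp y (((rhoC_contDiff ε).differentiable (by simp)) (x - y)).hasFDerivAt ?_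
      exact (hasFDerivAt_id y).const_sub x
    simp [this.fderiv]
  · exact hF
  · exact (rhoC_hcs hε).fderiv ℝ
  · exact (rhoC_contDiff ε).continuous_fderiv (by simp)

theorem wderBar_mo {ε : ℝ} (hε : 0 < ε) {F : (Fin n → ℂ) → ℂ} (hF : LocallyIntegrable F volume)
    (v x : Fin n → ℂ) :
    wderBar (mo ε F) v x = ∫ y, F y * (- wderBar (fun y => rhoC n ε (x - y)) v y) := by
  have ht : IsTest univ (fun y => rhoC n ε (x - y)) := rhoC_test hε x (subset_univ _)
  have hi : ∀ v, Integrable fun y => F y * (- fderiv ℝ (fun y => rhoC n ε (x - y)) y v) := fun v =>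
    conv_integrable hε hF ((ht.1.continuous_fderiv (by simp)).clm_apply continuous_const).neg
      (ht.2.1.fderiv_apply ℝ v).neg
  simp only [wderBar]
  rw [fderiv_mo hε hF, fderiv_mo hε hF, ← integral_const_mul, ← integral_add (hi _) ((hi _).const_mul _),
    ← integral_const_mul]
  congr 1; ext y; ring

theorem wder_mo {ε : ℝ} (hε : 0 < ε) {F : (Fin n → ℂ) → ℂ} (hF : LocallyIntegrable F volume)
    (v x : Fin n → ℂ) :
    wder (mo ε F) v x = ∫ y, F y * (- wder (fun y => rhoC n ε (x - y)) v y) := by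
  have ht : IsTest univ (fun y => rhoC n ε (x - y)) := rhoC_test hε x (subset_univ _)
  have hi : ∀ v, Integrable fun y => F y * (- fderiv ℝ (fun y => rhoC n ε (x - y)) y v) := fun v =>
    conv_integrable hε hF ((ht.1.continuous_fderiv (by simp)).clm_apply continuous_const).neg
      (ht.2.1.fderiv_apply ℝ v).neg
  simp only [wder]
  rw [fderiv_mo hε hF, fderiv_mo hε hF, ← integral_const_mul, ← integral_sub (hi _) ((hi _).const_mul _),
    ← integral_const_mul]
  congr 1; ext y; ring

theorem lintegral_rho {ε : ℝ} (hε : 0 < ε) : ∫⁻ y, ENNReal.ofReal (rho n ε y) = 1 := by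
  rw [← ofReal_integral_eq_lintegral_ofReal
    ((rho_contDiff ε).continuous.integrable_of_hasCompactSupport (rho_hcs hε))
    (Eventually.of_forall fun y => rho_nonneg hε y), rho_int hε]
  simp

theorem sq_lintegral_rho_le {ε : ℝ} (hε : 0 < ε) {g : (Fin n → ℂ) → ℝ≥0∞} (hg : Measurable g) :
    (∫⁻ w, g w * ENNReal.ofReal (rho n ε w)) ^ 2 ≤ ∫⁻ w, g w ^ 2 * ENNReal.ofReal (rho n ε w) := by
  have hm : Measurable fun w => ENNReal.ofReal (rho n ε w) :=
    (rho_contDiff ε).continuous.measurable.ennreal_ofReal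
  set ν := volume.withDensity fun w => ENNReal.ofReal (rho n ε w)
  have h1 : ∀ f : (Fin n → ℂ) → ℝ≥0∞, Measurable f →
      ∫⁻ w, f w * ENNReal.ofReal (rho n ε w) = ∫⁻ w, f w ∂ν := by
    intro f hf
    rw [lintegral_withDensity_eq_lintegral_mul _ hm hf]
    simp [mul_comm]
  have hν : IsProbabilityMeasure ν := ⟨by
    rw [withDensity_apply _ MeasurableSet.univ, Measure.restrict_univ, lintegral_rho hε]⟩
  rw [h1 g hg, h1 _ (hg.pow_const 2)]
  have := ENNReal.lintegral_mul_le_Lp_mul_Lq ν (Real.HolderConjugate.two_two) hg.aemeasurable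
    (aemeasurable_const (b := (1 : ℝ≥0∞)))
  simp only [Pi.mul_apply, mul_one, ENNReal.one_rpow, lintegral_one, measure_univ] at this
  calc (∫⁻ w, g w ∂ν) ^ 2 ≤ ((∫⁻ w, g w ^ (2:ℝ) ∂ν) ^ (1 / 2 : ℝ)) ^ 2 := by gcongr
    _ = ∫⁻ w, g w ^ 2 ∂ν := by
      rw [← ENNReal.rpow_natCast, ← ENNReal.rpow_mul]; simp

theorem eLpNorm_two_sq (f : (Fin n → ℂ) → ℂ) (μ : Measure (Fin n → ℂ)) :
    eLpNorm f 2 μ ^ 2 = ∫⁻ x, ‖f x‖ₑ ^ 2 ∂μ := by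
  have := eLpNorm_nnreal_pow_eq_lintegral (f := f) (μ := μ) (p := 2) (by norm_num)
  simpa using this

theorem translation_tendsto {F : (Fin n → ℂ) → ℂ} (hF : MemLp F 2 volume) :
    Tendsto (fun w => eLpNorm (fun x => F (x - w) - F x) 2 volume) (𝓝 0) (𝓝 0) := by
  have hmp : ∀ w : Fin n → ℂ, MeasurePreserving (fun x : Fin n → ℂ => x - w) volume volume :=
    fun w => measurePreserving_sub_right volume w
  let g : C((Fin n → ℂ), C((Fin n → ℂ), (Fin n → ℂ))) :=
    (ContinuousMap.mk (fun a : (Fin n → ℂ) × (Fin n → ℂ) => a.2 - a.1)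
      (continuous_snd.sub continuous_fst)).curry
  have hmp' : ∀ w : Fin n → ℂ, MeasurePreserving (⇑(g w)) volume volume := hmp
  have hc : Continuous fun w : Fin n → ℂ => Lp.compMeasurePreserving (g w) (hmp' w) (hF.toLp F) :=
    Continuous.compMeasurePreservingLp (f := fun _ => hF.toLp F) continuous_const g.continuous
      hmp' (by simp)
  have h1 := hc.tendsto 0
  rw [tendsto_iff_edist_tendsto_0] at h1
  refine h1.congr fun w => ?_
  rw [Lp.toLp_compMeasurePreserving, Lp.toLp_compMeasurePreserving, Lp.edist_toLp_toLp]
  congr 1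
  ext x
  show F (x - w) - F (x - 0) = _
  rw [sub_zero]

theorem mo_congr {F G : (Fin n → ℂ) → ℂ} (h : F =ᵐ[volume] G) (ε : ℝ) : mo ε F = mo ε G := by
  ext x
  refine integral_congr_ae ?_
  filter_upwards [h] with y hy
  rw [hy]

theorem mo_sub_eq {ε : ℝ} (hε : 0 < ε) {F : (Fin n → ℂ) → ℂ} (hF : LocallyIntegrable F volume)
    (x : Fin n → ℂ) : mo ε F x - F x = ∫ w, (F (x - w) - F x) * rhoC n ε w := by
  have e1 : mo ε F x = ∫ w, F (x - w) * rhoC n ε w := by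
    have := integral_sub_left_eq_self (fun y => F y * rhoC n ε (x - y)) volume x
    rw [mo, ← this]; simp
  have ht : IsTest univ (fun y => rhoC n ε (x - y)) := rhoC_test hε x (subset_univ _)
  have hi : Integrable fun w => F (x - w) * rhoC n ε w := by
    have := (conv_integrable hε hF ht.1.continuous ht.2.1).comp_sub_left x
    simpa using this
  have hi2 : Integrable fun w => F x * rhoC n ε w :=
    ((rhoC_contDiff ε).continuous.integrable_of_hasCompactSupport (rhoC_hcs hε)).const_mul _
  simp_rw [sub_mul]
  rw [integral_sub hi hi2, integral_const_mul, rhoC_int hε, mul_one, e1]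

theorem mo_sub_sq_le {ε : ℝ} (hε : 0 < ε) {F : (Fin n → ℂ) → ℂ} (hF : MemLp F 2 volume)
    (hFm : StronglyMeasurable F) {c : ℝ≥0∞}
    (hc : ∀ w ∈ Metric.ball (0 : Fin n → ℂ) ε, eLpNorm (fun x => F (x - w) - F x) 2 volume ≤ c) :
    eLpNorm (fun x => mo ε F x - F x) 2 volume ≤ c := by
  have hloc : LocallyIntegrable F volume := hF.locallyIntegrable (by norm_num)
  have hm : Measurable fun w => ENNReal.ofReal (rho n ε w) :=
    (rho_contDiff ε).continuous.measurable.ennreal_ofReal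
  have hF2 : Measurable fun p : (Fin n → ℂ) × (Fin n → ℂ) => F (p.1 - p.2) - F p.1 :=
    (hFm.measurable.comp (measurable_fst.sub measurable_snd)).sub (hFm.measurable.comp measurable_fst)
  refine (ENNReal.pow_le_pow_left_iff (n := 2) (by norm_num)).1 ?_
  rw [eLpNorm_two_sq]
  calc ∫⁻ x, ‖mo ε F x - F x‖ₑ ^ 2
      ≤ ∫⁻ x, ∫⁻ w, ‖F (x - w) - F x‖ₑ ^ 2 * ENNReal.ofReal (rho n ε w) := by
        refine lintegral_mono fun x => ?_
        rw [mo_sub_eq hε hloc]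
        refine le_trans ?_ (sq_lintegral_rho_le hε (g := fun w => ‖F (x - w) - F x‖ₑ) ?_)
        · gcongr
          refine (enorm_integral_le_lintegral_enorm _).trans (le_of_eq ?_)
          congr 1; ext w
          rw [enorm_mul]
          congr 1
          rw [rhoC, ← ofReal_norm, Complex.norm_real, Real.norm_of_nonneg (rho_nonneg hε w)]
        · exact (hF2.comp (measurable_const.prodMk measurable_id)).enorm
    _ = ∫⁻ w, ∫⁻ x, ‖F (x - w) - F x‖ₑ ^ 2 * ENNReal.ofReal (rho n ε w) := by
        refine lintegral_lintegral_swap ?_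
        exact ((hF2.enorm.pow_const 2).mul (hm.comp measurable_snd)).aemeasurable
    _ ≤ ∫⁻ w, c ^ 2 * ENNReal.ofReal (rho n ε w) := by
        refine lintegral_mono fun w => ?_
        have hw2 : Measurable fun x => ‖F (x - w) - F x‖ₑ ^ 2 :=
          (hF2.comp (measurable_id.prodMk measurable_const)).enorm.pow_const 2
        rw [lintegral_mul_const _ hw2]
        by_cases hw : w ∈ Metric.ball (0 : Fin n → ℂ) ε
        · gcongr
          rw [← eLpNorm_two_sq (fun x => F (x - w) - F x)]
          gcongr
          exact hc w hw
        · simp [rho_eq_zero hε hw]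
    _ = c ^ 2 := by rw [lintegral_const_mul _ hm, lintegral_rho hε, mul_one]

theorem mo_tendsto {F : (Fin n → ℂ) → ℂ} (hF : MemLp F 2 volume) :
    Tendsto (fun ε => eLpNorm (fun x => mo ε F x - F x) 2 volume) (𝓝[>] 0) (𝓝 0) := by
  set G := hF.1.mk F
  have hFG : F =ᵐ[volume] G := hF.1.ae_eq_mk
  have hG : MemLp G 2 volume := (memLp_congr_ae hFG).1 hF
  have e : ∀ ε, eLpNorm (fun x => mo ε F x - F x) 2 volume = eLpNorm (fun x => mo ε G x - G x) 2 volume := by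
    intro ε
    rw [mo_congr hFG]
    refine eLpNorm_congr_ae ?_
    filter_upwards [hFG] with x hx
    rw [hx]
  simp_rw [e]
  rw [ENNReal.tendsto_nhds_zero]
  intro c hc
  have := (ENNReal.tendsto_nhds_zero.1 (translation_tendsto hG)) c hc
  obtain ⟨r, hr, hb⟩ := Metric.eventually_nhds_iff_ball.1 this
  filter_upwards [Ioo_mem_nhdsGT hr] with ε hε
  exact mo_sub_sq_le hε.1 hG hF.1.stronglyMeasurable_mk
    fun w hw => hb w (Metric.ball_subset_ball hε.2.le hw)

end moll2
end

noncomputable section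
open MeasureTheory Set Filter
open scoped ENNReal ComplexOrder ContDiff Topology

section weyl
variable {n : ℕ}

theorem sum_ev (v : Fin n → ℂ) : v = ∑ j, v j • ev j := by
  ext i
  simp [ev, Finset.sum_apply, Pi.single_apply]

theorem holo_of_wderBar_ev {f : (Fin n → ℂ) → ℂ} {x : Fin n → ℂ} (hf : DifferentiableAt ℝ f x)
    (h : ∀ j, wderBar f (ev j) x = 0) : DifferentiableAt ℂ f x := by
  refine holo_of_wderBar hf fun v => ?_
  rw [sum_ev v, wderBar_sum_dir]
  simp [h]

theorem mo_comm {ε δ : ℝ} (hε : 0 < ε) (hδ : 0 < δ) {F : (Fin n → ℂ) → ℂ}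
    (hF : LocallyIntegrable F volume) : mo δ (mo ε F) = mo ε (mo δ F) := by
  have key : ∀ {ε δ : ℝ} (hε : 0 < ε) (hδ : 0 < δ) x, mo δ (mo ε F) x
      = convolution F (convolution (rhoC n ε) (rhoC n δ) (ContinuousLinearMap.mul ℝ ℂ) volume)
        (ContinuousLinearMap.mul ℝ ℂ) volume x := by
    intro ε δ hε hδ x
    rw [mo_eq_conv, mo_eq_conv]
    have c1 := (rhoC_contDiff (n := n) ε).continuous
    have c2 := (rhoC_contDiff (n := n) δ).continuous
    apply convolution_assoc
    · intro a b c; simp [mul_assoc]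
    · exact hF.aestronglyMeasurable
    · exact c1.aestronglyMeasurable
    · exact c2.aestronglyMeasurable
    · exact Eventually.of_forall
        ((rhoC_hcs hε).convolutionExists_right _ hF c1)
    · exact Eventually.of_forall ((rhoC_hcs hδ).norm.convolutionExists_right _
        c1.norm.locallyIntegrable c2.norm)
    · have k1 : HasCompactSupport (convolution (fun x => ‖rhoC n ε x‖) (fun x => ‖rhoC n δ x‖)
          (ContinuousLinearMap.mul ℝ ℝ) volume) :=
        HasCompactSupport.convolution (ContinuousLinearMap.mul ℝ ℝ) (rhoC_hcs hε).norm (rhoC_hcs hδ).norm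
      have k2 : Continuous (convolution (fun x => ‖rhoC n ε x‖) (fun x => ‖rhoC n δ x‖)
          (ContinuousLinearMap.mul ℝ ℝ) volume) :=
        HasCompactSupport.continuous_convolution_right (ContinuousLinearMap.mul ℝ ℝ)
          (rhoC_hcs hδ).norm c1.norm.locallyIntegrable c2.norm
      have k3 : LocallyIntegrable (fun x => ‖F x‖) volume := fun y => IntegrableAtFilter.norm (hF y)
      exact HasCompactSupport.convolutionExists_right (ContinuousLinearMap.mul ℝ ℝ) k1 k3 k2 x
  ext x
  rw [key hε hδ, key hδ hε, ← convolution_flip (f := rhoC n ε)]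
  congr 2
  ext a b <;> simp

theorem wderBar_support {θ : (Fin n → ℂ) → ℂ} {v y : Fin n → ℂ} (hy : y ∉ tsupport θ) :
    wderBar θ v y = 0 := by
  by_contra h
  exact hy (tsupport_wderBar v (subset_tsupport _ h))

theorem wder_support {θ : (Fin n → ℂ) → ℂ} {v y : Fin n → ℂ} (hy : y ∉ tsupport θ) :
    wder θ v y = 0 := by
  by_contra h
  exact hy (tsupport_wder v (subset_tsupport _ h))

theorem weyl_local {D : Set (Fin n → ℂ)} {F : (Fin n → ℂ) → ℂ}
    (hF : ∀ K, IsCompact K → K ⊆ D → MemLp F 2 (volume.restrict K))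
    (hw : ∀ θ, IsTest D θ → ∀ j, ∫ x, F x * wderBar θ (ev j) x = 0)
    {a : Fin n → ℂ} {r : ℝ} (hr : 0 < r) (ha : Metric.closedBall a (3 * r) ⊆ D) :
    ∃ g : (Fin n → ℂ) → ℂ, DifferentiableOn ℂ g (Metric.ball a r) ∧
      F =ᵐ[volume.restrict (Metric.ball a r)] g ∧
      ∀ ε, 0 < ε → ε < r → ∀ x ∈ Metric.ball a r, mo ε F x = g x := by
  set B := Metric.closedBall a (3 * r)
  set F' := B.indicator F
  have hBm : MeasurableSet B := Metric.isClosed_closedBall.measurableSet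
  have hF' : MemLp F' 2 volume :=
    (memLp_indicator_iff_restrict hBm).2 (hF B (isCompact_closedBall _ _) ha)
  have hloc : LocallyIntegrable F' volume := hF'.locallyIntegrable (by norm_num)
  have hsub : ∀ ε, ε < r → ∀ x ∈ Metric.ball a (2 * r), Metric.closedBall x ε ⊆ B := by
    intro ε hε x hx y hy
    rw [Metric.mem_ball] at hx
    rw [Metric.mem_closedBall] at hy ⊢
    linarith [dist_triangle y x a]
  have hmoeq : ∀ ε, 0 < ε → ε < r → ∀ x ∈ Metric.ball a (2 * r), mo ε F x = mo ε F' x := by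
    intro ε h0 hε x hx
    refine integral_congr_ae (Eventually.of_forall fun y => ?_)
    by_cases hy : y ∈ B
    · simp [F', hy]
    · have : rhoC n ε (x - y) = 0 := by
        apply rhoC_eq_zero h0
        intro hc
        apply hy
        apply hsub ε hε x hx
        rw [mem_ball_zero_iff] at hc
        rw [mem_closedBall_iff_norm, norm_sub_rev]
        exact hc.le
      simp [this]
  have hhol : ∀ ε, 0 < ε → ε < r → DifferentiableOn ℂ (mo ε F') (Metric.ball a (2 * r)) := by
    intro ε h0 hε x hx
    refine DifferentiableAt.differentiableWithinAt ?_
    refine holo_of_wderBar_ev ((mo_contDiff h0 hloc).differentiable (by simp) x) fun j => ?_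
    have ht := rhoC_test h0 x (hsub ε hε x hx)
    have ht' := rhoC_test h0 x ((hsub ε hε x hx).trans ha)
    have h1 := hw _ ht' j
    rw [wderBar_mo h0 hloc]
    simp only [mul_neg]
    rw [integral_neg, neg_eq_zero, ← h1]
    refine integral_congr_ae (Eventually.of_forall fun y => ?_)
    by_cases hy : y ∈ B
    · simp [F', hy]
    · have : wderBar (fun y => rhoC n ε (x - y)) (ev j) y = 0 :=
        wderBar_support fun h => hy (ht.2.2 h)
      simp [this]
  have hind : ∀ ε δ, 0 < ε → ε < r → 0 < δ → δ < r → ∀ x ∈ Metric.ball a r,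
      mo ε F' x = mo δ F' x := by
    intro ε δ he hε hd hδ x hx
    have hcb : ∀ ε, ε < r → Metric.closedBall x ε ⊆ Metric.ball a (2 * r) := by
      intro ε hε y hy
      rw [Metric.mem_ball] at hx ⊢
      rw [Metric.mem_closedBall] at hy
      linarith [dist_triangle y x a]
    have h1 := mo_mean_value hd Metric.isOpen_ball (hhol ε he hε) (hcb δ hδ)
    have h2 := mo_mean_value he Metric.isOpen_ball (hhol δ hd hδ) (hcb ε hε)
    rw [← h1, mo_comm he hd hloc, h2]
  have hbb : Metric.ball a r ⊆ Metric.ball a (2 * r) := Metric.ball_subset_ball (by linarith)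
  refine ⟨mo (r/2) F', (hhol (r/2) (by positivity) (by linarith)).mono hbb, ?_, ?_⟩
  · have hz : eLpNorm (fun x => mo (r/2) F' x - F' x) 2 (volume.restrict (Metric.ball a r)) = 0 := by
      refine le_antisymm ?_ bot_le
      refine le_of_tendsto_of_tendsto tendsto_const_nhds (mo_tendsto hF') ?_
      filter_upwards [Ioo_mem_nhdsGT hr] with ε hε
      refine le_trans (le_of_eq ?_) (eLpNorm_mono_measure _ (Measure.restrict_le_self (s := Metric.ball a r)))
      refine eLpNorm_congr_ae ?_
      filter_upwards [ae_restrict_mem Metric.isOpen_ball.measurableSet] with x hx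
      rw [hind (r/2) ε (by positivity) (by linarith) hε.1 hε.2 x hx]
    have hms : AEStronglyMeasurable (fun x => mo (r/2) F' x - F' x)
        (volume.restrict (Metric.ball a r)) :=
      ((mo_contDiff (by positivity) hloc).continuous.aestronglyMeasurable).sub hF'.1.restrict
    rw [eLpNorm_eq_zero_iff hms (by norm_num)] at hz
    filter_upwards [hz, ae_restrict_mem Metric.isOpen_ball.measurableSet] with x hx hxb
    have hxB : x ∈ B := hsub (r/2) (by linarith) x (hbb hxb) (Metric.mem_closedBall_self (by positivity))
    simp only [F', hxB, indicator_of_mem, Pi.zero_apply, sub_eq_zero] at hx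
    exact hx.symm
  · intro ε h0 hε x hx
    rw [hmoeq ε h0 hε x (hbb hx), hind ε (r/2) h0 hε (by positivity) (by linarith) x hx]

theorem weyl {D : Set (Fin n → ℂ)} (hD : IsOpen D) {F : (Fin n → ℂ) → ℂ}
    (hF : ∀ K, IsCompact K → K ⊆ D → MemLp F 2 (volume.restrict K))
    (hw : ∀ θ, IsTest D θ → ∀ j, ∫ x, F x * wderBar θ (ev j) x = 0) :
    ∃ g : (Fin n → ℂ) → ℂ, DifferentiableOn ℂ g D ∧ F =ᵐ[volume.restrict D] g := by
  set g : (Fin n → ℂ) → ℂ := fun x => limUnder (𝓝[>] (0:ℝ)) fun ε => mo ε F x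
  have hloc : ∀ a ∈ D, ∃ r > 0, ∃ g' : (Fin n → ℂ) → ℂ, DifferentiableOn ℂ g' (Metric.ball a r) ∧
      F =ᵐ[volume.restrict (Metric.ball a r)] g' ∧ ∀ x ∈ Metric.ball a r, g x = g' x := by
    intro a ha
    obtain ⟨R, hR, hRD⟩ := Metric.nhds_basis_closedBall.mem_iff.1 (hD.mem_nhds ha)
    obtain ⟨g', h1, h2, h3⟩ := weyl_local hF hw (a := a) (r := R / 3) (by positivity)
      (by convert hRD using 1; congr 1; ring)
    refine ⟨R / 3, by positivity, g', h1, h2, fun x hx => ?_⟩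
    refine Tendsto.limUnder_eq (Tendsto.congr' ?_ tendsto_const_nhds)
    filter_upwards [Ioo_mem_nhdsGT (show (0:ℝ) < R / 3 by positivity)] with ε hε
    exact (h3 ε hε.1 hε.2 x hx).symm
  refine ⟨g, ?_, ?_⟩
  · intro a ha
    obtain ⟨r, hr, g', h1, _, h3⟩ := hloc a ha
    have : DifferentiableAt ℂ g' a := h1.differentiableAt (Metric.ball_mem_nhds a hr)
    refine (this.congr_of_eventuallyEq ?_).differentiableWithinAt
    filter_upwards [Metric.ball_mem_nhds a hr] with x hx
    exact h3 x hx
  · rw [Filter.EventuallyEq, ae_restrict_iff' hD.measurableSet, ae_iff]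
    refine measure_null_of_locally_null _ fun a ha => ?_
    have haD : a ∈ D := by
      by_contra hc; exact ha (fun h => absurd h hc)
    obtain ⟨r, hr, g', _, h2, h3⟩ := hloc a haD
    rw [Filter.EventuallyEq, ae_restrict_iff' Metric.isOpen_ball.measurableSet, ae_iff] at h2
    refine ⟨_, inter_mem_nhdsWithin _ (Metric.ball_mem_nhds a hr), ?_⟩
    refine measure_mono_null ?_ h2
    rintro x ⟨hx, hxb⟩
    intro hc
    apply hx
    intro _
    rw [hc hxb, h3 x hxb]

theorem rho_bdd {ε : ℝ} (hε : 0 < ε) : ∃ M : NNReal, ∀ w : Fin n → ℂ, rho n ε w ≤ M := by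
  obtain ⟨C, hC⟩ := (rho_hcs (n := n) hε).exists_bound_of_continuous (rho_contDiff ε).continuous
  refine ⟨⟨max C 0, le_max_right _ _⟩, fun w => ?_⟩
  exact (le_abs_self _).trans ((hC w).trans (le_max_left C 0))

/-- Pointwise Bergman bound. -/
theorem bergman_bound {ε : ℝ} (hε : 0 < ε) : ∃ M : NNReal, ∀ (f : (Fin n → ℂ) → ℂ) (S : Set (Fin n → ℂ)) 
    (x : Fin n → ℂ), IsOpen S → DifferentiableOn ℂ f S → Metric.closedBall x ε ⊆ S →
    ‖f x‖ₑ ^ 2 ≤ M * ∫⁻ y in Metric.closedBall x ε, ‖f y‖ₑ ^ 2 := by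
  obtain ⟨M, hM⟩ := rho_bdd (n := n) hε
  refine ⟨M, fun f S x hS hf hx => ?_⟩
  set B := Metric.closedBall x ε
  have hBm : MeasurableSet B := Metric.isClosed_closedBall.measurableSet
  have hfm : Measurable (B.indicator f) := by
    classical
    rw [← Set.piecewise_eq_indicator]
    exact (hf.continuousOn.mono hx).measurable_piecewise continuousOn_const hBm
  have hmem : ∀ w, w ∈ Metric.ball (0 : Fin n → ℂ) ε → x - w ∈ B := by
    intro w hw
    rw [mem_ball_zero_iff] at hw
    rw [mem_closedBall_iff_norm]
    simpa using hw.le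
  have e1 : f x = ∫ w, B.indicator f (x - w) * rhoC n ε w := by
    rw [← mo_mean_value hε hS hf hx, mo,
      ← integral_sub_left_eq_self (fun y => f y * rhoC n ε (x - y)) volume x]
    refine integral_congr_ae (Eventually.of_forall fun w => ?_)
    by_cases hw : w ∈ Metric.ball (0 : Fin n → ℂ) ε
    · simp [hmem w hw]
    · simp [rhoC_eq_zero hε hw]
  have hg : Measurable fun w => ‖B.indicator f (x - w)‖ₑ :=
    (hfm.comp (measurable_const.sub measurable_id)).enorm
  calc ‖f x‖ₑ ^ 2 ≤ (∫⁻ w, ‖B.indicator f (x - w)‖ₑ * ENNReal.ofReal (rho n ε w)) ^ 2 := by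
        gcongr
        rw [e1]
        refine (enorm_integral_le_lintegral_enorm _).trans (le_of_eq ?_)
        congr 1; ext w
        rw [enorm_mul]
        congr 1
        rw [rhoC, ← ofReal_norm, Complex.norm_real, Real.norm_of_nonneg (rho_nonneg hε w)]
    _ ≤ ∫⁻ w, ‖B.indicator f (x - w)‖ₑ ^ 2 * ENNReal.ofReal (rho n ε w) := sq_lintegral_rho_le hε hg
    _ ≤ ∫⁻ w, ‖B.indicator f (x - w)‖ₑ ^ 2 * M := by
        refine lintegral_mono fun w => ?_
        gcongr
        rw [← ENNReal.ofReal_coe_nnreal]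
        exact ENNReal.ofReal_le_ofReal (hM w)
    _ = (∫⁻ w, ‖B.indicator f w‖ₑ ^ 2) * M := by
        rw [lintegral_mul_const _ (hg.pow_const 2)]
        congr 1
        exact lintegral_sub_left_eq_self (fun w => ‖B.indicator f w‖ₑ ^ 2) x
    _ = M * ∫⁻ y in B, ‖f y‖ₑ ^ 2 := by
        rw [mul_comm, ← lintegral_indicator hBm]
        congr 2; ext w
        by_cases hw : w ∈ B <;> simp [hw]

end weyl
end

noncomputable section
open MeasureTheory Set Filter
open scoped ENNReal ComplexOrder ContDiff Topology

section l2
variable {n : ℕ}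

theorem tendsto_integral_mul_conj {f g : ℕ → (Fin n → ℂ) → ℂ} {F G : (Fin n → ℂ) → ℂ}
    (hf : ∀ k, MemLp (f k) 2 volume) (hF : MemLp F 2 volume)
    (hg : ∀ k, MemLp (g k) 2 volume) (hG : MemLp G 2 volume)
    (h1 : Tendsto (fun k => eLpNorm (fun x => f k x - F x) 2 volume) atTop (𝓝 0))
    (h2 : Tendsto (fun k => eLpNorm (fun x => g k x - G x) 2 volume) atTop (𝓝 0)) :
    Tendsto (fun k => ∫ x, f k x * (starRingEnd ℂ) (g k x)) atTop
      (𝓝 (∫ x, F x * (starRingEnd ℂ) (G x))) := by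
  have t1 : Tendsto (fun k => (hf k).toLp (f k)) atTop (𝓝 (hF.toLp F)) :=
    (Lp.tendsto_Lp_iff_tendsto_eLpNorm'' f hf F hF).2 h1
  have t2 : Tendsto (fun k => (hg k).toLp (g k)) atTop (𝓝 (hG.toLp G)) :=
    (Lp.tendsto_Lp_iff_tendsto_eLpNorm'' g hg G hG).2 h2
  have t3 := Filter.Tendsto.inner (𝕜 := ℂ) t2 t1
  have e : ∀ {u v : (Fin n → ℂ) → ℂ} (hu : MemLp u 2 volume) (hv : MemLp v 2 volume),
      inner ℂ (hv.toLp v) (hu.toLp u) = ∫ x, u x * (starRingEnd ℂ) (v x) := by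
    intro u v hu hv
    rw [L2.inner_def]
    refine integral_congr_ae ?_
    filter_upwards [hu.coeFn_toLp, hv.coeFn_toLp] with x h1 h2
    rw [h1, h2]
    simp
  simp only [e] at t3
  exact t3

theorem tendsto_integral_normsq {f : ℕ → (Fin n → ℂ) → ℂ} {F : (Fin n → ℂ) → ℂ}
    (hf : ∀ k, MemLp (f k) 2 volume) (hF : MemLp F 2 volume)
    (h1 : Tendsto (fun k => eLpNorm (fun x => f k x - F x) 2 volume) atTop (𝓝 0)) :
    Tendsto (fun k => ∫ x, ‖f k x‖ ^ 2) atTop (𝓝 (∫ x, ‖F x‖ ^ 2)) := by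
  have h := tendsto_integral_mul_conj hf hF hf hF h1 h1
  have e : ∀ u : (Fin n → ℂ) → ℂ, ∫ x, u x * (starRingEnd ℂ) (u x) = ((∫ x, ‖u x‖ ^ 2 : ℝ) : ℂ) := by
    intro u
    rw [← integral_complex_ofReal]
    congr 1; ext x
    rw [Complex.mul_conj, Complex.normSq_eq_norm_sq]
  simp only [e] at h
  have := (Complex.continuous_re.tendsto _).comp h
  simpa [Function.comp_def] using this

theorem memLp_bdd_mul {K : Set (Fin n → ℂ)} (hK : IsCompact K) {a G : (Fin n → ℂ) → ℂ}
    (ha : ContinuousOn a K) (hG : MemLp G 2 volume) (h0 : ∀ x ∉ K, G x = 0) :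
    MemLp (fun x => a x * G x) 2 volume := by
  obtain ⟨C, hC⟩ := hK.exists_bound_of_continuousOn ha
  refine MemLp.of_le_mul (c := C) hG ?_ (Eventually.of_forall fun x => ?_)
  · have : (fun x => a x * G x) = fun x => K.indicator a x * G x := by
      ext x; by_cases hx : x ∈ K
      · simp [hx]
      · simp [h0 x hx]
    rw [this]
    refine AEStronglyMeasurable.mul ?_ hG.1
    rw [aestronglyMeasurable_indicator_iff hK.measurableSet]
    exact ha.aestronglyMeasurable hK.measurableSet
  · by_cases hx : x ∈ K
    · rw [norm_mul]; gcongr; exact hC x hx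
    · simp [h0 x hx]

theorem tendsto_bdd_mul {K : Set (Fin n → ℂ)} (hK : IsCompact K) {a : (Fin n → ℂ) → ℂ}
    (ha : ContinuousOn a K) {f : ℕ → (Fin n → ℂ) → ℂ} {F : (Fin n → ℂ) → ℂ}
    (h0 : ∀ k, ∀ x ∉ K, f k x = 0) (hF0 : ∀ x ∉ K, F x = 0)
    (h1 : Tendsto (fun k => eLpNorm (fun x => f k x - F x) 2 volume) atTop (𝓝 0)) :
    Tendsto (fun k => eLpNorm (fun x => a x * f k x - a x * F x) 2 volume) atTop (𝓝 0) := by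
  obtain ⟨C, hC⟩ := hK.exists_bound_of_continuousOn ha
  have h2 : Tendsto (fun k => ENNReal.ofReal C * eLpNorm (fun x => f k x - F x) 2 volume) atTop (𝓝 0) := by
    have := ENNReal.Tendsto.const_mul (a := ENNReal.ofReal C) h1 (Or.inr ENNReal.ofReal_ne_top)
    simpa using this
  refine tendsto_of_tendsto_of_tendsto_of_le_of_le tendsto_const_nhds h2 (fun _ => bot_le) fun k => ?_
  refine eLpNorm_le_mul_eLpNorm_of_ae_le_mul (Eventually.of_forall fun x => ?_) 2
  by_cases hx : x ∈ K
  · rw [← mul_sub, norm_mul]; gcongr; exact hC x hx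
  · simp [h0 k x hx, hF0 x hx]

theorem tendsto_add_L2 {f g : ℕ → (Fin n → ℂ) → ℂ} {F G : (Fin n → ℂ) → ℂ}
    (hf : ∀ k, MemLp (f k) 2 volume) (hF : MemLp F 2 volume)
    (hg : ∀ k, MemLp (g k) 2 volume) (hG : MemLp G 2 volume)
    (h1 : Tendsto (fun k => eLpNorm (fun x => f k x - F x) 2 volume) atTop (𝓝 0))
    (h2 : Tendsto (fun k => eLpNorm (fun x => g k x - G x) 2 volume) atTop (𝓝 0)) :
    Tendsto (fun k => eLpNorm (fun x => (f k x + g k x) - (F x + G x)) 2 volume) atTop (𝓝 0) := by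
  have h3 := h1.add h2
  rw [add_zero] at h3
  refine tendsto_of_tendsto_of_tendsto_of_le_of_le tendsto_const_nhds h3 (fun _ => bot_le) fun k => ?_
  have := eLpNorm_add_le (p := 2) ((hf k).sub hF).1 ((hg k).sub hG).1 (by norm_num)
  refine le_trans (le_of_eq ?_) this
  congr 1; ext x; simp; ring

theorem tendsto_sum_L2 {ι : Type*} (s : Finset ι) {f : ι → ℕ → (Fin n → ℂ) → ℂ} {F : ι → (Fin n → ℂ) → ℂ}
    (hf : ∀ i k, MemLp (f i k) 2 volume) (hF : ∀ i, MemLp (F i) 2 volume)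
    (h1 : ∀ i, Tendsto (fun k => eLpNorm (fun x => f i k x - F i x) 2 volume) atTop (𝓝 0)) :
    Tendsto (fun k => eLpNorm (fun x => (∑ i ∈ s, f i k x) - ∑ i ∈ s, F i x) 2 volume) atTop (𝓝 0) := by
  classical
  induction s using Finset.induction_on with
  | empty => simp
  | insert i s hi ih =>
    simp only [Finset.sum_insert hi]
    exact tendsto_add_L2 (hf i) (hF i) (fun k => memLp_finsetSum s fun i _ => hf i k)
      (memLp_finsetSum s fun i _ => hF i) (h1 i) ih

theorem mo_zero {K : Set (Fin n → ℂ)} {ε : ℝ} (hε : 0 < ε) {F : (Fin n → ℂ) → ℂ}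
    (h0 : ∀ x ∉ K, F x = 0) {x : Fin n → ℂ} (hx : x ∉ Metric.cthickening ε K) : mo ε F x = 0 := by
  rw [mo, ← integral_zero (Fin n → ℂ) ℂ]
  refine integral_congr_ae (Eventually.of_forall fun y => ?_)
  by_cases hy : y ∈ K
  · have : rhoC n ε (x - y) = 0 := by
      apply rhoC_eq_zero hε
      intro hc
      apply hx
      apply Metric.mem_cthickening_of_dist_le x y ε K hy
      rw [mem_ball_zero_iff] at hc
      rw [dist_eq_norm]; exact hc.le
    simp [this]
  · simp [h0 y hy]

theorem mo_test {K D : Set (Fin n → ℂ)} (hK : IsCompact K) {ε : ℝ} (hε : 0 < ε)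
    (hKD : Metric.cthickening ε K ⊆ D)
    {F : (Fin n → ℂ) → ℂ} (hF : MemLp F 2 volume)
    (h0 : ∀ x ∉ K, F x = 0) : IsTest D (mo ε F) := by
  have hts : tsupport (mo ε F) ⊆ Metric.cthickening ε K := by
    refine closure_minimal (fun x hx => ?_) Metric.isClosed_cthickening
    by_contra hc
    exact hx (mo_zero hε h0 hc)
  exact ⟨mo_contDiff hε (hF.locallyIntegrable (by norm_num)),
    hK.cthickening.of_isClosed_subset isClosed_closure hts, hts.trans hKD⟩

theorem IsTest.memLp {D : Set (Fin n → ℂ)} {θ : (Fin n → ℂ) → ℂ} (h : IsTest D θ) : MemLp θ 2 volume :=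
  h.1.continuous.memLp_of_hasCompactSupport h.2.1

theorem test_mul_memLp {D : Set (Fin n → ℂ)} {f θ : (Fin n → ℂ) → ℂ}
    (hf : MemLp f 2 (volume.restrict D)) (h : IsTest D θ) :
    MemLp (fun x => θ x * f x) 2 volume := by
  have h1 : MemLp ((tsupport θ).indicator f) 2 volume := by
    rw [memLp_indicator_iff_restrict h.2.1.measurableSet]
    exact hf.mono_measure (Measure.restrict_mono h.2.2 le_rfl)
  have := memLp_bdd_mul (K := tsupport θ) h.2.1 h.1.continuous.continuousOn h1 (fun x hx => by simp [hx])
  convert this using 2 with x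
  by_cases hx : x ∈ tsupport θ
  · simp [hx]
  · simp [image_eq_zero_of_notMem_tsupport hx]

theorem test_mul_integrable {D : Set (Fin n → ℂ)} {f θ : (Fin n → ℂ) → ℂ}
    (hf : MemLp f 2 (volume.restrict D)) (h : IsTest D θ) :
    Integrable (fun x => f x * θ x) volume := by
  have h1 : MemLp ((tsupport θ).indicator f) 2 volume := by
    rw [memLp_indicator_iff_restrict h.2.1.measurableSet]
    exact hf.mono_measure (Measure.restrict_mono h.2.2 le_rfl)
  have := h1.integrable_mul h.memLp
  refine this.congr (Eventually.of_forall fun x => ?_)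
  by_cases hx : x ∈ tsupport θ
  · simp [hx]
  · simp [image_eq_zero_of_notMem_tsupport hx]

end l2
end

noncomputable section
open MeasureTheory Set Filter
open scoped ENNReal ComplexOrder ContDiff Topology

section wbk
variable {n : ℕ} {D : Set (Fin n → ℂ)} {ψ : (Fin n → ℂ) → ℝ}

/-- formal transpose of `Zb`. -/
def Tb (ψ : (Fin n → ℂ) → ℝ) (j : Fin n) (θ : (Fin n → ℂ) → ℂ) (x : Fin n → ℂ) : ℂ :=
  - wderBar θ (ev j) x + (1 / 2) * wderBar (fun q => (ψ q : ℂ)) (ev j) x * θ x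

theorem IsTest.Tb (hD : IsOpen D) (hψ : ContDiffOn ℝ ∞ ψ D) {θ} (h : IsTest D θ) (j : Fin n) :
    IsTest D (fun x => Tb ψ j θ x) := by
  refine (h.wderBar (ev j)).neg.add (IsTest.mul_left hD ?_ h)
  exact contDiffOn_const.mul (contDiffOn_wderBar hD (contDiffOn_ofReal hψ) _)

theorem Tb_comm (hD : IsOpen D) (hψ : ContDiffOn ℝ ∞ ψ D) {θ : (Fin n → ℂ) → ℂ} (h : IsTest D θ) (j k : Fin n)
    (x : Fin n → ℂ) :
    Tb ψ k (fun y => Tb ψ j θ y) x = Tb ψ j (fun y => Tb ψ k θ y) x := by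
  by_cases hx : x ∈ D
  swap
  · rw [((h.Tb hD hψ j).Tb hD hψ k).eq_zero hx, ((h.Tb hD hψ k).Tb hD hψ j).eq_zero hx]
  have hc := contDiffOn_ofReal hψ
  have key : ∀ j k, Tb ψ k (fun y => Tb ψ j θ y) x =
      wderBar (fun y => wderBar θ (ev j) y) (ev k) x
      - (1/2) * (wderBar (fun y => wderBar (fun q => (ψ q : ℂ)) (ev j) y) (ev k) x * θ x
        + wderBar (fun q => (ψ q : ℂ)) (ev j) x * wderBar θ (ev k) x)
      + (1 / 2) * wderBar (fun q => (ψ q : ℂ)) (ev k) x *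
        (- wderBar θ (ev j) x + (1 / 2) * wderBar (fun q => (ψ q : ℂ)) (ev j) x * θ x) := by
    intro j k
    have d1 := diffAt_of_contDiffOn hD hx (contDiffOn_wderBar hD hc (ev j))
    have d2 := h.diff x
    have d3 := (h.wderBar (ev j)).diff x
    have e : (fun y => Tb ψ j θ y) = fun y => - wderBar θ (ev j) y
      + (1 / 2) * (wderBar (fun q => (ψ q : ℂ)) (ev j) y * θ y) := by
      ext y; simp only [_root_.Tb]; ring
    rw [_root_.Tb, e, wderBar_add _ d3.fun_neg ((d1.fun_mul d2).const_mul _), wderBar_neg,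
      wderBar_const_mul _ _ (d1.fun_mul d2), wderBar_mul _ d1 d2]
    simp only [_root_.Tb]
    ring
  rw [key j k, key k j, wderBar_wderBar_comm hD hx hc (ev k) (ev j),
    wderBar_wderBar_comm isOpen_univ (mem_univ x) h.1.contDiffOn (ev k) (ev j)]
  ring

theorem weak_closed (hD : IsOpen D) (hψ : ContDiffOn ℝ ∞ ψ D) {w : (Fin n → ℂ) → ℂ}
    {b : Fin n → (Fin n → ℂ) → ℂ}
    (W1 : ∀ θ, IsTest D θ → ∀ j, ∫ x, w x * Tb ψ j θ x = ∫ x, b j x * θ x)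
    {θ} (h : IsTest D θ) (j k : Fin n) :
    ∫ x, b k x * Tb ψ j θ x = ∫ x, b j x * Tb ψ k θ x := by
  rw [← W1 _ (h.Tb hD hψ j) k, ← W1 _ (h.Tb hD hψ k) j]
  congr 1; ext x
  rw [Tb_comm hD hψ h]

variable {χ w s : (Fin n → ℂ) → ℂ} {b : Fin n → (Fin n → ℂ) → ℂ}

theorem weak_zb (hD : IsOpen D) (hψ : ContDiffOn ℝ ∞ ψ D) (hχ : IsTest D χ)
    (hb : ∀ j, MemLp (b j) 2 (volume.restrict D))
    (W1 : ∀ θ, IsTest D θ → ∀ j, ∫ x, w x * Tb ψ j θ x = ∫ x, b j x * θ x)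
    {θ : (Fin n → ℂ) → ℂ} (hθ : ContDiff ℝ ∞ θ) (j k : Fin n) :
    (∫ x, χ x * b k x * (- wderBar θ (ev j) x)) - (∫ x, χ x * b j x * (- wderBar θ (ev k) x))
     = ∫ x, (wderBar χ (ev j) x * b k x - wderBar χ (ev k) x * b j x
        - (1/2) * wderBar (fun q => (ψ q : ℂ)) (ev j) x * (χ x * b k x)
        + (1/2) * wderBar (fun q => (ψ q : ℂ)) (ev k) x * (χ x * b j x)) * θ x := by
  have hc := contDiffOn_ofReal hψ
  have ht : IsTest D (fun x => θ x * χ x) := IsTest.mul_left hD hθ.contDiffOn hχ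
  have h1 := weak_closed hD hψ W1 ht j k
  have i1 : ∀ j k, Integrable (fun x => b k x * (- wderBar θ (ev j) x * χ x)) := fun j k =>
    test_mul_integrable (hb k) (IsTest.mul_left hD (contDiff_wderBar hθ (ev j)).neg.contDiffOn hχ)
  have i2 : ∀ j k, Integrable (fun x => b k x * (θ x * wderBar χ (ev j) x)) := fun j k =>
    test_mul_integrable (hb k) (IsTest.mul_left hD hθ.contDiffOn (hχ.wderBar _))
  have i3 : ∀ j k, Integrable (fun x => b k x * ((1/2) * wderBar (fun q => (ψ q : ℂ)) (ev j) x * (θ x * χ x))) :=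
    fun j k => test_mul_integrable (hb k) (IsTest.mul_left hD
      (contDiffOn_const.mul (contDiffOn_wderBar hD hc _)) ht)
  have i5 : ∀ j k, Integrable (fun x => - (b k x * (θ x * wderBar χ (ev j) x))
          + b k x * ((1/2) * wderBar (fun q => (ψ q : ℂ)) (ev j) x * (θ x * χ x))) :=
    fun j k => (i2 j k).neg.add (i3 j k)
  have e : ∀ j k, ∫ x, b k x * Tb ψ j (fun x => θ x * χ x) x
      = (∫ x, χ x * b k x * (- wderBar θ (ev j) x)) +
        ∫ x, (- (b k x * (θ x * wderBar χ (ev j) x))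
          + b k x * ((1/2) * wderBar (fun q => (ψ q : ℂ)) (ev j) x * (θ x * χ x))) := by
    intro j k
    have i1' : Integrable (fun x => χ x * b k x * (- wderBar θ (ev j) x)) := by
      refine (i1 j k).congr (Eventually.of_forall fun x => ?_); simp only; ring
    rw [← integral_add i1' (i5 j k)]
    congr 1; ext x
    rw [Tb, wderBar_mul _ (hθ.differentiable (by simp) x) (hχ.diff x)]
    ring
  rw [e, e] at h1
  have h2 : (∫ x, χ x * b k x * (- wderBar θ (ev j) x)) - (∫ x, χ x * b j x * (- wderBar θ (ev k) x))
    = (∫ x, (- (b j x * (θ x * wderBar χ (ev k) x))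
          + b j x * ((1/2) * wderBar (fun q => (ψ q : ℂ)) (ev k) x * (θ x * χ x))))
     - (∫ x, (- (b k x * (θ x * wderBar χ (ev j) x))
          + b k x * ((1/2) * wderBar (fun q => (ψ q : ℂ)) (ev j) x * (θ x * χ x)))) := by
    linear_combination h1
  rw [h2, ← integral_sub (i5 _ _) (i5 _ _)]
  congr 1; ext x
  ring

theorem weak_zs (hD : IsOpen D) (hψ : ContDiffOn ℝ ∞ ψ D) (hχ : IsTest D χ)
    (hb : ∀ j, MemLp (b j) 2 (volume.restrict D)) (hs : MemLp s 2 (volume.restrict D))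
    (W2 : ∀ θ, IsTest D θ → ∑ j, ∫ x, b j x * (wder θ (ev j) x
      + (1/2) * wder (fun q => (ψ q : ℂ)) (ev j) x * θ x) = ∫ x, s x * θ x)
    {θ : (Fin n → ℂ) → ℂ} (hθ : ContDiff ℝ ∞ θ) :
    ∑ j, (∫ x, χ x * b j x * wder θ (ev j) x)
     = ∫ x, (χ x * s x - ∑ j, (wder χ (ev j) x * b j x)
        - ∑ j, (1/2) * wder (fun q => (ψ q : ℂ)) (ev j) x * (χ x * b j x)) * θ x := by
  have hc := contDiffOn_ofReal hψ
  have ht : IsTest D (fun x => θ x * χ x) := IsTest.mul_left hD hθ.contDiffOn hχ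
  have h1 := W2 _ ht
  have i1 : ∀ j, Integrable (fun x => b j x * (wder θ (ev j) x * χ x)) := fun j =>
    test_mul_integrable (hb j) (IsTest.mul_left hD (contDiff_wder hθ (ev j)).contDiffOn hχ)
  have i2 : ∀ j, Integrable (fun x => b j x * (θ x * wder χ (ev j) x)) := fun j =>
    test_mul_integrable (hb j) (IsTest.mul_left hD hθ.contDiffOn (hχ.wder _))
  have i3 : ∀ j, Integrable (fun x => b j x * ((1/2) * wder (fun q => (ψ q : ℂ)) (ev j) x * (θ x * χ x))) :=
    fun j => test_mul_integrable (hb j) (IsTest.mul_left hD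
      (contDiffOn_const.mul (contDiffOn_wder hD hc _)) ht)
  have i5 : ∀ j, Integrable (fun x => b j x * (θ x * wder χ (ev j) x)
          + b j x * ((1/2) * wder (fun q => (ψ q : ℂ)) (ev j) x * (θ x * χ x))) :=
    fun j => (i2 j).add (i3 j)
  have i4 : Integrable (fun x => s x * (θ x * χ x)) := test_mul_integrable hs ht
  have e : ∀ j, ∫ x, b j x * (wder (fun x => θ x * χ x) (ev j) x
      + (1/2) * wder (fun q => (ψ q : ℂ)) (ev j) x * (θ x * χ x))
      = (∫ x, χ x * b j x * wder θ (ev j) x) +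
        ∫ x, (b j x * (θ x * wder χ (ev j) x)
          + b j x * ((1/2) * wder (fun q => (ψ q : ℂ)) (ev j) x * (θ x * χ x))) := by
    intro j
    have i1' : Integrable (fun x => χ x * b j x * wder θ (ev j) x) := by
      refine (i1 j).congr (Eventually.of_forall fun x => ?_); simp only; ring
    rw [← integral_add i1' (i5 j)]
    congr 1; ext x
    rw [wder_mul _ (hθ.differentiable (by simp) x) (hχ.diff x)]
    ring
  simp only [e] at h1
  rw [Finset.sum_add_distrib] at h1
  rw [eq_sub_of_add_eq h1, ← integral_finsetSum _ (fun j _ => i5 j),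
    ← integral_sub i4 (integrable_finsetSum _ fun j _ => i5 j)]
  congr 1; ext x
  rw [sub_sub, ← Finset.sum_add_distrib, sub_mul, Finset.sum_mul]
  congr 1
  · ring
  · exact Finset.sum_congr rfl fun j _ => by ring

end wbk
end

noncomputable section
open MeasureTheory Set Filter
open scoped ENNReal ComplexOrder ContDiff Topology

section wbk2
variable {n : ℕ} {D : Set (Fin n → ℂ)} {ψ : (Fin n → ℂ) → ℝ}
variable {χ w s : (Fin n → ℂ) → ℂ} {b : Fin n → (Fin n → ℂ) → ℂ}

theorem weak_bk (hD : IsOpen D) (hψ : ContDiffOn ℝ ∞ ψ D) (hχ : IsTest D χ)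
    (hb : ∀ j, MemLp (b j) 2 (volume.restrict D)) (hs : MemLp s 2 (volume.restrict D))
    (W1 : ∀ θ, IsTest D θ → ∀ j, ∫ x, w x * Tb ψ j θ x = ∫ x, b j x * θ x)
    (W2 : ∀ θ, IsTest D θ → ∑ j, ∫ x, b j x * (wder θ (ev j) x
      + (1/2) * wder (fun q => (ψ q : ℂ)) (ev j) x * θ x) = ∫ x, s x * θ x) :
    ∫ x, (∑ j, ∑ k, Lv ψ (ev j) (ev k) x * (χ x * b j x) * (starRingEnd ℂ) (χ x * b k x)).re
      ≤ (∫ x, ‖χ x * s x - ∑ j, (wder χ (ev j) x * b j x)‖ ^ 2)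
        + (1/2) * ∑ j, ∑ k, ∫ x, ‖wderBar χ (ev j) x * b k x - wderBar χ (ev k) x * b j x‖ ^ 2 := by
  have hc := contDiffOn_ofReal hψ
  set K := tsupport χ
  have hK : IsCompact K := hχ.2.1
  obtain ⟨ε₀, hε₀, hKD⟩ := hK.exists_cthickening_subset_open hD hχ.2.2
  set K' := Metric.cthickening ε₀ K
  have hK' : IsCompact K' := hK.cthickening
  have hKK' : K ⊆ K' := Metric.self_subset_cthickening K
  set e : ℕ → ℝ := fun k => ε₀ / (k + 1)
  have he0 : ∀ k, 0 < e k := fun k => by positivity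
  have hee : ∀ k, e k ≤ ε₀ := fun k => div_le_self hε₀.le (by linarith [Nat.cast_nonneg (α := ℝ) k])
  have het : Tendsto e atTop (𝓝[>] 0) := by
    rw [tendsto_nhdsWithin_iff]
    refine ⟨?_, Eventually.of_forall he0⟩
    exact (tendsto_const_div_atTop_nhds_zero_nat ε₀).comp (tendsto_add_atTop_nat 1) |>.congr
      fun k => by simp [e]
  set F : Fin n → (Fin n → ℂ) → ℂ := fun j x => χ x * b j x
  have hF : ∀ j, MemLp (F j) 2 volume := fun j => test_mul_memLp (hb j) hχ
  have hF0 : ∀ j, ∀ x ∉ K, F j x = 0 := fun j x hx => by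
    simp [F, image_eq_zero_of_notMem_tsupport hx]
  have hF0' : ∀ j, ∀ x ∉ K', F j x = 0 := fun j x hx => hF0 j x fun h => hx (hKK' h)
  have hFl : ∀ j, LocallyIntegrable (F j) volume := fun j => (hF j).locallyIntegrable (by norm_num)
  have hck : ∀ k, Metric.cthickening (e k) K ⊆ K' := fun k => Metric.cthickening_mono (hee k) K
  have hmt : ∀ j k, IsTest D (mo (e k) (F j)) := fun j k =>
    mo_test hK (he0 k) ((hck k).trans hKD) (hF j) (hF0 j)
  have hm0 : ∀ j k, ∀ x ∉ K', mo (e k) (F j) x = 0 := fun j k x hx =>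
    mo_zero (he0 k) (hF0 j) fun h => hx (hck k h)
  have hlim : ∀ {G : (Fin n → ℂ) → ℂ}, MemLp G 2 volume →
      Tendsto (fun k => eLpNorm (fun x => mo (e k) G x - G x) 2 volume) atTop (𝓝 0) :=
    fun hG => (mo_tendsto hG).comp het
  have hbk := fun k => bk_ineq hD hψ (fun j => mo (e k) (F j)) (fun j => hmt j k)
  have ha : ∀ j, ContinuousOn (fun x => (1/2) * wder (fun q => (ψ q : ℂ)) (ev j) x) K' := fun j =>
    (contDiffOn_const.mul (contDiffOn_wder hD hc (ev j))).continuousOn.mono hKD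
  have hab : ∀ j, ContinuousOn (fun x => (1/2) * wderBar (fun q => (ψ q : ℂ)) (ev j) x) K' := fun j =>
    (contDiffOn_const.mul (contDiffOn_wderBar hD hc (ev j))).continuousOn.mono hKD
  have hL : ∀ j k, ContinuousOn (fun x => Lv ψ (ev j) (ev k) x) K' := fun j k =>
    (contDiffOn_Lv hD hψ _ _).continuousOn.mono hKD
  -- left side
  have hl : Tendsto (fun k => ∫ x, (∑ i, ∑ j, Lv ψ (ev i) (ev j) x * mo (e k) (F i) x *
      (starRingEnd ℂ) (mo (e k) (F j) x)).re) atTop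
      (𝓝 (∫ x, (∑ i, ∑ j, Lv ψ (ev i) (ev j) x * F i x * (starRingEnd ℂ) (F j x)).re)) := by
    have e1 : ∀ G : Fin n → (Fin n → ℂ) → ℂ, (∀ i, MemLp (G i) 2 volume) → (∀ i, ∀ x ∉ K', G i x = 0) →
        ∫ x, (∑ i, ∑ j, Lv ψ (ev i) (ev j) x * G i x * (starRingEnd ℂ) (G j x)).re
        = (∑ i, ∑ j, ∫ x, Lv ψ (ev i) (ev j) x * G i x * (starRingEnd ℂ) (G j x)).re := by
      intro G hG hG0
      have hi : ∀ i j, Integrable (fun x => Lv ψ (ev i) (ev j) x * G i x * (starRingEnd ℂ) (G j x)) :=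
        fun i j => (memLp_bdd_mul hK' (hL i j) (hG i) (hG0 i)).integrable_mul (hG j).star
      have hi2 : ∀ i, Integrable (fun x => ∑ j, Lv ψ (ev i) (ev j) x * G i x * (starRingEnd ℂ) (G j x)) :=
        fun i => integrable_finsetSum _ fun j _ => hi i j
      have e2 : (∑ i, ∑ j, ∫ x, Lv ψ (ev i) (ev j) x * G i x * (starRingEnd ℂ) (G j x))
        = ∫ x, ∑ i, ∑ j, Lv ψ (ev i) (ev j) x * G i x * (starRingEnd ℂ) (G j x) := by
        rw [integral_finsetSum _ fun i _ => hi2 i]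
        exact Finset.sum_congr rfl fun i _ => (integral_finsetSum _ fun j _ => hi i j).symm
      rw [e2]
      exact integral_re (𝕜 := ℂ) (integrable_finsetSum _ fun i _ => hi2 i)
    rw [e1 F hF hF0']
    simp_rw [fun k => e1 (fun i => mo (e k) (F i)) (fun i => (hmt i k).memLp) (fun i => hm0 i k)]
    refine (Complex.continuous_re.tendsto _).comp ?_
    refine tendsto_finsetSum _ fun i _ => tendsto_finsetSum _ fun j _ => ?_
    exact tendsto_integral_mul_conj
      (fun k => memLp_bdd_mul hK' (hL i j) (hmt i k).memLp (hm0 i k))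
      (memLp_bdd_mul hK' (hL i j) (hF i) (hF0' i)) (fun k => (hmt j k).memLp) (hF j)
      (tendsto_bdd_mul hK' (hL i j) (hm0 i) (hF0' i) (hlim (hF i))) (hlim (hF j))
  -- first right term
  set S0 : (Fin n → ℂ) → ℂ := fun x => χ x * s x - ∑ j, (wder χ (ev j) x * b j x)
  have hS0 : MemLp S0 2 volume := (test_mul_memLp hs hχ).sub
    (memLp_finsetSum _ fun j _ => test_mul_memLp (hb j) (hχ.wder (ev j)))
  set G2 : (Fin n → ℂ) → ℂ := fun x => S0 x - ∑ j, (1/2) * wder (fun q => (ψ q : ℂ)) (ev j) x * F j x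
  have hpF : ∀ j, MemLp (fun x => (1/2) * wder (fun q => (ψ q : ℂ)) (ev j) x * F j x) 2 volume := fun j =>
    memLp_bdd_mul hK' (ha j) (hF j) (hF0' j)
  have hpm : ∀ j k, MemLp (fun x => (1/2) * wder (fun q => (ψ q : ℂ)) (ev j) x * mo (e k) (F j) x) 2 volume :=
    fun j k => memLp_bdd_mul hK' (ha j) (hmt j k).memLp (hm0 j k)
  have hG2 : MemLp G2 2 volume := hS0.sub (memLp_finsetSum _ fun j _ => hpF j)
  have hχ0 : ∀ x ∉ K, χ x = 0 := fun x hx => image_eq_zero_of_notMem_tsupport hx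
  have hG20 : ∀ x ∉ K, G2 x = 0 := by
    intro x hx
    simp [G2, S0, hχ0 x hx, wder_support hx, hF0 _ x hx]
  have hmG2 : ∀ k, MemLp (mo (e k) G2) 2 volume := fun k =>
    (mo_test hK (he0 k) ((hck k).trans hKD) hG2 hG20).memLp
  have hr1 : Tendsto (fun k => ∫ x, ‖∑ j, Zs ψ j (mo (e k) (F j)) x‖ ^ 2) atTop (𝓝 (∫ x, ‖S0 x‖ ^ 2)) := by
    have eq1 : ∀ k, (fun x => ∑ j, Zs ψ j (mo (e k) (F j)) x) = fun x => mo (e k) G2 x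
        + ∑ j, (1/2) * wder (fun q => (ψ q : ℂ)) (ev j) x * mo (e k) (F j) x := by
      intro k; ext x
      have hθ : ContDiff ℝ ∞ (fun y => rhoC n (e k) (x - y)) := (rhoC_test (he0 k) x (subset_univ _)).1
      have := weak_zs hD hψ hχ hb hs W2 hθ
      simp only [Zs, Finset.sum_add_distrib]
      congr 1
      rw [mo, ← this]
      refine Finset.sum_congr rfl fun j _ => ?_
      rw [wder_mo (he0 k) (hFl j), ← integral_neg]
      congr 1; ext y; simp [F]
    have eq2 : S0 = fun x => G2 x + ∑ j, (1/2) * wder (fun q => (ψ q : ℂ)) (ev j) x * F j x := by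
      ext x; simp [G2]
    have hsum : ∀ k, MemLp (fun x => ∑ j, (1/2) * wder (fun q => (ψ q : ℂ)) (ev j) x * mo (e k) (F j) x) 2 volume :=
      fun k => memLp_finsetSum _ fun j _ => hpm j k
    have hsumF : MemLp (fun x => ∑ j, (1/2) * wder (fun q => (ψ q : ℂ)) (ev j) x * F j x) 2 volume :=
      memLp_finsetSum _ fun j _ => hpF j
    refine tendsto_integral_normsq (fun k => ?_) hS0 ?_
    · rw [eq1 k]; exact (hmG2 k).add (hsum k)
    · have := tendsto_add_L2 hmG2 hG2 hsum hsumF (hlim hG2)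
        (tendsto_sum_L2 Finset.univ hpm hpF fun j => tendsto_bdd_mul hK' (ha j) (hm0 j) (hF0' j) (hlim (hF j)))
      refine this.congr fun k => ?_
      congr 1; ext x
      rw [congrFun (eq1 k) x, congrFun eq2 x]
  -- second right term
  have hr2 : ∀ j k, Tendsto (fun i => ∫ x, ‖Zb ψ j (mo (e i) (F k)) x - Zb ψ k (mo (e i) (F j)) x‖ ^ 2) atTop
      (𝓝 (∫ x, ‖wderBar χ (ev j) x * b k x - wderBar χ (ev k) x * b j x‖ ^ 2)) := by
    intro j k
    set S1 : (Fin n → ℂ) → ℂ := fun x => wderBar χ (ev j) x * b k x - wderBar χ (ev k) x * b j x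
    have hS1 : MemLp S1 2 volume := (test_mul_memLp (hb k) (hχ.wderBar (ev j))).sub
      (test_mul_memLp (hb j) (hχ.wderBar (ev k)))
    have hqF : ∀ j k, MemLp (fun x => (1/2) * wderBar (fun q => (ψ q : ℂ)) (ev j) x * F k x) 2 volume :=
      fun j k => memLp_bdd_mul hK' (hab j) (hF k) (hF0' k)
    have hqm : ∀ j k i, MemLp (fun x => (1/2) * wderBar (fun q => (ψ q : ℂ)) (ev j) x * mo (e i) (F k) x) 2 volume :=
      fun j k i => memLp_bdd_mul hK' (hab j) (hmt k i).memLp (hm0 k i)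
    set G3 : (Fin n → ℂ) → ℂ := fun x => S1 x - (1/2) * wderBar (fun q => (ψ q : ℂ)) (ev j) x * F k x
      + (1/2) * wderBar (fun q => (ψ q : ℂ)) (ev k) x * F j x
    have hG3 : MemLp G3 2 volume := (hS1.sub (hqF j k)).add (hqF k j)
    have hG30 : ∀ x ∉ K, G3 x = 0 := by
      intro x hx
      simp [G3, S1, wderBar_support hx, hF0 _ x hx]
    have hmG3 : ∀ i, MemLp (mo (e i) G3) 2 volume := fun i =>
      (mo_test hK (he0 i) ((hck i).trans hKD) hG3 hG30).memLp
    have eq1 : ∀ i, (fun x => Zb ψ j (mo (e i) (F k)) x - Zb ψ k (mo (e i) (F j)) x) = fun x => mo (e i) G3 x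
        + ((1/2) * wderBar (fun q => (ψ q : ℂ)) (ev j) x * mo (e i) (F k) x
         + -((1/2) * wderBar (fun q => (ψ q : ℂ)) (ev k) x * mo (e i) (F j) x)) := by
      intro i; ext x
      have hθ : ContDiff ℝ ∞ (fun y => rhoC n (e i) (x - y)) := (rhoC_test (he0 i) x (subset_univ _)).1
      have := weak_zb hD hψ hχ hb W1 hθ j k
      have h2 : wderBar (mo (e i) (F k)) (ev j) x - wderBar (mo (e i) (F j)) (ev k) x = mo (e i) G3 x := by
        rw [wderBar_mo (he0 i) (hFl k), wderBar_mo (he0 i) (hFl j), mo]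
        exact this
      simp only [Zb]
      rw [← h2]; ring
    have eq2 : S1 = fun x => G3 x + ((1/2) * wderBar (fun q => (ψ q : ℂ)) (ev j) x * F k x
         + -((1/2) * wderBar (fun q => (ψ q : ℂ)) (ev k) x * F j x)) := by
      ext x; simp only [G3]; ring
    have hq2 : ∀ i, MemLp (fun x => -((1/2) * wderBar (fun q => (ψ q : ℂ)) (ev k) x * mo (e i) (F j) x)) 2 volume :=
      fun i => (hqm k j i).neg
    have hq3 : MemLp (fun x => -((1/2) * wderBar (fun q => (ψ q : ℂ)) (ev k) x * F j x)) 2 volume := (hqF k j).neg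
    refine tendsto_integral_normsq (fun i => ?_) hS1 ?_
    · rw [eq1 i]; exact (hmG3 i).add ((hqm j k i).add (hq2 i))
    · have t2 : Tendsto (fun i => eLpNorm (fun x => -((1/2) * wderBar (fun q => (ψ q : ℂ)) (ev k) x * mo (e i) (F j) x)
          - -((1/2) * wderBar (fun q => (ψ q : ℂ)) (ev k) x * F j x)) 2 volume) atTop (𝓝 0) := by
        refine (tendsto_bdd_mul hK' (hab k) (hm0 j) (hF0' j) (hlim (hF j))).congr fun i => ?_
        rw [← eLpNorm_neg]
        congr 1; ext x; simp; ring
      have := tendsto_add_L2 hmG3 hG3 (fun i => (hqm j k i).add (hq2 i)) ((hqF j k).add hq3) (hlim hG3)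
        (tendsto_add_L2 (hqm j k) (hqF j k) hq2 hq3
          (tendsto_bdd_mul hK' (hab j) (hm0 k) (hF0' k) (hlim (hF k))) t2)
      refine this.congr fun i => ?_
      congr 1; ext x
      have e1 := congrFun (eq1 i) x
      have e2 := congrFun eq2 x
      rw [e1]
      refine Eq.trans ?_ (congrArg _ e2.symm)
      rfl
  exact le_of_tendsto_of_tendsto' hl (hr1.add (Tendsto.const_mul _
    (tendsto_finsetSum _ fun j _ => tendsto_finsetSum _ fun k _ => hr2 j k))) hbk

end wbk2
end

noncomputable section
open MeasureTheory Set Filter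
open scoped ENNReal ComplexOrder ContDiff Topology

section cut
variable {n : ℕ} {D : Set (Fin n → ℂ)} {ψ : (Fin n → ℂ) → ℝ}
variable {s w : (Fin n → ℂ) → ℂ} {b : Fin n → (Fin n → ℂ) → ℂ}

/-- quadratic form attached to `ψ`. -/
def Qf (ψ : (Fin n → ℂ) → ℝ) (b : Fin n → ℂ) (x : Fin n → ℂ) : ℝ :=
  (∑ j, ∑ k, Lv ψ (ev j) (ev k) x * b j * (starRingEnd ℂ) (b k)).re

/-- right side integrand -/
def Rf (χ s : (Fin n → ℂ) → ℂ) (b : Fin n → (Fin n → ℂ) → ℂ) (x : Fin n → ℂ) : ℝ :=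
  ‖χ x * s x - ∑ j, (wder χ (ev j) x * b j x)‖ ^ 2
    + (1/2) * ∑ j, ∑ k, ‖wderBar χ (ev j) x * b k x - wderBar χ (ev k) x * b j x‖ ^ 2

theorem Rf_nonneg (χ s : (Fin n → ℂ) → ℂ) (b : Fin n → (Fin n → ℂ) → ℂ) (x : Fin n → ℂ) :
    0 ≤ Rf χ s b x := by
  unfold Rf; positivity

theorem Rf_le {c : (Fin n → ℂ) → ℂ} {x : Fin n → ℂ} {g : ℝ} (hg : ∀ j, ‖wder c (ev j) x‖ ≤ g)
    (hg' : ∀ j, ‖wderBar c (ev j) x‖ ≤ g) :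
    Rf c s b x ≤ 2 * ‖c x‖ ^ 2 * ‖s x‖ ^ 2 + 4 * n * g ^ 2 * ∑ j, ‖b j x‖ ^ 2 := by
  have h2 : ∀ a b : ℂ, ‖a - b‖ ^ 2 ≤ 2 * ‖a‖ ^ 2 + 2 * ‖b‖ ^ 2 := by
    intro a b
    have h1 := norm_sub_le a b
    have h3 := norm_nonneg (a - b)
    nlinarith [sq_nonneg (‖a‖ - ‖b‖)]
  have hsum : ‖∑ j, wder c (ev j) x * b j x‖ ^ 2 ≤ n * g ^ 2 * ∑ j, ‖b j x‖ ^ 2 := by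
    have h1 : ‖∑ j, wder c (ev j) x * b j x‖ ≤ ∑ j, g * ‖b j x‖ := by
      refine (norm_sum_le _ _).trans (Finset.sum_le_sum fun j _ => ?_)
      rw [norm_mul]; gcongr; exact hg j
    calc ‖∑ j, wder c (ev j) x * b j x‖ ^ 2 ≤ (∑ j, g * ‖b j x‖) ^ 2 := by gcongr
      _ ≤ (Finset.univ : Finset (Fin n)).card * ∑ j, (g * ‖b j x‖) ^ 2 := sq_sum_le_card_mul_sum_sq
      _ = _ := by simp only [Finset.card_univ, Fintype.card_fin, mul_pow, ← Finset.mul_sum]; ring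
  have h3 : ∀ j k, ‖wderBar c (ev j) x * b k x - wderBar c (ev k) x * b j x‖ ^ 2
      ≤ 2 * g ^ 2 * ‖b k x‖ ^ 2 + 2 * g ^ 2 * ‖b j x‖ ^ 2 := by
    intro j k
    refine (h2 _ _).trans ?_
    rw [norm_mul, norm_mul, mul_pow, mul_pow]
    have a1 : ‖wderBar c (ev j) x‖ ^ 2 ≤ g ^ 2 := by gcongr; exact hg' j
    have a2 : ‖wderBar c (ev k) x‖ ^ 2 ≤ g ^ 2 := by gcongr; exact hg' k
    nlinarith [sq_nonneg ‖b k x‖, sq_nonneg ‖b j x‖, mul_le_mul_of_nonneg_right a1 (sq_nonneg ‖b k x‖),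
      mul_le_mul_of_nonneg_right a2 (sq_nonneg ‖b j x‖)]
  have h4 : ∑ j, ∑ k, ‖wderBar c (ev j) x * b k x - wderBar c (ev k) x * b j x‖ ^ 2
      ≤ 4 * n * g ^ 2 * ∑ j, ‖b j x‖ ^ 2 := by
    refine (Finset.sum_le_sum fun j _ => Finset.sum_le_sum fun k _ => h3 j k).trans (le_of_eq ?_)
    simp only [Finset.sum_add_distrib, ← Finset.mul_sum, Finset.sum_const, Finset.card_univ, Fintype.card_fin,
      nsmul_eq_mul]
    ring
  unfold Rf
  have h5 := h2 (c x * s x) (∑ j, (wder c (ev j) x * b j x))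
  rw [norm_mul, mul_pow] at h5
  nlinarith

theorem weak_bk_lint (hD : IsOpen D) (hψ : ContDiffOn ℝ ∞ ψ D) {c : (Fin n → ℂ) → ℝ}
    (hχ : IsTest D (fun x => (c x : ℂ)))
    (hb : ∀ j, MemLp (b j) 2 (volume.restrict D)) (hs : MemLp s 2 (volume.restrict D))
    (hQ : ∀ x ∈ D, ∀ ξ : Fin n → ℂ, 0 ≤ Qf ψ ξ x)
    (W1 : ∀ θ, IsTest D θ → ∀ j, ∫ x, w x * Tb ψ j θ x = ∫ x, b j x * θ x)
    (W2 : ∀ θ, IsTest D θ → ∑ j, ∫ x, b j x * (wder θ (ev j) x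
      + (1/2) * wder (fun q => (ψ q : ℂ)) (ev j) x * θ x) = ∫ x, s x * θ x) :
    ∫⁻ x in D, ENNReal.ofReal (c x ^ 2 * Qf ψ (fun j => b j x) x)
      ≤ ∫⁻ x in D, ENNReal.ofReal (Rf (fun x => (c x : ℂ)) s b x) := by
  have h := weak_bk hD hψ hχ hb hs W1 W2
  set χ : (Fin n → ℂ) → ℂ := fun x => (c x : ℂ)
  have hLt : ∀ j k, MemLp (fun x => (Lv ψ (ev j) (ev k) x * χ x) * b j x) 2 volume := fun j k =>
    test_mul_memLp (hb j) (IsTest.mul_left hD (contDiffOn_Lv hD hψ _ _) hχ)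
  have hF : ∀ j, MemLp (fun x => χ x * b j x) 2 volume := fun j => test_mul_memLp (hb j) hχ
  have hi : Integrable (fun x => ∑ j, ∑ k, Lv ψ (ev j) (ev k) x * (χ x * b j x) *
      (starRingEnd ℂ) (χ x * b k x)) := by
    refine integrable_finsetSum _ fun j _ => integrable_finsetSum _ fun k _ => ?_
    refine ((hLt j k).integrable_mul (hF k).star).congr (Eventually.of_forall fun x => ?_)
    simp only [Pi.mul_apply, Pi.star_apply, RCLike.star_def]; ring
  have hir : Integrable (fun x => (∑ j, ∑ k, Lv ψ (ev j) (ev k) x * (χ x * b j x) *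
      (starRingEnd ℂ) (χ x * b k x)).re) := hi.re
  have e1 : (fun x => (∑ j, ∑ k, Lv ψ (ev j) (ev k) x * (χ x * b j x) *
      (starRingEnd ℂ) (χ x * b k x)).re) = fun x => c x ^ 2 * Qf ψ (fun j => b j x) x := by
    ext x
    rw [Qf, ← Complex.re_ofReal_mul, Finset.mul_sum]
    congr 1
    refine Finset.sum_congr rfl fun j _ => ?_
    rw [Finset.mul_sum]
    refine Finset.sum_congr rfl fun k _ => ?_
    simp [χ]; ring
  rw [e1] at h hir
  have hS0 : MemLp (fun x => χ x * s x - ∑ j, (wder χ (ev j) x * b j x)) 2 volume := (test_mul_memLp hs hχ).sub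
    (memLp_finsetSum _ fun j _ => test_mul_memLp (hb j) (hχ.wder (ev j)))
  have hS1 : ∀ j k, MemLp (fun x => wderBar χ (ev j) x * b k x - wderBar χ (ev k) x * b j x) 2 volume :=
    fun j k => (test_mul_memLp (hb k) (hχ.wderBar (ev j))).sub (test_mul_memLp (hb j) (hχ.wderBar (ev k)))
  have i0 : Integrable (fun x => ‖χ x * s x - ∑ j, (wder χ (ev j) x * b j x)‖ ^ 2) :=
    (memLp_two_iff_integrable_sq_norm hS0.1).1 hS0
  have i1 : ∀ j k, Integrable (fun x => ‖wderBar χ (ev j) x * b k x - wderBar χ (ev k) x * b j x‖ ^ 2) :=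
    fun j k => (memLp_two_iff_integrable_sq_norm (hS1 j k).1).1 (hS1 j k)
  have i2 : Integrable (fun x => ∑ j, ∑ k, ‖wderBar χ (ev j) x * b k x - wderBar χ (ev k) x * b j x‖ ^ 2) :=
    integrable_finsetSum _ fun j _ => integrable_finsetSum _ fun k _ => i1 j k
  have hiR : Integrable (Rf χ s b) := i0.add (i2.const_mul _)
  have e2 : (∫ x, ‖χ x * s x - ∑ j, (wder χ (ev j) x * b j x)‖ ^ 2)
        + (1/2) * ∑ j, ∑ k, ∫ x, ‖wderBar χ (ev j) x * b k x - wderBar χ (ev k) x * b j x‖ ^ 2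
      = ∫ x, Rf χ s b x := by
    simp only [Rf]
    rw [integral_add i0 (i2.const_mul _), integral_const_mul,
      integral_finsetSum _ fun j _ => integrable_finsetSum _ fun k _ => i1 j k]
    simp_rw [fun j => integral_finsetSum Finset.univ fun k _ => i1 j k]
  rw [e2] at h
  have hc0 : ∀ x ∉ D, c x = 0 := fun x hx => by
    have := hχ.eq_zero hx
    simpa [χ] using this
  have hpos : ∀ x, 0 ≤ c x ^ 2 * Qf ψ (fun j => b j x) x := by
    intro x
    by_cases hx : x ∈ D
    · exact mul_nonneg (sq_nonneg _) (hQ x hx _)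
    · simp [hc0 x hx]
  have hR0 : ∀ x ∉ D, Rf χ s b x = 0 := by
    intro x hx
    have hx' : x ∉ tsupport χ := fun h => hx (hχ.2.2 h)
    simp [Rf, wder_support hx', wderBar_support hx', hχ.eq_zero hx]
  calc ∫⁻ x in D, ENNReal.ofReal (c x ^ 2 * Qf ψ (fun j => b j x) x)
      ≤ ∫⁻ x, ENNReal.ofReal (c x ^ 2 * Qf ψ (fun j => b j x) x) := setLIntegral_le_lintegral _ _
    _ = ENNReal.ofReal (∫ x, c x ^ 2 * Qf ψ (fun j => b j x) x) :=
        (ofReal_integral_eq_lintegral_ofReal hir (Eventually.of_forall hpos)).symm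
    _ ≤ ENNReal.ofReal (∫ x, Rf χ s b x) := ENNReal.ofReal_le_ofReal h
    _ = ∫⁻ x, ENNReal.ofReal (Rf χ s b x) :=
        ofReal_integral_eq_lintegral_ofReal hiR (Eventually.of_forall fun x => Rf_nonneg _ _ _ _)
    _ = ∫⁻ x in D, ENNReal.ofReal (Rf χ s b x) := by
        rw [← lintegral_indicator hD.measurableSet]
        congr 1; ext x
        by_cases hx : x ∈ D
        · simp [hx]
        · simp [hx, hR0 x hx]

theorem wder_comp_real {m : (Fin n → ℂ) → ℝ} {P : ℝ → ℝ} {x : Fin n → ℂ} (hP : DifferentiableAt ℝ P (m x))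
    (hm : DifferentiableAt ℝ m x) (v : Fin n → ℂ) :
    wder (fun y => (P (m y) : ℂ)) v x = ((deriv P (m x) : ℝ) : ℂ) * wder (fun y => (m y : ℂ)) v x := by
  have hc : fderiv ℝ (fun y => P (m y)) x = deriv P (m x) • fderiv ℝ m x :=
    (hP.hasDerivAt.comp_hasFDerivAt x hm.hasFDerivAt).fderiv
  rw [wder_ofReal_eq v hm, wder_ofReal_eq v (f := fun y => P (m y)) (hP.comp x hm), hc]
  simp
  ring

theorem cut_test (hD : IsOpen D) {m : (Fin n → ℂ) → ℝ} (hm : ContDiffOn ℝ ∞ m D)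
    (hmc : ∀ ε > 0, IsCompact {x ∈ D | ε ≤ m x}) {P : ℝ → ℝ} (hP : ContDiff ℝ ∞ P) {a : ℝ} (ha : 0 < a)
    (hPa : ∀ t ≤ a, P t = 0) : IsTest D (fun x => ((D.indicator (fun x => P (m x)) x : ℝ) : ℂ)) := by
  set χ : (Fin n → ℂ) → ℂ := fun x => ((D.indicator (fun x => P (m x)) x : ℝ) : ℂ)
  have hts : tsupport χ ⊆ {x ∈ D | a ≤ m x} := by
    refine closure_minimal (fun x hx => ?_) (hmc a ha).isClosed
    by_contra hc
    apply hx
    by_cases hxD : x ∈ D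
    · have : m x < a := by
        by_contra h; exact hc ⟨hxD, not_lt.1 h⟩
      simp [χ, hxD, hPa _ this.le]
    · simp [χ, hxD]
  refine ⟨?_, (hmc a ha).of_isClosed_subset isClosed_closure hts, hts.trans fun x hx => hx.1⟩
  rw [contDiff_iff_contDiffAt]
  intro x
  by_cases hx : x ∈ D
  · have h1 : ContDiffAt ℝ ∞ (fun x => ((P (m x) : ℝ) : ℂ)) x :=
      Complex.ofRealCLM.contDiff.contDiffAt.comp x
        (hP.contDiffAt.comp x (hm.contDiffAt (hD.mem_nhds hx)))
    refine h1.congr_of_eventuallyEq ?_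
    filter_upwards [hD.mem_nhds hx] with y hy
    simp [χ, hy]
  · have : χ =ᶠ[𝓝 x] fun _ => 0 :=
      notMem_tsupport_iff_eventuallyEq.1 fun h => hx (hts h).1
    exact contDiffAt_const.congr_of_eventuallyEq this

theorem cut_wder (hD : IsOpen D) {m : (Fin n → ℂ) → ℝ} (hm : ContDiffOn ℝ ∞ m D)
    {P : ℝ → ℝ} (hP : ContDiff ℝ ∞ P) {x : Fin n → ℂ} (hx : x ∈ D) (v : Fin n → ℂ) :
    wder (fun x => ((D.indicator (fun x => P (m x)) x : ℝ) : ℂ)) v x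
      = ((deriv P (m x) : ℝ) : ℂ) * wder (fun y => (m y : ℂ)) v x := by
  rw [← wder_comp_real (hP.differentiable (by simp) _) (diffAt_of_contDiffOn hD hx hm)]
  refine wder_congr v ?_
  filter_upwards [hD.mem_nhds hx] with y hy
  simp [hy]

theorem cut_wderBar_norm (hD : IsOpen D) {m : (Fin n → ℂ) → ℝ} (hm : ContDiffOn ℝ ∞ m D)
    {P : ℝ → ℝ} (hP : ContDiff ℝ ∞ P) {x : Fin n → ℂ} (hx : x ∈ D) (v : Fin n → ℂ) :
    ‖wderBar (fun x => ((D.indicator (fun x => P (m x)) x : ℝ) : ℂ)) v x‖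
      = ‖wder (fun x => ((D.indicator (fun x => P (m x)) x : ℝ) : ℂ)) v x‖ := by
  have hd : DifferentiableAt ℝ (fun x => D.indicator (fun x => P (m x)) x) x := by
    have : DifferentiableAt ℝ (fun x => P (m x)) x :=
      (hP.differentiable (by simp) _).comp x (diffAt_of_contDiffOn hD hx hm)
    refine this.congr_of_eventuallyEq ?_
    filter_upwards [hD.mem_nhds hx] with y hy
    simp [hy]
  rw [← conj_wderBar_ofReal v hd, RCLike.norm_conj]

theorem deriv_bdd {p : ℝ → ℝ} (hp : ContDiff ℝ ∞ p) (h0 : ∀ x < 1, p x = 0) {c d : ℝ}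
    (h1 : ∀ x > 2, p x = c * x + d) : ∃ C, 0 ≤ C ∧ ∀ x, |deriv p x| ≤ C := by
  have hcont : Continuous (deriv p) := hp.continuous_deriv (by simp)
  obtain ⟨C, hC⟩ := (isCompact_Icc (a := (1:ℝ)) (b := 2)).exists_bound_of_continuousOn hcont.continuousOn
  refine ⟨max C |c|, le_max_of_le_right (abs_nonneg _), fun x => ?_⟩
  rcases lt_or_ge x 1 with h | h
  · have : p =ᶠ[𝓝 x] fun _ => 0 := by
      filter_upwards [Iio_mem_nhds h] with y hy using h0 y hy
    rw [this.deriv_eq]; simp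
  rcases le_or_gt x 2 with h' | h'
  · exact (hC x ⟨h, h'⟩).trans (le_max_left _ _)
  · have : p =ᶠ[𝓝 x] fun x => c * x + d := by
      filter_upwards [Ioi_mem_nhds h'] with y hy using h1 y hy
    rw [this.deriv_eq]
    simp

end cut
end

noncomputable section
open MeasureTheory Set Filter
open scoped ENNReal ComplexOrder ContDiff Topology

section cut2
variable {n : ℕ} {D : Set (Fin n → ℂ)} {ψ : (Fin n → ℂ) → ℝ}
variable {s w : (Fin n → ℂ) → ℂ} {b : Fin n → (Fin n → ℂ) → ℂ}

theorem aemeas_Qf (hD : IsOpen D) (hψ : ContDiffOn ℝ ∞ ψ D) (hb : ∀ j, AEMeasurable (b j) (volume.restrict D)) :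
    AEMeasurable (fun x => Qf ψ (fun j => b j x) x) (volume.restrict D) := by
  unfold Qf
  refine Complex.measurable_re.comp_aemeasurable (Finset.aemeasurable_fun_sum _ fun j _ =>
    Finset.aemeasurable_fun_sum _ fun k _ => ?_)
  have h1 : AEMeasurable (Lv ψ (ev j) (ev k)) (volume.restrict D) :=
    (contDiffOn_Lv hD hψ _ _).continuousOn.aemeasurable hD.measurableSet
  exact (h1.mul (hb j)).mul (Complex.continuous_conj.measurable.comp_aemeasurable (hb k))

theorem aemeas_Rf {χ : (Fin n → ℂ) → ℂ} (hχ : IsTest D χ) (hb : ∀ j, AEMeasurable (b j) (volume.restrict D))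
    (hs : AEMeasurable s (volume.restrict D)) :
    AEMeasurable (fun x => Rf χ s b x) (volume.restrict D) := by
  unfold Rf
  have c0 := hχ.1.continuous.aemeasurable (μ := volume.restrict D)
  have c1 := fun j => (hχ.wder (ev j)).1.continuous.aemeasurable (μ := volume.restrict D)
  have c2 := fun j => (hχ.wderBar (ev j)).1.continuous.aemeasurable (μ := volume.restrict D)
  refine AEMeasurable.add ?_ (AEMeasurable.const_mul ?_ _)
  · exact (((c0.mul hs).sub (Finset.aemeasurable_fun_sum _ fun j _ => (c1 j).mul (hb j))).norm).pow_const 2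
  · exact Finset.aemeasurable_fun_sum _ fun j _ => Finset.aemeasurable_fun_sum _ fun k _ =>
      ((((c2 j).mul (hb k)).sub ((c2 k).mul (hb j))).norm).pow_const 2

theorem liminf_of_ev {f : ℕ → ℝ≥0∞} {a : ℝ≥0∞} (h : ∀ᶠ ν in atTop, f ν = a) : a = liminf f atTop := by
  have h1 : Tendsto f atTop (𝓝 a) := tendsto_const_nhds.congr' (h.mono fun ν hν => hν.symm)
  exact h1.liminf_eq.symm

theorem lint_sq_ne_top {f : (Fin n → ℂ) → ℂ} (hf : MemLp f 2 (volume.restrict D)) :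
    ∫⁻ x in D, ENNReal.ofReal (‖f x‖ ^ 2) ≠ ⊤ := by
  have := (memLp_two_iff_integrable_sq_norm hf.1).1 hf
  exact ((hasFiniteIntegral_iff_ofReal (Eventually.of_forall fun x => sq_nonneg _)).1 this.2).ne

set_option maxHeartbeats 1600000 in
theorem bk_final (hD : IsOpen D) (hψ : ContDiffOn ℝ ∞ ψ D) {m : (Fin n → ℂ) → ℝ} {M : ℝ}
    (hm : ContDiffOn ℝ ∞ m D) (hm0 : ∀ x ∈ D, 0 < m x) (hmM : ∀ x ∈ D, m x ≤ M)
    (hmd : ∀ x ∈ D, ∀ j, ‖wder (fun y => (m y : ℂ)) (ev j) x‖ ≤ M)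
    (hmc : ∀ ε > 0, IsCompact {x ∈ D | ε ≤ m x})
    (hQ : ∀ x ∈ D, ∀ ξ : Fin n → ℂ, ∑ j, ‖ξ j‖ ^ 2 ≤ m x ^ 4 * Qf ψ ξ x)
    (hb : ∀ j, MemLp (b j) 2 (volume.restrict D)) (hs : MemLp s 2 (volume.restrict D))
    (W1 : ∀ θ, IsTest D θ → ∀ j, ∫ x, w x * Tb ψ j θ x = ∫ x, b j x * θ x)
    (W2 : ∀ θ, IsTest D θ → ∑ j, ∫ x, b j x * (wder θ (ev j) x
      + (1/2) * wder (fun q => (ψ q : ℂ)) (ev j) x * θ x) = ∫ x, s x * θ x) :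
    ∫⁻ x in D, ENNReal.ofReal (Qf ψ (fun j => b j x) x) ≤ ∫⁻ x in D, ENNReal.ofReal (‖s x‖ ^ 2) := by
  have hQ0 : ∀ x ∈ D, ∀ ξ : Fin n → ℂ, 0 ≤ Qf ψ ξ x := by
    intro x hx ξ
    have h1 := hQ x hx ξ
    have h2 : 0 ≤ ∑ j, ‖ξ j‖ ^ 2 := Finset.sum_nonneg fun j _ => sq_nonneg _
    have h3 : 0 < m x ^ 4 := pow_pos (hm0 x hx) 4
    by_contra hc
    push Not at hc
    nlinarith [mul_neg_of_pos_of_neg h3 hc]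
  have hbm : ∀ j, AEMeasurable (b j) (volume.restrict D) := fun j => (hb j).1.aemeasurable
  have hsm : AEMeasurable s (volume.restrict D) := hs.1.aemeasurable
  have hmm : AEMeasurable m (volume.restrict D) := hm.continuousOn.aemeasurable hD.measurableSet
  have hQm := aemeas_Qf hD hψ hbm
  set B : (Fin n → ℂ) → ℝ := fun x => ∑ j, ‖b j x‖ ^ 2 with hB
  have hBm : AEMeasurable B (volume.restrict D) :=
    Finset.aemeasurable_fun_sum _ fun j _ => (hbm j).norm.pow_const 2
  have hB0 : ∀ x, 0 ≤ B x := fun x => Finset.sum_nonneg fun j _ => sq_nonneg _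
  -- general consequence for cutoffs
  have key : ∀ (P : ℝ → ℝ) (a : ℝ), ContDiff ℝ ∞ P → 0 < a → (∀ t ≤ a, P t = 0) →
      ∫⁻ x in D, ENNReal.ofReal (P (m x) ^ 2 * Qf ψ (fun j => b j x) x)
        ≤ ∫⁻ x in D, ENNReal.ofReal (Rf (fun x => ((D.indicator (fun x => P (m x)) x : ℝ) : ℂ)) s b x) := by
    intro P a hP ha hPa
    have h := weak_bk_lint hD hψ (c := fun x => D.indicator (fun x => P (m x)) x)
      (cut_test hD hm hmc hP ha hPa) hb hs hQ0 W1 W2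
    refine le_trans (le_of_eq ?_) h
    refine setLIntegral_congr_fun hD.measurableSet fun x hx => ?_
    simp [hx]
  have keyR : ∀ (P : ℝ → ℝ), ContDiff ℝ ∞ P → ∀ x ∈ D,
      Rf (fun x => ((D.indicator (fun x => P (m x)) x : ℝ) : ℂ)) s b x
        ≤ 2 * P (m x) ^ 2 * ‖s x‖ ^ 2 + 4 * n * (|deriv P (m x)| * M) ^ 2 * B x := by
    intro P hP x hx
    have h1 : ∀ j, ‖wder (fun x => ((D.indicator (fun x => P (m x)) x : ℝ) : ℂ)) (ev j) x‖
        ≤ |deriv P (m x)| * M := by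
      intro j
      rw [cut_wder hD hm hP hx, norm_mul, Complex.norm_real, Real.norm_eq_abs]
      gcongr; exact hmd x hx j
    refine (Rf_le h1 fun j => ?_).trans (le_of_eq ?_)
    · rw [cut_wderBar_norm hD hm hP hx]; exact h1 j
    · simp [hx, hB]
  have hsq := lint_sq_ne_top hs
  have hBi : ∫⁻ x in D, ENNReal.ofReal (B x) ≠ ⊤ := by
    have : Integrable B (volume.restrict D) :=
      integrable_finsetSum _ fun j _ => (memLp_two_iff_integrable_sq_norm (hb j).1).1 (hb j)
    exact ((hasFiniteIntegral_iff_ofReal (Eventually.of_forall hB0)).1 this.2).ne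
  -- step 1
  have step1 : ∫⁻ x in D, ENNReal.ofReal (m x ^ 2 * (m x ^ 4)⁻¹ * B x) ≠ ⊤ := by
    set p : ℝ → ℝ := fun t => t * Real.smoothTransition (t - 1)
    have hp : ContDiff ℝ ∞ p :=
      contDiff_id.mul (Real.smoothTransition.contDiff.comp (contDiff_id.sub contDiff_const))
    have hp0 : ∀ t ≤ 1, p t = 0 := fun t ht => by
      simp [p, Real.smoothTransition.zero_of_nonpos (show t - 1 ≤ 0 by linarith)]
    have hp1 : ∀ t ≥ 2, p t = t := fun t ht => by
      simp [p, Real.smoothTransition.one_of_one_le (show 1 ≤ t - 1 by linarith)]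
    have hpa : ∀ t, |p t| ≤ |t| := fun t => by
      simp only [p, abs_mul]
      have : |Real.smoothTransition (t-1)| ≤ 1 := by
        rw [abs_of_nonneg (Real.smoothTransition.nonneg _)]; exact Real.smoothTransition.le_one _
      nlinarith [abs_nonneg t]
    obtain ⟨C, hC0, hC⟩ := deriv_bdd hp (fun x hx => hp0 x hx.le) (c := 1) (d := 0)
      (fun x hx => by rw [hp1 x hx.le]; ring)
    set P : ℕ → ℝ → ℝ := fun ν t => ((ν:ℝ) + 1)⁻¹ * p (((ν:ℝ) + 1) * t)
    have hPs : ∀ ν, ContDiff ℝ ∞ (P ν) := fun ν =>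
      contDiff_const.mul (hp.comp (contDiff_const.mul contDiff_id))
    have hPd : ∀ ν t, |deriv (P ν) t| ≤ C := by
      intro ν t
      have hν : (0:ℝ) < (ν:ℝ) + 1 := by positivity
      have : deriv (P ν) t = deriv p (((ν:ℝ) + 1) * t) := by
        have h1 : HasDerivAt (fun t => ((ν:ℝ) + 1) * t) (((ν:ℝ) + 1)) t := by
          simpa using (hasDerivAt_id t).const_mul ((ν:ℝ) + 1)
        have h2 := (((hp.differentiable (by simp) (((ν:ℝ) + 1) * t)).hasDerivAt.comp t h1).const_mul ((ν:ℝ) + 1)⁻¹).deriv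
        rw [show deriv (P ν) t = _ from h2]
        field_simp
      rw [this]; exact hC _
    have hPb : ∀ ν t, |P ν t| ≤ |t| := by
      intro ν t
      have hν : (0:ℝ) < (ν:ℝ) + 1 := by positivity
      simp only [P, abs_mul, abs_inv]
      have := hpa (((ν:ℝ) + 1) * t)
      rw [abs_mul ((ν:ℝ)+1) t] at this
      rw [inv_mul_le_iff₀ (by positivity)]
      exact this
    have hPt : ∀ t > 0, ∀ᶠ ν : ℕ in atTop, P ν t = t := by
      intro t ht
      obtain ⟨N, hN⟩ := exists_nat_gt (2 / t)
      filter_upwards [eventually_ge_atTop N] with ν hν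
      have h1 : 2 ≤ ((ν:ℝ) + 1) * t := by
        have : (N:ℝ) ≤ ν := by exact_mod_cast hν
        rw [div_lt_iff₀ ht] at hN
        nlinarith
      simp only [P]
      rw [hp1 _ h1]
      field_simp
    set G : ℝ≥0∞ := ∫⁻ x in D, ENNReal.ofReal (2 * M ^ 2 * ‖s x‖ ^ 2 + 4 * n * (C * M) ^ 2 * B x) with hG
    have hGt : G ≠ ⊤ := by
      have i1 := (memLp_two_iff_integrable_sq_norm hs.1).1 hs
      have i2 : Integrable B (volume.restrict D) :=
        integrable_finsetSum _ fun j _ => (memLp_two_iff_integrable_sq_norm (hb j).1).1 (hb j)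
      have i3 : Integrable (fun x => 2 * M ^ 2 * ‖s x‖ ^ 2 + 4 * n * (C * M) ^ 2 * B x) (volume.restrict D) :=
        (i1.const_mul _).add (i2.const_mul _)
      refine ((hasFiniteIntegral_iff_ofReal (Eventually.of_forall fun x => ?_)).1 i3.2).ne
      have := hB0 x
      positivity
    have hbd : ∀ ν, ∫⁻ x in D, ENNReal.ofReal (P ν (m x) ^ 2 * (m x ^ 4)⁻¹ * B x) ≤ G := by
      intro ν
      have hν : (0:ℝ) < (ν:ℝ) + 1 := by positivity
      refine le_trans ?_ ((key (P ν) (((ν:ℝ) + 1)⁻¹) (hPs ν) (by positivity) ?_).trans ?_)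
      · refine setLIntegral_mono' hD.measurableSet fun x hx => ENNReal.ofReal_le_ofReal ?_
        rw [mul_assoc]
        gcongr
        rw [inv_mul_le_iff₀ (pow_pos (hm0 x hx) 4)]
        exact hQ x hx _
      · intro t ht
        have : ((ν:ℝ) + 1) * t ≤ 1 := by
          calc ((ν:ℝ) + 1) * t ≤ ((ν:ℝ) + 1) * ((ν:ℝ) + 1)⁻¹ := by gcongr
            _ = 1 := by field_simp
        simp [P, hp0 _ this]
      · refine setLIntegral_mono' hD.measurableSet fun x hx => ENNReal.ofReal_le_ofReal ?_
        refine (keyR (P ν) (hPs ν) x hx).trans ?_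
        have h1 : P ν (m x) ^ 2 ≤ M ^ 2 := by
          rw [← sq_abs]
          have := hPb ν (m x)
          rw [abs_of_pos (hm0 x hx)] at this
          have := hmM x hx
          gcongr; linarith
        have hM : 0 ≤ M := (hm0 x hx).le.trans (hmM x hx)
        have := hPd ν (m x)
        have := hB0 x
        gcongr
    have hme : ∀ ν, AEMeasurable (fun x => ENNReal.ofReal (P ν (m x) ^ 2 * (m x ^ 4)⁻¹ * B x))
        (volume.restrict D) := by
      intro ν
      have a1 : AEMeasurable (fun x => P ν (m x)) (volume.restrict D) :=
        (hPs ν).continuous.measurable.comp_aemeasurable hmm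
      have a2 : AEMeasurable (fun x => P ν (m x) ^ 2) (volume.restrict D) := a1.pow_const 2
      have a3 : AEMeasurable (fun x => m x ^ 4) (volume.restrict D) := hmm.pow_const 4
      have a4 : AEMeasurable (fun x => (m x ^ 4)⁻¹) (volume.restrict D) := a3.inv
      have a5 : AEMeasurable (fun x => P ν (m x) ^ 2 * (m x ^ 4)⁻¹) (volume.restrict D) := a2.mul a4
      exact (a5.mul hBm).ennreal_ofReal
    have hfa := lintegral_liminf_le' (u := (atTop : Filter ℕ)) (μ := volume.restrict D) hme
    have h2 : ∫⁻ x in D, ENNReal.ofReal (m x ^ 2 * (m x ^ 4)⁻¹ * B x) ≤ G := by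
      calc _ = ∫⁻ x in D, liminf (fun ν => ENNReal.ofReal (P ν (m x) ^ 2 * (m x ^ 4)⁻¹ * B x)) atTop := by
            refine setLIntegral_congr_fun hD.measurableSet fun x hx => ?_
            refine liminf_of_ev ?_
            filter_upwards [hPt (m x) (hm0 x hx)] with ν hν
            rw [hν]
        _ ≤ _ := hfa
        _ ≤ liminf (fun _ : ℕ => G) atTop := liminf_le_liminf (Eventually.of_forall hbd)
        _ = G := by simp
    exact ne_top_of_le_ne_top hGt h2
  -- step 2
  set p : ℝ → ℝ := fun t => Real.smoothTransition (t - 1)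
  have hp : ContDiff ℝ ∞ p :=
    (Real.smoothTransition.contDiff.comp (contDiff_id.sub contDiff_const))
  have hp0 : ∀ t ≤ 1, p t = 0 := fun t ht => by
    simp [p, Real.smoothTransition.zero_of_nonpos (show t - 1 ≤ 0 by linarith)]
  have hp1 : ∀ t ≥ 2, p t = 1 := fun t ht => by
    simp [p, Real.smoothTransition.one_of_one_le (show 1 ≤ t - 1 by linarith)]
  obtain ⟨C, hC0, hC⟩ := deriv_bdd hp (fun x hx => hp0 x hx.le) (c := 0) (d := 1)
    (fun x hx => by rw [hp1 x hx.le]; ring)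
  have hd2 : ∀ t > 2, deriv p t = 0 := by
    intro t ht
    have : p =ᶠ[𝓝 t] fun _ => 1 := by
      filter_upwards [Ioi_mem_nhds ht] with y hy using hp1 y (le_of_lt hy)
    rw [this.deriv_eq]; simp
  set P : ℕ → ℝ → ℝ := fun ν t => p (((ν:ℝ) + 1) * t)
  have hPs : ∀ ν, ContDiff ℝ ∞ (P ν) := fun ν => (hp.comp (contDiff_const.mul contDiff_id))
  have hPd : ∀ ν t, deriv (P ν) t = ((ν:ℝ) + 1) * deriv p (((ν:ℝ) + 1) * t) := by
    intro ν t
    have h1 : HasDerivAt (fun t => ((ν:ℝ) + 1) * t) (((ν:ℝ) + 1)) t := by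
      simpa using (hasDerivAt_id t).const_mul ((ν:ℝ) + 1)
    have h2 := (((hp.differentiable (by simp) (((ν:ℝ) + 1) * t)).hasDerivAt.comp t h1)).deriv
    rw [show deriv (P ν) t = _ from h2]
    ring
  have hPd2 : ∀ ν, ∀ t > 0, |deriv (P ν) t| ≤ 2 * C * t⁻¹ := by
    intro ν t ht
    rw [hPd]
    rcases le_or_gt (((ν:ℝ) + 1) * t) 2 with h | h
    · rw [abs_mul, abs_of_pos (show (0:ℝ) < (ν:ℝ)+1 by positivity)]
      have := hC (((ν:ℝ) + 1) * t)
      have h3 : (ν:ℝ) + 1 ≤ 2 * t⁻¹ := by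
        rw [← div_eq_mul_inv, le_div_iff₀ ht]; exact h
      calc _ ≤ (2 * t⁻¹) * C := by gcongr
        _ = _ := by ring
    · rw [hd2 _ h]; simp; positivity
  have hPb : ∀ ν t, P ν t ^ 2 ≤ 1 := by
    intro ν t
    have h1 := Real.smoothTransition.nonneg (((ν:ℝ) + 1) * t - 1)
    have h2 := Real.smoothTransition.le_one (((ν:ℝ) + 1) * t - 1)
    simp only [P, p]
    nlinarith
  have hlarge : ∀ t > 0, ∀ᶠ ν : ℕ in atTop, 2 < ((ν:ℝ) + 1) * t := by
    intro t ht
    obtain ⟨N, hN⟩ := exists_nat_gt (2 / t)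
    filter_upwards [eventually_ge_atTop N] with ν hν
    have : (N:ℝ) ≤ ν := by exact_mod_cast hν
    rw [div_lt_iff₀ ht] at hN
    nlinarith
  have hPa : ∀ ν : ℕ, ∀ t ≤ ((ν:ℝ) + 1)⁻¹, P ν t = 0 := by
    intro ν t ht
    have hν : (0:ℝ) < (ν:ℝ) + 1 := by positivity
    have : ((ν:ℝ) + 1) * t ≤ 1 := by
      calc ((ν:ℝ) + 1) * t ≤ ((ν:ℝ) + 1) * ((ν:ℝ) + 1)⁻¹ := by gcongr
        _ = 1 := by field_simp
    simp [P, hp0 _ this]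
  have hmain : ∀ ν, ∫⁻ x in D, ENNReal.ofReal (P ν (m x) ^ 2 * Qf ψ (fun j => b j x) x)
        ≤ ∫⁻ x in D, ENNReal.ofReal (Rf (fun x => ((D.indicator (fun x => P ν (m x)) x : ℝ) : ℂ)) s b x) :=
    fun ν => key (P ν) (((ν:ℝ) + 1)⁻¹) (hPs ν) (by positivity) (hPa ν)
  have hdom : Tendsto (fun ν => ∫⁻ x in D,
      ENNReal.ofReal (Rf (fun x => ((D.indicator (fun x => P ν (m x)) x : ℝ) : ℂ)) s b x)) atTop
      (𝓝 (∫⁻ x in D, ENNReal.ofReal (‖s x‖ ^ 2))) := by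
    refine tendsto_lintegral_of_dominated_convergence' (fun x => ENNReal.ofReal (2 * ‖s x‖ ^ 2)
      + ENNReal.ofReal (4 * n * (2 * C * M) ^ 2) * ENNReal.ofReal (m x ^ 2 * (m x ^ 4)⁻¹ * B x)) (fun ν => ?_) (fun ν => ?_) ?_ ?_
    · exact (aemeas_Rf (cut_test hD hm hmc (hPs ν) (a := ((ν:ℝ) + 1)⁻¹) (by positivity) (hPa ν)) hbm hsm).ennreal_ofReal
    · filter_upwards [ae_restrict_mem hD.measurableSet] with x hx
      have hB0x := hB0 x
      have hmx := hm0 x hx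
      rw [← ENNReal.ofReal_mul (by positivity), ← ENNReal.ofReal_add (by positivity) (by positivity)]
      refine ENNReal.ofReal_le_ofReal ?_
      refine (keyR (P ν) (hPs ν) x hx).trans ?_
      have h1 := hPb ν (m x)
      have h2 := hPd2 ν _ hmx
      have hM : 0 ≤ M := hmx.le.trans (hmM x hx)
      calc 2 * P ν (m x) ^ 2 * ‖s x‖ ^ 2 + 4 * n * (|deriv (P ν) (m x)| * M) ^ 2 * B x
          ≤ 2 * 1 * ‖s x‖ ^ 2 + 4 * n * (2 * C * (m x)⁻¹ * M) ^ 2 * B x := by gcongr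
        _ = _ := by field_simp
    · have hle : ∫⁻ x in D, ENNReal.ofReal (2 * ‖s x‖ ^ 2) ≠ ⊤ := by
        simp_rw [fun x => ENNReal.ofReal_mul (p := 2) (q := ‖s x‖ ^ 2) (by norm_num)]
        rw [lintegral_const_mul' _ _ (by simp)]
        exact ENNReal.mul_ne_top (by simp) hsq
      rw [lintegral_add_left' ((hsm.norm.pow_const 2).const_mul 2).ennreal_ofReal, lintegral_const_mul' _ _ ENNReal.ofReal_ne_top]
      exact ENNReal.add_ne_top.2 ⟨hle, ENNReal.mul_ne_top ENNReal.ofReal_ne_top step1⟩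
    · filter_upwards [ae_restrict_mem hD.measurableSet] with x hx
      refine tendsto_const_nhds.congr' ?_
      filter_upwards [hlarge (m x) (hm0 x hx)] with ν hν
      have h1 : deriv (P ν) (m x) = 0 := by rw [hPd, hd2 _ hν, mul_zero]
      have h2 : P ν (m x) = 1 := hp1 _ hν.le
      have h3 : ∀ j, wder (fun x => ((D.indicator (fun x => P ν (m x)) x : ℝ) : ℂ)) (ev j) x = 0 := by
        intro j; rw [cut_wder hD hm (hPs ν) hx, h1]; simp
      have h4 : ∀ j, wderBar (fun x => ((D.indicator (fun x => P ν (m x)) x : ℝ) : ℂ)) (ev j) x = 0 := by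
        intro j; rw [← norm_eq_zero, cut_wderBar_norm hD hm (hPs ν) hx, h3, norm_zero]
      simp [Rf, h3, h4, hx, h2]
  have hme : ∀ ν, AEMeasurable (fun x => ENNReal.ofReal (P ν (m x) ^ 2 * Qf ψ (fun j => b j x) x))
      (volume.restrict D) := by
    intro ν
    have a1 : AEMeasurable (fun x => P ν (m x)) (volume.restrict D) :=
      (hPs ν).continuous.measurable.comp_aemeasurable hmm
    have a2 : AEMeasurable (fun x => P ν (m x) ^ 2) (volume.restrict D) := a1.pow_const 2
    exact (a2.mul hQm).ennreal_ofReal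
  have hfa := lintegral_liminf_le' (u := (atTop : Filter ℕ)) (μ := volume.restrict D) hme
  calc _ = ∫⁻ x in D, liminf (fun ν => ENNReal.ofReal (P ν (m x) ^ 2 * Qf ψ (fun j => b j x) x)) atTop := by
        refine setLIntegral_congr_fun hD.measurableSet fun x hx => ?_
        refine liminf_of_ev ?_
        filter_upwards [hlarge (m x) (hm0 x hx)] with ν hν
        rw [show P ν (m x) = 1 from hp1 _ hν.le]; simp
    _ ≤ _ := hfa
    _ ≤ liminf (fun ν => ∫⁻ x in D, ENNReal.ofReal
        (Rf (fun x => ((D.indicator (fun x => P ν (m x)) x : ℝ) : ℂ)) s b x)) atTop :=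
      liminf_le_liminf (Eventually.of_forall hmain)
    _ = _ := hdom.liminf_eq

end cut2
end

noncomputable section
open MeasureTheory Set Filter
open scoped ENNReal ComplexOrder ContDiff Topology

section hilb
variable {H0 H1 : Type*} [NormedAddCommGroup H0] [InnerProductSpace ℂ H0] [CompleteSpace H0]
  [NormedAddCommGroup H1] [InnerProductSpace ℂ H1] [CompleteSpace H1]

theorem proj_exists {H : Type*} [NormedAddCommGroup H] [InnerProductSpace ℂ H] [CompleteSpace H] (A : Set H) (v : H) :
    ∃ y : H, (∀ a ∈ A, inner ℂ a y = 0) ∧ ∀ y', (∀ a ∈ A, inner ℂ a y' = 0) → inner ℂ y' y = inner ℂ y' v := by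
  have hmem : ∀ y : H, y ∈ (Submodule.span ℂ A)ᗮ ↔ ∀ a ∈ A, inner ℂ a y = 0 := by
    intro y
    rw [Submodule.mem_orthogonal]
    constructor
    · intro h a ha; exact h a (Submodule.subset_span ha)
    · intro h u hu
      induction hu using Submodule.span_induction with
      | mem u hu => exact h u hu
      | zero => simp
      | add a b _ _ ha hb => rw [inner_add_left, ha, hb, add_zero]
      | smul c a _ ha => rw [inner_smul_left, ha, mul_zero]
  refine ⟨(Submodule.span ℂ A)ᗮ.starProjection v, ?_, ?_⟩
  · exact (hmem _).1 (Submodule.starProjection_apply_mem _ v)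
  · intro y' hy'
    have h := Submodule.starProjection_inner_eq_zero (K := (Submodule.span ℂ A)ᗮ) v y' ((hmem y').2 hy')
    rw [inner_sub_left, sub_eq_zero] at h
    have h3 := congrArg (starRingEnd ℂ) h
    rw [inner_conj_symm, inner_conj_symm] at h3
    exact h3.symm

theorem hilb_exists (S : Set (H0 × H1)) (h : H0) {r : ℝ} (hr : 0 < r) :
    ∃ w : H0, ∃ b : H1, (∀ x ∈ S, inner ℂ x.1 w = inner ℂ x.2 b) ∧
      ∀ w' : H0, ∀ b' : H1, (∀ x ∈ S, inner ℂ x.1 w' = inner ℂ x.2 b') →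
        inner ℂ b' b + ((r ^ 2 : ℝ) : ℂ) * inner ℂ w' w = inner ℂ w' h := by
  obtain ⟨y, hy, hy'⟩ := proj_exists (H := WithLp 2 (H0 × H1))
    ((fun x : H0 × H1 => WithLp.toLp 2 (((r⁻¹ : ℝ) : ℂ) • x.1, -x.2)) '' S)
    (WithLp.toLp 2 (((r⁻¹ : ℝ) : ℂ) • h, 0))
  have hmem : ∀ (y1 : H0) (y2 : H1), (∀ a ∈ (fun x : H0 × H1 => WithLp.toLp 2 (((r⁻¹ : ℝ) : ℂ) • x.1, -x.2)) '' S,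
      inner ℂ a (WithLp.toLp 2 (y1, y2)) = 0) ↔ ∀ x ∈ S, ((r⁻¹ : ℝ) : ℂ) * inner ℂ x.1 y1 = inner ℂ x.2 y2 := by
    intro y1 y2
    rw [Set.forall_mem_image]
    refine forall₂_congr fun x hx => ?_
    rw [WithLp.prod_inner_apply, inner_smul_left, inner_neg_left, Complex.conj_ofReal, ← sub_eq_add_neg, sub_eq_zero]
  have hrc : (r : ℂ) ≠ 0 := by exact_mod_cast hr.ne'
  refine ⟨((r⁻¹ : ℝ) : ℂ) • y.fst, y.snd, ?_, ?_⟩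
  · intro x hx
    rw [inner_smul_right]; exact (hmem y.fst y.snd).1 hy x hx
  · intro w' b' H
    have h3 := hy' (WithLp.toLp 2 ((r : ℂ) • w', b')) ((hmem _ _).2 fun x hx => by
      rw [inner_smul_right, ← H x hx]
      push_cast; field_simp)
    rw [WithLp.prod_inner_apply, WithLp.prod_inner_apply, inner_smul_left, inner_smul_left, inner_smul_right,
      inner_zero_right, add_zero, Complex.conj_ofReal] at h3
    rw [inner_smul_right]
    change (r:ℂ) * inner ℂ w' y.fst + inner ℂ b' y.snd = _ at h3
    push_cast at h3 ⊢
    have e1 : (r:ℂ) * ((r:ℂ)⁻¹ * inner ℂ w' h) = inner ℂ w' h := by field_simp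
    rw [e1] at h3
    rw [← h3]; field_simp; ring

theorem hilb_main (S : Set (H0 × H1)) (h : H0) (hadd : ∀ x ∈ S, ∀ y ∈ S, x + y ∈ S)
    (hsm : ∀ c : ℂ, ∀ x ∈ S, c • x ∈ S) (h0 : (0 : H0 × H1) ∈ S)
    (horth : ∀ w : H0, (∀ x ∈ S, inner ℂ x.1 w = 0) → inner ℂ w h = 0) (bh : H1)
    (hbh : ∀ x ∈ S, inner ℂ x.1 h = inner ℂ x.2 bh) {κ : ℝ} (hκ : 0 < κ) :
    ∃ ε : ℝ, 0 < ε ∧ ∃ w : H0, ∃ b : H1, (∀ x ∈ S, inner ℂ x.1 w = inner ℂ x.2 b) ∧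
      (∀ w' : H0, ∀ b' : H1, (∀ x ∈ S, inner ℂ x.1 w' = inner ℂ x.2 b') →
        inner ℂ b' b + (ε : ℂ) * inner ℂ w' w = inner ℂ w' h) ∧
      ‖h - (ε : ℂ) • w‖ ≤ ‖h‖ ∧ ‖h‖ ^ 2 ≤ ‖inner ℂ bh b‖ + κ := by
  -- h in closure of P
  set P : Submodule ℂ H0 := 
    { carrier := Prod.fst '' S
      add_mem' := by
        rintro _ _ ⟨x, hx, rfl⟩ ⟨y, hy, rfl⟩; exact ⟨x + y, hadd x hx y hy, rfl⟩
      zero_mem' := ⟨0, h0, rfl⟩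
      smul_mem' := by rintro c _ ⟨x, hx, rfl⟩; exact ⟨c • x, hsm c x hx, rfl⟩ } with hP
  have hcl : h ∈ closure (P : Set H0) := by
    rw [← Submodule.topologicalClosure_coe, SetLike.mem_coe, ← Submodule.orthogonal_orthogonal_eq_closure,
      Submodule.mem_orthogonal]
    intro w hw
    rw [Submodule.mem_orthogonal] at hw
    exact horth w fun x hx => hw _ ⟨x, hx, rfl⟩
  set κ1 := κ / (2 * (‖h‖ + 1)) with hκ1
  have hκ1p : 0 < κ1 := by positivity
  obtain ⟨p, ⟨x, hx, rfl⟩, hp⟩ := Metric.mem_closure_iff.1 hcl κ1 hκ1p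
  set r := κ / (2 * (‖h‖ + 1) * (‖x.2‖ + 1)) with hr
  have hrp : 0 < r := by positivity
  obtain ⟨w, b, hG, hE⟩ := hilb_exists S h hrp
  have hself := hE w b hG
  have hself' : ‖b‖ ^ 2 + r ^ 2 * ‖w‖ ^ 2 = (inner ℂ w h : ℂ).re := by
    rw [← hself, inner_self_eq_norm_sq_to_K, inner_self_eq_norm_sq_to_K]
    simp only [Complex.coe_algebraMap, ← Complex.ofReal_pow, ← Complex.ofReal_mul, ← Complex.ofReal_add, Complex.ofReal_re]
  have hre : (inner ℂ w h : ℂ).re ≤ ‖w‖ * ‖h‖ := (Complex.re_le_norm _).trans (norm_inner_le_norm w h)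
  have hw : r ^ 2 * ‖w‖ ≤ ‖h‖ := by
    rcases eq_or_lt_of_le (norm_nonneg w) with h' | h'
    · rw [← h']; simp
    · have : r ^ 2 * ‖w‖ * ‖w‖ ≤ ‖h‖ * ‖w‖ := by nlinarith [sq_nonneg ‖b‖]
      exact le_of_mul_le_mul_right this h'
  have hb : r * ‖b‖ ≤ ‖h‖ := by
    have : (r * ‖b‖) ^ 2 ≤ ‖h‖ ^ 2 := by
      have h1 : ‖b‖ ^ 2 ≤ ‖w‖ * ‖h‖ := by nlinarith [sq_nonneg (r * ‖w‖)]
      calc (r * ‖b‖) ^ 2 = r ^ 2 * ‖b‖ ^ 2 := by ring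
        _ ≤ r ^ 2 * (‖w‖ * ‖h‖) := by gcongr
        _ = (r ^ 2 * ‖w‖) * ‖h‖ := by ring
        _ ≤ ‖h‖ * ‖h‖ := by gcongr
        _ = _ := by ring
    exact le_of_sq_le_sq this (norm_nonneg _)
  refine ⟨r ^ 2, by positivity, w, b, hG, ?_, ?_, ?_⟩
  · intro w' b' h; simpa using hE w' b' h
  · have : ‖h - ((r ^ 2 : ℝ) : ℂ) • w‖ ^ 2 ≤ ‖h‖ ^ 2 := by
      rw [@norm_sub_sq ℂ, inner_smul_right, norm_smul]
      have e1 : RCLike.re (((r ^ 2 : ℝ) : ℂ) * inner ℂ h w) = r ^ 2 * (inner ℂ w h : ℂ).re := by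
        rw [← inner_conj_symm h w]
        simp only [RCLike.re_to_complex, Complex.re_ofReal_mul, Complex.conj_re]
      rw [e1, ← hself', Complex.norm_real, Real.norm_of_nonneg (by positivity)]
      nlinarith [mul_nonneg (sq_nonneg r) (sq_nonneg ‖b‖), mul_nonneg (sq_nonneg (r^2)) (sq_nonneg ‖w‖)]
    exact le_of_sq_le_sq this (norm_nonneg _)
  · have e1 := hE h bh hbh
    have e2 : ‖h‖ ^ 2 ≤ ‖inner ℂ bh b‖ + r ^ 2 * ‖inner ℂ h w‖ := by
      have : ‖h‖ ^ 2 = ‖(inner ℂ h h : ℂ)‖ := by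
        rw [inner_self_eq_norm_sq_to_K]; norm_cast; simp
      rw [this, ← e1]
      refine (norm_add_le _ _).trans ?_
      rw [norm_mul, Complex.norm_real, Real.norm_of_nonneg (by positivity)]
    have e3 : r ^ 2 * ‖inner ℂ h w‖ ≤ κ := by
      have h1 : inner ℂ h w = inner ℂ (h - x.1) w + inner ℂ x.2 b := by
        rw [inner_sub_left, ← hG x hx]; ring
      have h2 : ‖inner ℂ (h - x.1) w‖ ≤ κ1 * ‖w‖ := by
        refine (norm_inner_le_norm _ _).trans ?_
        rw [dist_eq_norm] at hp
        gcongr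
      have h3 : ‖inner ℂ x.2 b‖ ≤ ‖x.2‖ * ‖b‖ := norm_inner_le_norm _ _
      calc r ^ 2 * ‖inner ℂ h w‖ ≤ r ^ 2 * (κ1 * ‖w‖ + ‖x.2‖ * ‖b‖) := by
            rw [h1]; gcongr; exact (norm_add_le _ _).trans (add_le_add h2 h3)
        _ = κ1 * (r ^ 2 * ‖w‖) + r * ‖x.2‖ * (r * ‖b‖) := by ring
        _ ≤ κ1 * ‖h‖ + r * ‖x.2‖ * ‖h‖ := by gcongr
        _ ≤ κ1 * (‖h‖ + 1) + r * ((‖x.2‖ + 1) * (‖h‖ + 1)) := by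
            have := norm_nonneg x.2
            have := norm_nonneg h
            nlinarith [mul_nonneg hrp.le (norm_nonneg x.2), mul_nonneg hrp.le (norm_nonneg h)]
        _ = κ := by rw [hκ1, hr]; field_simp; ring
    linarith

end hilb
end

noncomputable section
open MeasureTheory Set Filter
open scoped ENNReal ComplexOrder ContDiff Topology

section solve
variable {n : ℕ} {D : Set (Fin n → ℂ)} {ψ : (Fin n → ℂ) → ℝ}

/-- the Hilbert space L²(D) -/
abbrev LD (D : Set (Fin n → ℂ)) := Lp ℂ 2 (volume.restrict D)

theorem inner_eq {x w : LD D} {f g : (Fin n → ℂ) → ℂ} (hx : x =ᵐ[volume.restrict D] f)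
    (hw : w =ᵐ[volume.restrict D] g) :
    inner ℂ x w = ∫ y in D, g y * (starRingEnd ℂ) (f y) := by
  rw [L2.inner_def]
  refine integral_congr_ae ?_
  filter_upwards [hx, hw] with y hy hy'
  rw [hy, hy', RCLike.inner_apply]

theorem inner_test {x w : LD D} {θ g : (Fin n → ℂ) → ℂ} (hθ : IsTest D θ)
    (hx : x =ᵐ[volume.restrict D] fun y => (starRingEnd ℂ) (θ y))
    (hw : w =ᵐ[volume.restrict D] g) :
    inner ℂ x w = ∫ y, g y * θ y := by
  rw [inner_eq hx hw]
  simp only [Complex.conj_conj]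
  refine setIntegral_eq_integral_of_forall_compl_eq_zero fun y hy => ?_
  rw [hθ.eq_zero hy, mul_zero]

theorem Tb_add {θ θ' : (Fin n → ℂ) → ℂ} (h : IsTest D θ) (h' : IsTest D θ') (j : Fin n) (x : Fin n → ℂ) :
    Tb ψ j (fun x => θ x + θ' x) x = Tb ψ j θ x + Tb ψ j θ' x := by
  simp only [Tb]; rw [wderBar_add _ (h.diff x) (h'.diff x)]; ring

theorem Tb_smul {θ : (Fin n → ℂ) → ℂ} (c : ℂ) (h : IsTest D θ) (j : Fin n) (x : Fin n → ℂ) :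
    Tb ψ j (fun x => c * θ x) x = c * Tb ψ j θ x := by
  simp only [Tb]; rw [wderBar_const_mul _ c (h.diff x)]; ring

theorem Tb_zero (j : Fin n) (x : Fin n → ℂ) : Tb ψ j (fun _ => 0) x = 0 := by
  have h := Tb_smul (ψ := ψ) (0:ℂ) (IsTest.zero (D := (univ : Set (Fin n → ℂ)))) j x
  simpa using h

/-- graph of the adjoint on test forms -/
def Sset (D : Set (Fin n → ℂ)) (ψ : (Fin n → ℂ) → ℝ) : Set (LD D × PiLp 2 (fun _ : Fin n => LD D)) :=
  {x | ∃ θ : Fin n → (Fin n → ℂ) → ℂ, (∀ j, IsTest D (θ j)) ∧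
    (x.1 =ᵐ[volume.restrict D] fun y => (starRingEnd ℂ) (∑ j, Tb ψ j (θ j) y)) ∧
    ∀ j, x.2 j =ᵐ[volume.restrict D] fun y => (starRingEnd ℂ) (θ j y)}

theorem Sset_add {x y} (hx : x ∈ Sset D ψ) (hy : y ∈ Sset D ψ) : x + y ∈ Sset D ψ := by
  obtain ⟨θ, h1, h2, h3⟩ := hx
  obtain ⟨θ', h1', h2', h3'⟩ := hy
  refine ⟨fun j x => θ j x + θ' j x, fun j => (h1 j).add (h1' j), ?_, fun j => ?_⟩
  · refine (Lp.coeFn_add x.1 y.1).trans ?_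
    filter_upwards [h2, h2'] with z hz hz'
    rw [Pi.add_apply, hz, hz', ← map_add, ← Finset.sum_add_distrib]
    simp only [Tb_add (h1 _) (h1' _)]
  · refine (Lp.coeFn_add (x.2 j) (y.2 j)).trans ?_
    filter_upwards [h3 j, h3' j] with z hz hz'
    rw [Pi.add_apply, hz, hz', ← map_add]

theorem Sset_smul (c : ℂ) {x} (hx : x ∈ Sset D ψ) : c • x ∈ Sset D ψ := by
  obtain ⟨θ, h1, h2, h3⟩ := hx
  refine ⟨fun j x => (starRingEnd ℂ) c * θ j x, fun j => (h1 j).const_mul _, ?_, fun j => ?_⟩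
  · refine (Lp.coeFn_smul c x.1).trans ?_
    filter_upwards [h2] with z hz
    simp only [Tb_smul _ (h1 _)]
    rw [Pi.smul_apply, hz, ← Finset.mul_sum, map_mul, Complex.conj_conj, smul_eq_mul]
  · refine (Lp.coeFn_smul c (x.2 j)).trans ?_
    filter_upwards [h3 j] with z hz
    rw [Pi.smul_apply, hz, map_mul, Complex.conj_conj, smul_eq_mul]

theorem Sset_zero : (0 : LD D × PiLp 2 (fun _ : Fin n => LD D)) ∈ Sset D ψ := by
  refine ⟨fun j x => 0, fun j => IsTest.zero, ?_, fun j => ?_⟩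
  · refine (Lp.coeFn_zero ℂ 2 _).trans ?_
    filter_upwards with z
    simp [Tb_zero]
  · refine (Lp.coeFn_zero ℂ 2 _).trans ?_
    filter_upwards with z
    simp

theorem Sset_inner (hD : IsOpen D) (hψ : ContDiffOn ℝ ∞ ψ D) {x : LD D × PiLp 2 (fun _ : Fin n => LD D)}
    {θ : Fin n → (Fin n → ℂ) → ℂ}
    (h1 : ∀ j, IsTest D (θ j))
    (h2 : x.1 =ᵐ[volume.restrict D] fun y => (starRingEnd ℂ) (∑ j, Tb ψ j (θ j) y))
    {w : LD D} {g : (Fin n → ℂ) → ℂ} (hw : w =ᵐ[volume.restrict D] g) :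
    inner ℂ x.1 w = ∑ j, ∫ y, g y * Tb ψ j (θ j) y := by
  have hg : MemLp g 2 (volume.restrict D) := (memLp_congr_ae hw).1 (Lp.memLp w)
  rw [inner_test (IsTest.sum Finset.univ fun j => (h1 j).Tb hD hψ j) h2 hw]
  simp only [Finset.mul_sum]
  exact integral_finsetSum _ fun j _ => test_mul_integrable hg ((h1 j).Tb hD hψ j)

theorem Sset_G (hD : IsOpen D) (hψ : ContDiffOn ℝ ∞ ψ D) {w : LD D} {b : PiLp 2 (fun _ : Fin n => LD D)}
    {g : (Fin n → ℂ) → ℂ} {c : Fin n → (Fin n → ℂ) → ℂ} (hw : w =ᵐ[volume.restrict D] g)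
    (hb : ∀ j, b j =ᵐ[volume.restrict D] c j) :
    (∀ x ∈ Sset D ψ, inner ℂ x.1 w = inner ℂ x.2 b) ↔
      ∀ θ, IsTest D θ → ∀ j, ∫ x, g x * Tb ψ j θ x = ∫ x, c j x * θ x := by
  constructor
  · intro H θ hθ j
    classical
    set Θ : Fin n → (Fin n → ℂ) → ℂ := fun k => if k = j then θ else fun _ => 0
    have hΘ : ∀ k, IsTest D (Θ k) := by
      intro k
      by_cases hk : k = j
      · simp [Θ, hk]; exact hθ
      · simp [Θ, hk]; exact IsTest.zero
    have hp : IsTest D (fun y => (starRingEnd ℂ) (∑ j, Tb ψ j (Θ j) y)) :=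
      (IsTest.sum Finset.univ fun j => (hΘ j).Tb hD hψ j).conj
    set x : LD D × PiLp 2 (fun _ : Fin n => LD D) := 
      ((hp.memLp.restrict D).toLp _, WithLp.toLp 2 (fun k => (((hΘ k).conj.memLp).restrict D).toLp _))
    have h2 : x.1 =ᵐ[volume.restrict D] fun y => (starRingEnd ℂ) (∑ j, Tb ψ j (Θ j) y) :=
      MemLp.coeFn_toLp (hp.memLp.restrict D)
    have h3 : ∀ k, x.2 k =ᵐ[volume.restrict D] fun y => (starRingEnd ℂ) (Θ k y) :=
      fun k => MemLp.coeFn_toLp (((hΘ k).conj.memLp).restrict D)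
    have h := H x ⟨Θ, hΘ, h2, h3⟩
    rw [Sset_inner hD hψ hΘ h2 hw, PiLp.inner_apply] at h
    simp only [inner_test (hΘ _) (h3 _) (hb _)] at h
    rw [Finset.sum_eq_single j, Finset.sum_eq_single j] at h
    · simpa [Θ] using h
    · intro k _ hk; simp [Θ, hk]
    · simp
    · intro k _ hk; simp [Θ, hk, Tb_zero]
    · simp
  · rintro H x ⟨θ, h1, h2, h3⟩
    rw [Sset_inner hD hψ h1 h2 hw, PiLp.inner_apply]
    simp only [inner_test (h1 _) (h3 _) (hb _)]
    exact Finset.sum_congr rfl fun j _ => H _ (h1 j) j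

theorem Zb_W1 (hD : IsOpen D) (hψ : ContDiffOn ℝ ∞ ψ D) {F : (Fin n → ℂ) → ℂ} (hF : IsTest D F) :
    ∀ θ, IsTest D θ → ∀ j, ∫ x, F x * Tb ψ j θ x = ∫ x, Zb ψ j F x * θ x := by
  intro θ hθ j
  have hi1 := (hF.mul (hθ.Tb hD hψ j)).integrable
  have hi2 := ((hF.Zb hD hψ j).mul hθ).integrable
  rw [← sub_eq_zero, ← integral_sub hi1 hi2]
  have h0 := integral_wderBar_test (hF.mul hθ).neg (ev j)
  rw [← h0]
  congr 1
  ext x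
  rw [wderBar_neg, wderBar_mul _ (hF.diff x) (hθ.diff x)]
  simp only [Tb, Zb]
  ring

theorem dbar_solve (hD : IsOpen D) (hψ : ContDiffOn ℝ ∞ ψ D) {m : (Fin n → ℂ) → ℝ} {M : ℝ}
    (hm : ContDiffOn ℝ ∞ m D) (hm0 : ∀ x ∈ D, 0 < m x) (hmM : ∀ x ∈ D, m x ≤ M)
    (hmd : ∀ x ∈ D, ∀ j, ‖wder (fun y => (m y : ℂ)) (ev j) x‖ ≤ M)
    (hmc : ∀ ε > 0, IsCompact {x ∈ D | ε ≤ m x})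
    (hQ : ∀ x ∈ D, ∀ ξ : Fin n → ℂ, ∑ j, ‖ξ j‖ ^ 2 ≤ m x ^ 4 * Qf ψ ξ x)
    {h : (Fin n → ℂ) → ℂ} {bh : Fin n → (Fin n → ℂ) → ℂ}
    (hh : MemLp h 2 (volume.restrict D)) (hbh : ∀ j, MemLp (bh j) 2 (volume.restrict D))
    (hW : ∀ θ, IsTest D θ → ∀ j, ∫ x, h x * Tb ψ j θ x = ∫ x, bh j x * θ x)
    (horth : ∀ w, MemLp w 2 (volume.restrict D) → (∀ θ, IsTest D θ → ∀ j, ∫ x, w x * Tb ψ j θ x = 0) →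
      ∫ x in D, h x * (starRingEnd ℂ) (w x) = 0) {κ : ℝ} (hκ : 0 < κ) :
    ∃ b : Fin n → (Fin n → ℂ) → ℂ, (∀ j, MemLp (b j) 2 (volume.restrict D)) ∧
      ∫⁻ x in D, ENNReal.ofReal (Qf ψ (fun j => b j x) x) ≤ ∫⁻ x in D, ENNReal.ofReal (‖h x‖ ^ 2) ∧
      ∫ x in D, ‖h x‖ ^ 2 ≤ ‖∑ j, ∫ x in D, b j x * (starRingEnd ℂ) (bh j x)‖ + κ := by
  set hL : LD D := hh.toLp h
  have ehL : hL =ᵐ[volume.restrict D] h := hh.coeFn_toLp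
  set bL : PiLp 2 (fun _ : Fin n => LD D) := WithLp.toLp 2 (fun j => (hbh j).toLp (bh j))
  have ebL : ∀ j, bL j =ᵐ[volume.restrict D] bh j := fun j => (hbh j).coeFn_toLp
  obtain ⟨ε, hε, w, b, hG, hE, hn, hf⟩ := hilb_main (Sset D ψ) hL (fun x hx y hy => Sset_add hx hy)
    (fun c x hx => Sset_smul c hx) Sset_zero
    (by
      intro w hw
      have h2 := horth w (Lp.memLp w) (by
        have := (Sset_G hD hψ (w := w) (b := 0) (g := w) (c := fun _ _ => 0) (EventuallyEq.refl _ _)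
          (fun j => Lp.coeFn_zero ℂ 2 _)).1 (fun x hx => by rw [hw x hx, inner_zero_right])
        intro θ hθ j
        rw [this θ hθ j]; simp)
      rw [inner_eq (EventuallyEq.refl _ _) ehL]
      exact h2)
    bL ((Sset_G hD hψ ehL ebL).2 hW) hκ
  have hbL2 : ∀ j, MemLp (b j) 2 (volume.restrict D) := fun j => Lp.memLp (b j)
  refine ⟨fun j => b j, hbL2, ?_, ?_⟩
  · set s : LD D := hL - (ε : ℂ) • w with hs
    have h1 := bk_final (s := s) (b := fun j => b j) (w := w) hD hψ hm hm0 hmM hmd hmc hQ hbL2 (Lp.memLp s)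
      ((Sset_G hD hψ (EventuallyEq.refl _ _) (fun j => EventuallyEq.refl _ _)).1 hG) (by
        intro θ hθ
        have hF := hθ.conj
        set w' : LD D := (hF.memLp.restrict D).toLp _
        set b' : PiLp 2 (fun _ : Fin n => LD D) := WithLp.toLp 2 (fun j => ((hF.Zb hD hψ j).memLp.restrict D).toLp _)
        have ew : w' =ᵐ[volume.restrict D] fun x => (starRingEnd ℂ) (θ x) :=
          MemLp.coeFn_toLp (hF.memLp.restrict D)
        have eb : ∀ j, b' j =ᵐ[volume.restrict D] fun x => Zb ψ j (fun x => (starRingEnd ℂ) (θ x)) x :=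
          fun j => MemLp.coeFn_toLp ((hF.Zb hD hψ j).memLp.restrict D)
        have h3 := hE w' b' ((Sset_G hD hψ ew eb).2 (Zb_W1 hD hψ hF))
        have h4 : inner ℂ b' b = inner ℂ w' s := by
          rw [hs, inner_sub_right, inner_smul_right, ← h3]; ring
        rw [inner_test hθ ew (EventuallyEq.refl _ _), PiLp.inner_apply] at h4
        rw [← h4]
        refine Finset.sum_congr rfl fun j _ => ?_
        rw [inner_test (θ := fun x => (starRingEnd ℂ) (Zb ψ j (fun x => (starRingEnd ℂ) (θ x)) x))
          (hF.Zb hD hψ j).conj ((eb j).trans (by filter_upwards with x; rw [Complex.conj_conj])) (EventuallyEq.refl _ _)]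
        congr 1
        ext x
        congr 1
        by_cases hx : x ∈ D
        · simp only [Zb]
          rw [wderBar_conj _ (hθ.diff x), map_add, map_mul, map_mul,
            conj_wderBar_ofReal _ (diffAt_of_contDiffOn hD hx hψ)]
          simp [map_ofNat]
        · rw [(hF.Zb hD hψ j).eq_zero hx, hθ.eq_zero hx, (hθ.wder (ev j)).eq_zero hx]; simp)
    refine h1.trans ?_
    have h5 : ∀ f : LD D, ∫⁻ x in D, ENNReal.ofReal (‖f x‖ ^ 2) = ENNReal.ofReal (‖f‖ ^ 2) := by
      intro f
      have hi := (memLp_two_iff_integrable_sq_norm (Lp.memLp f).1).1 (Lp.memLp f)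
      rw [← ofReal_integral_eq_lintegral_ofReal hi (Eventually.of_forall fun x => sq_nonneg _)]
      congr 1
      have h6 : (inner ℂ f f : ℂ) = ((‖f‖ ^ 2 : ℝ) : ℂ) := by
        rw [inner_self_eq_norm_sq_to_K]; simp
      rw [inner_eq (EventuallyEq.refl _ _) (EventuallyEq.refl _ _)] at h6
      simp only [Complex.mul_conj, Complex.normSq_eq_norm_sq] at h6
      rw [integral_complex_ofReal] at h6
      exact_mod_cast h6
    rw [h5 s]
    have h7 : ∫⁻ x in D, ENNReal.ofReal (‖h x‖ ^ 2) = ENNReal.ofReal (‖hL‖ ^ 2) := by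
      rw [← h5 hL]
      refine lintegral_congr_ae ?_
      filter_upwards [ehL] with x hx
      rw [hx]
    rw [h7]
    gcongr
  · have h6 : (inner ℂ hL hL : ℂ) = ((‖hL‖ ^ 2 : ℝ) : ℂ) := by
      rw [inner_self_eq_norm_sq_to_K]; simp
    rw [inner_eq ehL ehL] at h6
    simp only [Complex.mul_conj, Complex.normSq_eq_norm_sq] at h6
    rw [integral_complex_ofReal] at h6
    have h7 : ∫ x in D, ‖h x‖ ^ 2 = ‖hL‖ ^ 2 := by exact_mod_cast h6
    rw [h7]
    refine hf.trans (le_of_eq ?_)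
    rw [PiLp.inner_apply]
    simp only [inner_eq (ebL _) (EventuallyEq.refl _ _)]

end solve
end

noncomputable section
open MeasureTheory Set Filter
open scoped ENNReal ComplexOrder ContDiff Topology

section core
variable {n : ℕ} {D : Set (Fin n → ℂ)} {ψ W η : (Fin n → ℂ) → ℝ}

/-- half weight -/
def hx (W : (Fin n → ℂ) → ℝ) (x : Fin n → ℂ) : ℂ := ((Real.exp (-(W x) / 2) : ℝ) : ℂ)

theorem hx_ne (x : Fin n → ℂ) : hx W x ≠ 0 := by
  unfold hx; exact_mod_cast (Real.exp_pos _).ne'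

theorem hx_contDiffOn (hW : ContDiffOn ℝ ∞ W D) : ContDiffOn ℝ ∞ (hx W) D :=
  contDiffOn_ofReal (Real.contDiff_exp.comp_contDiffOn (hW.neg.div_const 2))

theorem norm_hx_sq (x : Fin n → ℂ) : ‖hx W x‖ ^ 2 = Real.exp (-(W x)) := by
  unfold hx
  rw [Complex.norm_real, Real.norm_of_nonneg (Real.exp_pos _).le, ← Real.exp_nat_mul]
  congr 1; push_cast; ring

theorem wderBar_hx (hD : IsOpen D) (hW : ContDiffOn ℝ ∞ W D) {x} (hx' : x ∈ D) (v : Fin n → ℂ) :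
    wderBar (hx W) v x = -(1/2) * wderBar (fun q => (W q : ℂ)) v x * hx W x := by
  have hd := diffAt_of_contDiffOn hD hx' hW
  have h1 := wder_comp_real (P := fun t => Real.exp (-t/2)) (m := W) (x := x) (by fun_prop) hd v
  have h2 : deriv (fun t => Real.exp (-t/2)) (W x) = -(1/2) * Real.exp (-(W x)/2) := by
    have : HasDerivAt (fun t : ℝ => -t/2) (-1/2) (W x) := ((hasDerivAt_id (W x)).neg).div_const 2
    rw [this.exp.deriv]; ring
  have hd' : DifferentiableAt ℝ (fun x => Real.exp (-(W x)/2)) x :=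
    DifferentiableAt.comp x (f := W) (g := fun t : ℝ => Real.exp (-t/2)) (by fun_prop) hd
  rw [h2] at h1
  have h3 := congrArg (starRingEnd ℂ) h1
  rw [conj_wder_ofReal v hd', map_mul, conj_wder_ofReal v hd, Complex.conj_ofReal] at h3
  change wderBar (fun x => ((Real.exp (-(W x)/2) : ℝ) : ℂ)) v x = _
  rw [h3, hx]
  push_cast; ring

theorem smooth_W1 (hD : IsOpen D) {F : (Fin n → ℂ) → ℂ} (hF : ContDiffOn ℝ ∞ F D)
    (hψ : ContDiffOn ℝ ∞ ψ D) :
    ∀ θ, IsTest D θ → ∀ j, ∫ x, F x * Tb ψ j θ x = ∫ x, Zb ψ j F x * θ x := by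
  intro θ hθ j
  have hZ : ContDiffOn ℝ ∞ (fun x => Zb ψ j F x) D := by
    unfold Zb
    exact (contDiffOn_wderBar hD hF _).add ((contDiffOn_const.mul
      (contDiffOn_wderBar hD (contDiffOn_ofReal hψ) _)).mul hF)
  have hi1 := (IsTest.mul_left hD hF (hθ.Tb hD hψ j)).integrable
  have hi2 := (IsTest.mul_left hD hZ hθ).integrable
  have hp := (IsTest.mul_left hD hF hθ).neg
  rw [← sub_eq_zero, ← integral_sub hi1 hi2]
  have h0 := integral_wderBar_test hp (ev j)
  rw [← h0]
  congr 1
  ext x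
  by_cases hx : x ∈ D
  · rw [wderBar_neg, wderBar_mul _ (diffAt_of_contDiffOn hD hx hF) (hθ.diff x)]
    simp only [Tb, Zb]
    ring
  · rw [(hp.wderBar (ev j)).eq_zero hx, (hθ.Tb hD hψ j).eq_zero hx, hθ.eq_zero hx]; ring

theorem Zb_mul_hx (hD : IsOpen D) {G : (Fin n → ℂ) → ℂ} (hG : ContDiffOn ℝ ∞ G D)
    (hψ : ContDiffOn ℝ ∞ ψ D) {x} (h : x ∈ D) (j : Fin n) :
    Zb ψ j (fun x => G x * hx ψ x) x = wderBar G (ev j) x * hx ψ x := by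
  simp only [Zb]
  rw [wderBar_mul _ (diffAt_of_contDiffOn hD h hG) (diffAt_of_contDiffOn hD h (hx_contDiffOn hψ)),
    wderBar_hx hD hψ h]
  ring

theorem holo_contDiffOn (hD : IsOpen D) {g : (Fin n → ℂ) → ℂ} (hg : DifferentiableOn ℂ g D) :
    ContDiffOn ℝ ∞ g D := by
  intro x hx
  obtain ⟨ε0, hε0, hb⟩ := Metric.isOpen_iff.1 hD x hx
  set ε := ε0 / 3 with hεd
  have hε : 0 < ε := by positivity
  have hsub : Metric.closedBall x (2 * ε) ⊆ D :=
    (Metric.closedBall_subset_ball (by linarith)).trans hb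
  set F := (Metric.closedBall x (2 * ε)).indicator g with hF
  have hFi : Integrable F volume := by
    rw [hF, integrable_indicator_iff Metric.isClosed_closedBall.measurableSet]
    exact (hg.continuousOn.mono hsub).integrableOn_compact (isCompact_closedBall _ _)
  have hc := mo_contDiff hε hFi.locallyIntegrable
  refine (hc.contDiffAt.congr_of_eventuallyEq ?_).contDiffWithinAt
  filter_upwards [Metric.ball_mem_nhds x hε] with y hy
  have hsy : Metric.closedBall y ε ⊆ Metric.closedBall x (2 * ε) := by
    apply Metric.closedBall_subset_closedBall'
    have : dist y x < ε := hy
    linarith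
  rw [← mo_mean_value hε hD hg (hsy.trans hsub)]
  simp only [mo]
  congr 1; ext w
  by_cases hw : w ∈ Metric.closedBall x (2 * ε)
  · rw [hF, indicator_of_mem hw]
  · rw [rhoC_eq_zero hε, mul_zero, mul_zero]
    intro h
    apply hw
    apply hsy
    rw [mem_ball_zero_iff] at h
    rw [Metric.mem_closedBall, dist_comm, dist_eq_norm]
    exact h.le

theorem holo_W1 (hD : IsOpen D) {g : (Fin n → ℂ) → ℂ} (hg : DifferentiableOn ℂ g D)
    (hψ : ContDiffOn ℝ ∞ ψ D) :
    ∀ θ, IsTest D θ → ∀ j, ∫ x, (g x * hx ψ x) * Tb ψ j θ x = 0 := by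
  intro θ hθ j
  have hG := holo_contDiffOn hD hg
  rw [smooth_W1 hD (hG.mul (hx_contDiffOn hψ)) hψ θ hθ j]
  rw [← integral_zero (Fin n → ℂ) ℂ]
  congr 1; ext x
  by_cases h : x ∈ D
  · rw [Zb_mul_hx hD hG hψ h, wderBar_holo _ ((hg x h).differentiableAt (hD.mem_nhds h))]; simp
  · rw [hθ.eq_zero h, mul_zero]

theorem locL2_mul (hD : IsOpen D) {a v : (Fin n → ℂ) → ℂ} (ha : ContinuousOn a D)
    (hv : MemLp v 2 (volume.restrict D)) {K : Set (Fin n → ℂ)} (hK : IsCompact K) (hKD : K ⊆ D) :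
    MemLp (fun x => v x * a x) 2 (volume.restrict K) := by
  obtain ⟨C, hC⟩ := hK.exists_bound_of_continuousOn (ha.mono hKD)
  have hvK : MemLp v 2 (volume.restrict K) := hv.mono_measure (Measure.restrict_mono hKD le_rfl)
  refine MemLp.of_le_mul (c := C) hvK (hvK.1.mul ((ha.mono hKD).aestronglyMeasurable hK.measurableSet)) ?_
  filter_upwards [ae_restrict_mem hK.measurableSet] with x hx
  rw [norm_mul, mul_comm]
  gcongr; exact hC x hx

theorem weyl_Tb (hD : IsOpen D) (hψ : ContDiffOn ℝ ∞ ψ D) {v : (Fin n → ℂ) → ℂ}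
    (hv : MemLp v 2 (volume.restrict D))
    (hw : ∀ θ, IsTest D θ → ∀ j, ∫ x, v x * Tb ψ j θ x = 0) :
    ∃ g, DifferentiableOn ℂ g D ∧ v =ᵐ[volume.restrict D] fun x => g x * hx ψ x := by
  have hinv : ContDiffOn ℝ ∞ (fun x => hx (fun x => - ψ x) x) D := hx_contDiffOn hψ.neg
  have hi : ∀ x, hx (fun x => - ψ x) x * hx ψ x = 1 := by
    intro x; unfold hx; rw [← Complex.ofReal_mul, ← Real.exp_add]
    norm_cast; rw [← Real.exp_zero]; congr 1; ring
  obtain ⟨g, hg, he⟩ := weyl hD (F := fun x => v x * hx (fun x => - ψ x) x)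
    (fun K hK hKD => locL2_mul hD hinv.continuousOn hv hK hKD) (by
      intro θ hθ j
      have h1 := hw _ (IsTest.mul_left hD hinv hθ) j
      rw [← neg_eq_zero, ← integral_neg, ← h1]
      congr 1; ext x
      by_cases h : x ∈ D
      · simp only [Tb]
        rw [wderBar_mul _ (diffAt_of_contDiffOn hD h hinv) (hθ.diff x)]
        have := wderBar_hx hD hψ.neg h (ev j)
        have e2 : wderBar (fun q => ((- ψ q : ℝ) : ℂ)) (ev j) x = - wderBar (fun q => (ψ q : ℂ)) (ev j) x := by
          rw [← wderBar_neg]; simp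
        rw [show wderBar (fun x => hx (fun x => - ψ x) x) (ev j) x = _ from this, e2]
        ring
      · have h2 := (hθ.wderBar (ev j)).eq_zero h
        have h3 := ((IsTest.mul_left hD hinv hθ).Tb hD hψ j).eq_zero h
        rw [h2, h3]; ring)
  refine ⟨g, hg, ?_⟩
  filter_upwards [he] with x hx'
  rw [← hx', mul_assoc, hi, mul_one]

end core
end

noncomputable section
open MeasureTheory Set Filter
open scoped ENNReal ComplexOrder ContDiff Topology

section core2
variable {n : ℕ} {D : Set (Fin n → ℂ)} {W η : (Fin n → ℂ) → ℝ}

theorem memLp_bdd (hD : IsOpen D) {a v : (Fin n → ℂ) → ℂ} {K : ℝ} (ha : ContinuousOn a D)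
    (hK : ∀ x ∈ D, ‖a x‖ ≤ K)
    (hv : MemLp v 2 (volume.restrict D)) : MemLp (fun x => a x * v x) 2 (volume.restrict D) := by
  refine MemLp.of_le_mul (c := K) hv ((ha.aestronglyMeasurable hD.measurableSet).mul hv.1) ?_
  filter_upwards [ae_restrict_mem hD.measurableSet] with x hx
  rw [norm_mul]
  gcongr; exact hK x hx

theorem hx_add (x : Fin n → ℂ) : hx (fun y => W y + η y) x = hx W x * hx η x := by
  unfold hx; rw [← Complex.ofReal_mul, ← Real.exp_add]; congr 2; ring

theorem hx_inv (x : Fin n → ℂ) : hx (fun y => - η y) x * hx η x = 1 := by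
  unfold hx; rw [← Complex.ofReal_mul, ← Real.exp_add]
  norm_cast; rw [← Real.exp_zero]; congr 1; ring

theorem hx_conj (x : Fin n → ℂ) : (starRingEnd ℂ) (hx η x) = hx η x := by
  unfold hx; exact Complex.conj_ofReal _

theorem hx_bdd {M : ℝ} {x : Fin n → ℂ} (h : |η x| ≤ M) : ‖hx η x‖ ≤ Real.exp (M / 2) := by
  unfold hx
  rw [Complex.norm_real, Real.norm_of_nonneg (Real.exp_pos _).le]
  apply Real.exp_le_exp.2
  have := (abs_le.1 h).1
  linarith

theorem ptwise_amgm {F0 h : ℂ} {b a e : Fin n → ℂ} {C δ Q : ℝ} (hδ : 0 < δ) (hC : 0 ≤ C)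
    (hB : 0 ≤ Q - (1 + δ) * ‖∑ j, b j * e j‖ ^ 2)
    (hS : ‖∑ j, (starRingEnd ℂ) (b j) * a j‖ ^ 2 ≤
      C * (δ / (1 + δ)) * (Q - (1 + δ) * ‖∑ j, b j * e j‖ ^ 2)) :
    ‖∑ j, b j * (starRingEnd ℂ) (F0 * a j + h * (starRingEnd ℂ) (e j))‖ ≤
      1/2 * (δ / (1 + δ) * (C * ‖F0‖ ^ 2) + 1 / (1 + δ) * ‖h‖ ^ 2 + Q) := by
  have e1 : ∑ j, b j * (starRingEnd ℂ) (F0 * a j + h * (starRingEnd ℂ) (e j)) =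
      (starRingEnd ℂ) (F0 * ∑ j, (starRingEnd ℂ) (b j) * a j) + (starRingEnd ℂ) h * ∑ j, b j * e j := by
    simp only [map_mul, map_sum, map_add, Complex.conj_conj, Finset.mul_sum, ← Finset.sum_add_distrib]
    refine Finset.sum_congr rfl fun j _ => ?_
    ring
  rw [e1]
  refine (norm_add_le _ _).trans ?_
  rw [RCLike.norm_conj, norm_mul, norm_mul, RCLike.norm_conj]
  set S := ‖∑ j, (starRingEnd ℂ) (b j) * a j‖
  set T := ‖∑ j, b j * e j‖
  have hS0 : 0 ≤ S := norm_nonneg _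
  have hT0 : 0 ≤ T := norm_nonneg _
  have hc : 0 ≤ C * (δ / (1 + δ)) := by positivity
  set c := δ / (1 + δ)
  set B := Q - (1 + δ) * T ^ 2 with hBd
  have h1 : ‖F0‖ * S ≤ 1/2 * (c * (C * ‖F0‖ ^ 2) + B) := by
    have hS' : S ≤ Real.sqrt (C * c) * Real.sqrt B := by
      rw [← Real.sqrt_mul hc]; exact Real.le_sqrt_of_sq_le hS
    have := mul_le_mul_of_nonneg_left hS' (norm_nonneg F0)
    have h3 := Real.sq_sqrt hc
    have h4 := Real.sq_sqrt hB
    nlinarith [sq_nonneg (‖F0‖ * Real.sqrt (C * c) - Real.sqrt B)]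
  have h2 : ‖h‖ * T ≤ 1/2 * (1 / (1 + δ) * ‖h‖ ^ 2 + (1 + δ) * T ^ 2) := by
    have h3 : 0 < 1 + δ := by linarith
    have : 0 ≤ 1 / (1 + δ) * (‖h‖ - (1 + δ) * T) ^ 2 := by positivity
    have h4 : 1 / (1 + δ) * (‖h‖ - (1 + δ) * T) ^ 2 = 1 / (1 + δ) * ‖h‖ ^ 2 - 2 * (‖h‖ * T) + (1 + δ) * T ^ 2 := by
      field_simp; ring
    rw [h4] at this
    linarith
  calc _ ≤ _ := add_le_add h1 h2
    _ = _ := by rw [hBd]; ring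

/-- integrated version -/
theorem int_amgm (hD : IsOpen D) {ψ : (Fin n → ℂ) → ℝ} (hψ : ContDiffOn ℝ ∞ ψ D)
    {F0 h : (Fin n → ℂ) → ℂ} {b a e bh : Fin n → (Fin n → ℂ) → ℂ} {C : (Fin n → ℂ) → ℝ}
    {δ κ M : ℝ} (hδ : 0 < δ) (hC : ∀ x ∈ D, 0 ≤ C x) (hCM : ∀ x ∈ D, C x ≤ M) (hCc : ContinuousOn C D)
    (hB : ∀ x ∈ D, ∀ ξ : Fin n → ℂ, 0 ≤ Qf ψ ξ x - (1 + δ) * ‖∑ j, ξ j * e j x‖ ^ 2)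
    (hS : ∀ x ∈ D, ∀ ξ : Fin n → ℂ, ‖∑ j, (starRingEnd ℂ) (ξ j) * a j x‖ ^ 2 ≤
      C x * (δ / (1 + δ)) * (Qf ψ ξ x - (1 + δ) * ‖∑ j, ξ j * e j x‖ ^ 2))
    (hF0 : MemLp F0 2 (volume.restrict D)) (hh : MemLp h 2 (volume.restrict D))
    (hb : ∀ j, MemLp (b j) 2 (volume.restrict D)) (hbh : ∀ j, MemLp (bh j) 2 (volume.restrict D))
    (hbe : ∀ x ∈ D, ∀ j, bh j x = F0 x * a j x + h x * (starRingEnd ℂ) (e j x))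
    (hQ : ∫⁻ x in D, ENNReal.ofReal (Qf ψ (fun j => b j x) x) ≤ ∫⁻ x in D, ENNReal.ofReal (‖h x‖ ^ 2))
    (hX : ∫ x in D, ‖h x‖ ^ 2 ≤ ‖∑ j, ∫ x in D, b j x * (starRingEnd ℂ) (bh j x)‖ + κ) :
    δ / (1 + δ) * ∫ x in D, ‖h x‖ ^ 2 ≤ δ / (1 + δ) * (∫ x in D, C x * ‖F0 x‖ ^ 2) + 2 * κ := by
  have hQ0 : ∀ x ∈ D, ∀ ξ, 0 ≤ Qf ψ ξ x := fun x hx ξ => by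
    have := hB x hx ξ; have : 0 ≤ (1 + δ) * ‖∑ j, ξ j * e j x‖ ^ 2 := by positivity
    linarith
  have ih : Integrable (fun x => ‖h x‖ ^ 2) (volume.restrict D) :=
    (memLp_two_iff_integrable_sq_norm hh.1).1 hh
  have iF : Integrable (fun x => ‖F0 x‖ ^ 2) (volume.restrict D) :=
    (memLp_two_iff_integrable_sq_norm hF0.1).1 hF0
  have iC : Integrable (fun x => C x * ‖F0 x‖ ^ 2) (volume.restrict D) := by
    refine Integrable.bdd_mul (c := M) iF (hCc.aestronglyMeasurable hD.measurableSet) ?_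
    filter_upwards [ae_restrict_mem hD.measurableSet] with x hx
    rw [Real.norm_of_nonneg (hC x hx)]; exact hCM x hx
  have hlh := ofReal_integral_eq_lintegral_ofReal ih (Eventually.of_forall fun x => by positivity)
  have hQnn : 0 ≤ᵐ[volume.restrict D] fun x => Qf ψ (fun j => b j x) x := by
    filter_upwards [ae_restrict_mem hD.measurableSet] with x hx
    exact hQ0 x hx _
  have iQ : Integrable (fun x => Qf ψ (fun j => b j x) x) (volume.restrict D) := by
    refine ⟨(aemeas_Qf hD hψ fun j => (hb j).1.aemeasurable).aestronglyMeasurable, ?_⟩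
    rw [hasFiniteIntegral_iff_ofReal hQnn]
    refine hQ.trans_lt ?_
    rw [← hlh]; exact ENNReal.ofReal_lt_top
  have hQ' : ∫ x in D, Qf ψ (fun j => b j x) x ≤ ∫ x in D, ‖h x‖ ^ 2 := by
    rw [← hlh, ← ofReal_integral_eq_lintegral_ofReal iQ hQnn] at hQ
    exact (ENNReal.ofReal_le_ofReal_iff (integral_nonneg fun x => by positivity)).1 hQ
  have ib : ∀ j, Integrable (fun x => b j x * (starRingEnd ℂ) (bh j x)) (volume.restrict D) :=
    fun j => (hb j).integrable_mul (hbh j).star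
  rw [← integral_finsetSum _ fun j _ => ib j] at hX
  have hR : Integrable (fun x => 1/2 * (δ / (1 + δ) * (C x * ‖F0 x‖ ^ 2) + 1 / (1 + δ) * ‖h x‖ ^ 2 + Qf ψ (fun j => b j x) x)) (volume.restrict D) :=
    (((iC.const_mul _).add (ih.const_mul _)).add iQ).const_mul _
  have h1 : ‖∫ x in D, ∑ j, b j x * (starRingEnd ℂ) (bh j x)‖ ≤
      ∫ x in D, 1/2 * (δ / (1 + δ) * (C x * ‖F0 x‖ ^ 2) + 1 / (1 + δ) * ‖h x‖ ^ 2 + Qf ψ (fun j => b j x) x) := by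
    refine norm_integral_le_of_norm_le hR ?_
    filter_upwards [ae_restrict_mem hD.measurableSet] with x hx
    simp only [hbe x hx]
    exact ptwise_amgm (b := fun j => b j x) (a := fun j => a j x) (e := fun j => e j x) hδ (hC x hx) (hB x hx _) (hS x hx _)
  have i2 : Integrable (fun x => δ / (1 + δ) * (C x * ‖F0 x‖ ^ 2)) (volume.restrict D) := iC.const_mul _
  have i3 : Integrable (fun x => 1 / (1 + δ) * ‖h x‖ ^ 2) (volume.restrict D) := ih.const_mul _
  have i4 : Integrable (fun x => δ / (1 + δ) * (C x * ‖F0 x‖ ^ 2) + 1 / (1 + δ) * ‖h x‖ ^ 2) (volume.restrict D) := i2.add i3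
  rw [integral_const_mul, integral_add i4 iQ, integral_add i2 i3, integral_const_mul, integral_const_mul] at h1
  set X := ∫ x in D, ‖h x‖ ^ 2
  have e : 1 / (1 + δ) * X = X - δ / (1 + δ) * X := by
    field_simp; ring
  rw [e] at h1
  linarith

end core2
end

noncomputable section
open MeasureTheory Set Filter
open scoped ENNReal ComplexOrder ContDiff Topology

section core3
variable {n : ℕ} {D : Set (Fin n → ℂ)} {W η : (Fin n → ℂ) → ℝ}

/-- projection onto holomorphic functions in a weighted space -/
theorem proj_holo (hD : IsOpen D) {q : (Fin n → ℂ) → ℝ} (hq : ContDiffOn ℝ ∞ q D)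
    {a : (Fin n → ℂ) → ℂ} (ha : MemLp a 2 (volume.restrict D)) :
    ∃ g, DifferentiableOn ℂ g D ∧ MemLp (fun x => g x * hx q x) 2 (volume.restrict D) ∧
      ∀ k, DifferentiableOn ℂ k D → MemLp (fun x => k x * hx q x) 2 (volume.restrict D) →
        ∫ x in D, (a x - g x * hx q x) * (starRingEnd ℂ) (k x * hx q x) = 0 := by
  obtain ⟨y, hy1, hy2⟩ := proj_exists (H := LD D)
    {x | ∃ θ, IsTest D θ ∧ ∃ j, x =ᵐ[volume.restrict D] fun z => (starRingEnd ℂ) (Tb q j θ z)} (ha.toLp a)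
  obtain ⟨g, hg, he⟩ := weyl_Tb hD hq (Lp.memLp y) (by
    intro θ hθ j
    have hT := hθ.Tb hD hq j
    have hm : MemLp (fun z => (starRingEnd ℂ) (Tb q j θ z)) 2 (volume.restrict D) :=
      (hT.conj.memLp).mono_measure Measure.restrict_le_self
    have h1 := hy1 (hm.toLp _) ⟨θ, hθ, j, MemLp.coeFn_toLp hm⟩
    rw [inner_test hT (MemLp.coeFn_toLp hm) (EventuallyEq.refl _ _)] at h1
    exact h1)
  have hgm : MemLp (fun x => g x * hx q x) 2 (volume.restrict D) := (memLp_congr_ae he).1 (Lp.memLp y)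
  refine ⟨g, hg, hgm, ?_⟩
  intro k hk hkm
  have h2 := hy2 (hkm.toLp _) (by
    rintro x ⟨θ, hθ, j, hx⟩
    rw [inner_test (hθ.Tb hD hq j) hx (MemLp.coeFn_toLp hkm)]
    exact holo_W1 hD hk hq θ hθ j)
  rw [inner_eq (MemLp.coeFn_toLp hkm) he, inner_eq (MemLp.coeFn_toLp hkm) (MemLp.coeFn_toLp ha)] at h2
  have i1 : Integrable (fun x => a x * (starRingEnd ℂ) (k x * hx q x)) (volume.restrict D) :=
    ha.integrable_mul hkm.star
  have i2 : Integrable (fun x => g x * hx q x * (starRingEnd ℂ) (k x * hx q x)) (volume.restrict D) :=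
    hgm.integrable_mul hkm.star
  simp only [sub_mul]
  rw [integral_sub i1 i2, h2, sub_self]

theorem core_thm (hD : IsOpen D) (hW : ContDiffOn ℝ ∞ W D) (hη : ContDiffOn ℝ ∞ η D) {M δ : ℝ} (hδ : 0 < δ)
    (hηM : ∀ x ∈ D, |η x| ≤ M) (hηd : ∀ x ∈ D, ∀ j, ‖wder (fun y => (η y : ℂ)) (ev j) x‖ ≤ M)
    {m : (Fin n → ℂ) → ℝ}
    (hm : ContDiffOn ℝ ∞ m D) (hm0 : ∀ x ∈ D, 0 < m x) (hmM : ∀ x ∈ D, m x ≤ M)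
    (hmd : ∀ x ∈ D, ∀ j, ‖wder (fun y => (m y : ℂ)) (ev j) x‖ ≤ M)
    (hmc : ∀ ε > 0, IsCompact {x ∈ D | ε ≤ m x})
    (hB : ∀ x ∈ D, ∀ ξ : Fin n → ℂ, ∑ j, ‖ξ j‖ ^ 2 ≤ m x ^ 4 *
      (Qf (fun y => W y + 2 * η y) ξ x - (1 + δ) * ‖∑ j, ξ j * wder (fun y => (η y : ℂ)) (ev j) x‖ ^ 2))
    {A : (Fin n → ℂ) → ℂ} {C : (Fin n → ℂ) → ℝ} (hA : ContDiffOn ℝ ∞ A D) (hAM : ∀ x ∈ D, ‖A x‖ ≤ M)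
    (hAd : ∀ x ∈ D, ∀ j, ‖wderBar A (ev j) x‖ ≤ M)
    (hC : ∀ x ∈ D, 0 ≤ C x) (hCM : ∀ x ∈ D, C x ≤ M) (hCc : ContinuousOn C D)
    (hS : ∀ x ∈ D, ∀ ξ : Fin n → ℂ, ‖∑ j, (starRingEnd ℂ) (ξ j) * wderBar A (ev j) x‖ ^ 2 ≤
      C x * (δ / (1 + δ)) * (Qf (fun y => W y + 2 * η y) ξ x
        - (1 + δ) * ‖∑ j, ξ j * wder (fun y => (η y : ℂ)) (ev j) x‖ ^ 2))
    {f : (Fin n → ℂ) → ℂ} (hf : DifferentiableOn ℂ f D)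
    (hfm : MemLp (fun x => f x * hx W x) 2 (volume.restrict D)) :
    ∃ g, DifferentiableOn ℂ g D ∧ MemLp (fun x => g x * hx W x) 2 (volume.restrict D) ∧
      ∫ x in D, ‖(A x * f x - g x) * hx W x‖ ^ 2 ≤ ∫ x in D, C x * ‖f x * hx W x‖ ^ 2 := by
  set ψ : (Fin n → ℂ) → ℝ := fun y => W y + 2 * η y with hψd
  have hψ : ContDiffOn ℝ ∞ ψ D := hW.add (contDiffOn_const.mul hη)
  set q : (Fin n → ℂ) → ℝ := fun y => W y + η y with hqd
  have hq : ContDiffOn ℝ ∞ q D := hW.add hη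
  have hxψ : ∀ x, hx ψ x = hx W x * hx η x * hx η x := fun x => by
    rw [hψd]; unfold hx; rw [← Complex.ofReal_mul, ← Complex.ofReal_mul, ← Real.exp_add, ← Real.exp_add]
    congr 2; ring
  have hxq : ∀ x, hx q x = hx W x * hx η x := fun x => hx_add x
  have cη := (hx_contDiffOn hη).continuousOn
  have cη' := (hx_contDiffOn hη.neg).continuousOn
  have bη : ∀ x ∈ D, ‖hx η x‖ ≤ Real.exp (M / 2) := fun x hx => hx_bdd (hηM x hx)
  have bη' : ∀ x ∈ D, ‖hx (fun y => - η y) x‖ ≤ Real.exp (M / 2) := fun x hx =>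
    hx_bdd (by rw [abs_neg]; exact hηM x hx)
  have hAf : MemLp (fun x => A x * (f x * hx W x)) 2 (volume.restrict D) :=
    memLp_bdd hD hA.continuousOn hAM hfm
  obtain ⟨g, hg, hgm, hgo⟩ := proj_holo hD hq (memLp_bdd hD cη bη hAf)
  have hgW : MemLp (fun x => g x * hx W x) 2 (volume.restrict D) := by
    have := memLp_bdd hD cη' bη' hgm
    refine (memLp_congr_ae (Eventually.of_forall fun x => ?_)).1 this
    simp only [hxq]
    linear_combination (g x * hx W x) * hx_inv (η := η) x
  refine ⟨g, hg, hgW, ?_⟩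
  have hfs := holo_contDiffOn hD hf
  have hgs := holo_contDiffOn hD hg
  set h : (Fin n → ℂ) → ℂ := fun x => (A x * f x - g x) * hx W x with hhd
  have hh : MemLp h 2 (volume.restrict D) := by
    refine (memLp_congr_ae (Eventually.of_forall fun x => ?_)).1 (hAf.sub hgW)
    simp only [hhd, Pi.sub_apply]; ring
  set e : Fin n → (Fin n → ℂ) → ℂ := fun j x => wder (fun y => (η y : ℂ)) (ev j) x with hed
  set a : Fin n → (Fin n → ℂ) → ℂ := fun j x => wderBar A (ev j) x with had
  set bh : Fin n → (Fin n → ℂ) → ℂ := fun j x => a j x * (f x * hx W x) + (starRingEnd ℂ) (e j x) * h x with hbhd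
  have ca : ∀ j, ContinuousOn (a j) D := fun j => (contDiffOn_wderBar hD hA _).continuousOn
  have ce : ∀ j, ContinuousOn (e j) D := fun j =>
    (contDiffOn_wder hD (contDiffOn_ofReal hη) _).continuousOn
  have hbh : ∀ j, MemLp (bh j) 2 (volume.restrict D) := fun j =>
    (memLp_bdd hD (ca j) (fun x hx => hAd x hx j) hfm).add
      (memLp_bdd hD (Complex.continuous_conj.comp_continuousOn (ce j))
        (fun x hx => by rw [RCLike.norm_conj]; exact hηd x hx j) hh)
  -- U
  set U : (Fin n → ℂ) → ℂ := fun x => (A x * f x - g x) * hx (fun y => -(2 * η y)) x with hUd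
  have hη2 : ContDiffOn ℝ ∞ (fun y => -(2 * η y)) D := (contDiffOn_const.mul hη).neg
  have hAfg : ContDiffOn ℝ ∞ (fun x => A x * f x - g x) D := (hA.mul hfs).sub hgs
  have hU : ContDiffOn ℝ ∞ U D := hAfg.mul (hx_contDiffOn hη2)
  have hUx : ∀ x, hx (fun y => -(2 * η y)) x * hx ψ x = hx W x := fun x => by
    rw [hψd]; unfold hx; rw [← Complex.ofReal_mul, ← Real.exp_add]
    congr 2; ring
  have hUh : (fun x => U x * hx ψ x) = h := by
    ext x; simp only [hUd, hhd]; rw [mul_assoc, hUx]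
  have hW1 : ∀ θ, IsTest D θ → ∀ j, ∫ x, h x * Tb ψ j θ x = ∫ x, bh j x * θ x := by
    intro θ hθ j
    have hsm : ContDiffOn ℝ ∞ h D := by rw [← hUh]; exact hU.mul (hx_contDiffOn hψ)
    have := smooth_W1 hD hsm hψ θ hθ j
    rw [this]
    congr 1; ext x
    by_cases hxD : x ∈ D
    · congr 1
      rw [← hUh, Zb_mul_hx hD hU hψ hxD]
      have dA := diffAt_of_contDiffOn hD hxD hA
      have df := diffAt_of_contDiffOn hD hxD hfs
      have dg := diffAt_of_contDiffOn hD hxD hgs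
      have d2 := diffAt_of_contDiffOn hD hxD (hx_contDiffOn hη2)
      have dη := diffAt_of_contDiffOn hD hxD hη
      have dηc := diffAt_of_contDiffOn hD hxD (contDiffOn_ofReal hη)
      simp only [hUd]
      have e1 : wderBar (fun q => ((-(2 * η q) : ℝ) : ℂ)) (ev j) x = -2 * (starRingEnd ℂ) (e j x) := by
        rw [hed]; simp only; rw [conj_wder_ofReal _ dη, ← wderBar_const_mul _ _ dηc]
        congr 1; ext y; push_cast; ring
      rw [wderBar_mul _ (diffAt_of_contDiffOn hD hxD hAfg) d2, wderBar_hx hD hη2 hxD, e1,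
        wderBar_sub _ (diffAt_of_contDiffOn hD hxD (hA.mul hfs)) dg, wderBar_mul _ dA df,
        wderBar_holo _ ((hf x hxD).differentiableAt (hD.mem_nhds hxD)),
        wderBar_holo _ ((hg x hxD).differentiableAt (hD.mem_nhds hxD))]
      simp only [hbhd, hhd, had]
      rw [← hUx x]; ring
    · rw [hθ.eq_zero hxD, mul_zero, mul_zero]
  have horth : ∀ w, MemLp w 2 (volume.restrict D) → (∀ θ, IsTest D θ → ∀ j, ∫ x, w x * Tb ψ j θ x = 0) →
      ∫ x in D, h x * (starRingEnd ℂ) (w x) = 0 := by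
    intro w hw hwT
    obtain ⟨k, hk, hke⟩ := weyl_Tb hD hψ hw hwT
    have hkm : MemLp (fun x => k x * hx q x) 2 (volume.restrict D) := by
      refine (memLp_congr_ae ?_).1 (memLp_bdd hD cη' bη' hw)
      filter_upwards [hke] with x hx'
      rw [hx', hxq, hxψ]
      linear_combination (k x * hx W x * hx η x) * hx_inv (η := η) x
    rw [← hgo k hk hkm]
    refine integral_congr_ae ?_
    filter_upwards [hke] with x hx'
    rw [hx', hxq, hxψ]
    simp only [map_mul, hx_conj, hhd]
    ring
  have hQ : ∀ x ∈ D, ∀ ξ : Fin n → ℂ, ∑ j, ‖ξ j‖ ^ 2 ≤ m x ^ 4 * Qf ψ ξ x := by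
    intro x hx ξ
    refine (hB x hx ξ).trans ?_
    have := hm0 x hx
    gcongr
    have : 0 ≤ (1 + δ) * ‖∑ j, ξ j * wder (fun y => (η y : ℂ)) (ev j) x‖ ^ 2 := by positivity
    linarith
  have hB0 : ∀ x ∈ D, ∀ ξ : Fin n → ℂ, 0 ≤ Qf ψ ξ x - (1 + δ) * ‖∑ j, ξ j * e j x‖ ^ 2 := by
    intro x hx ξ
    have h1 : 0 ≤ ∑ j, ‖ξ j‖ ^ 2 := Finset.sum_nonneg fun j _ => by positivity
    have h2 := h1.trans (hB x hx ξ)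
    have := hm0 x hx
    exact nonneg_of_mul_nonneg_right h2 (by positivity)
  have key : ∀ κ > 0, δ / (1 + δ) * ∫ x in D, ‖h x‖ ^ 2 ≤
      δ / (1 + δ) * (∫ x in D, C x * ‖f x * hx W x‖ ^ 2) + 2 * κ := by
    intro κ hκ
    obtain ⟨b, hb, hb1, hb2⟩ := dbar_solve hD hψ hm hm0 hmM hmd hmc hQ hh hbh hW1 horth hκ
    refine int_amgm hD hψ hδ hC hCM hCc hB0 hS hfm hh hb hbh ?_ hb1 hb2
    intro x hx j
    simp only [hbhd]; ring
  have hc : 0 < δ / (1 + δ) := by positivity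
  refine le_of_mul_le_mul_left ?_ hc
  refine le_of_forall_pos_le_add fun κ hκ => ?_
  have := key (κ / 2) (by positivity)
  linarith

end core3
end

noncomputable section
open MeasureTheory Set Filter
open scoped ENNReal ComplexOrder ContDiff Topology

section geo
variable {n m : ℕ} {D : Set (Fin n → ℂ)}

theorem Qf_eq (hD : IsOpen D) {ψ : (Fin n → ℂ) → ℝ} (hψ : ContDiffOn ℝ ∞ ψ D) {x} (hx : x ∈ D)
    (ξ : Fin n → ℂ) :
    Qf ψ ξ x = (wder (fun y => wderBar (fun q => (ψ q : ℂ)) ξ y) ξ x).re := by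
  unfold Qf Lv
  congr 1
  have hc := contDiffOn_ofReal hψ
  have h1 : ∀ j, ∑ k, wder (fun y => wderBar (fun q => (ψ q : ℂ)) (ev k) y) (ev j) x * ξ j * (starRingEnd ℂ) (ξ k)
      = ξ j * wder (fun y => wderBar (fun q => (ψ q : ℂ)) ξ y) (ev j) x := by
    intro j
    rw [wder_wderBar_comm hD hx hc]
    conv_rhs => rw [sum_ev ξ, wderBar_sum_dir]
    rw [Finset.mul_sum]
    refine Finset.sum_congr rfl fun k _ => ?_
    rw [wder_wderBar_comm hD hx hc]
    simp only [← sum_ev ξ]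
    ring
  simp only [h1]
  conv_rhs => rw [show wder (fun y => wderBar (fun q => (ψ q : ℂ)) ξ y) ξ x =
    wder (fun y => wderBar (fun q => (ψ q : ℂ)) ξ y) (∑ j, ξ j • ev j) x by rw [← sum_ev], wder_sum_dir]

theorem Levi_add {E : Type*} [NormedAddCommGroup E] [NormedSpace ℂ E] {D : Set E} (hD : IsOpen D)
    {f g : E → ℝ} (hf : ContDiffOn ℝ ∞ f D)
    (hg : ContDiffOn ℝ ∞ g D) (a b : E) {x} (hx : x ∈ D) :
    wder (fun y => wderBar (fun q => ((f q + g q : ℝ) : ℂ)) b y) a x =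
      wder (fun y => wderBar (fun q => (f q : ℂ)) b y) a x +
      wder (fun y => wderBar (fun q => (g q : ℂ)) b y) a x := by
  have cf := contDiffOn_ofReal hf
  have cg := contDiffOn_ofReal hg
  rw [← wder_add _ (diffAt_of_contDiffOn hD hx (contDiffOn_wderBar hD cf b))
    (diffAt_of_contDiffOn hD hx (contDiffOn_wderBar hD cg b))]
  apply wder_congr
  filter_upwards [hD.mem_nhds hx] with y hy
  rw [← wderBar_add _ (diffAt_of_contDiffOn hD hy cf) (diffAt_of_contDiffOn hD hy cg)]
  simp

theorem Levi_const_mul {E : Type*} [NormedAddCommGroup E] [NormedSpace ℂ E] {D : Set E} (hD : IsOpen D)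
    {f : E → ℝ} (hf : ContDiffOn ℝ ∞ f D) (c : ℝ) (a b : E) {x} (hx : x ∈ D) :
    wder (fun y => wderBar (fun q => ((c * f q : ℝ) : ℂ)) b y) a x =
      c * wder (fun y => wderBar (fun q => (f q : ℂ)) b y) a x := by
  have cf := contDiffOn_ofReal hf
  rw [← wder_const_mul _ _ (diffAt_of_contDiffOn hD hx (contDiffOn_wderBar hD cf b))]
  apply wder_congr
  filter_upwards [hD.mem_nhds hx] with y hy
  rw [← wderBar_const_mul _ _ (diffAt_of_contDiffOn hD hy cf)]
  simp

theorem Levi_comp (hD : IsOpen D) {u : (Fin n → ℂ) → ℝ} (hu : ContDiffOn ℝ ∞ u D) {P : ℝ → ℝ}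
    {T : Set ℝ} (hT : IsOpen T) (hP : ContDiffOn ℝ ∞ P T) (huT : ∀ x ∈ D, u x ∈ T)
    (ξ : Fin n → ℂ) {x} (hx : x ∈ D) :
    wder (fun y => wderBar (fun q => ((P (u q) : ℝ) : ℂ)) ξ y) ξ x =
      ((deriv P (u x) : ℝ) : ℂ) * wder (fun y => wderBar (fun q => (u q : ℂ)) ξ y) ξ x +
      ((deriv (deriv P) (u x) : ℝ) : ℂ) * (Complex.normSq (wder (fun q => (u q : ℂ)) ξ x) : ℂ) := by
  have cu := contDiffOn_ofReal hu
  have hP' : ContDiffOn ℝ ∞ (deriv P) T := hP.deriv_of_isOpen hT (m := ∞) (by simp)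
  have dP : ∀ t ∈ T, DifferentiableAt ℝ P t := fun t ht => (hP.contDiffAt (hT.mem_nhds ht)).differentiableAt (by simp)
  have dP' : ∀ t ∈ T, DifferentiableAt ℝ (deriv P) t := fun t ht =>
    (hP'.contDiffAt (hT.mem_nhds ht)).differentiableAt (by simp)
  have h1 : (fun y => wderBar (fun q => ((P (u q) : ℝ) : ℂ)) ξ y) =ᶠ[𝓝 x]
      fun y => ((deriv P (u y) : ℝ) : ℂ) * wderBar (fun q => (u q : ℂ)) ξ y := by
    filter_upwards [hD.mem_nhds hx] with y hy
    have du := diffAt_of_contDiffOn hD hy hu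
    have := congrArg (starRingEnd ℂ) (wder_comp_real (P := P) (m := u) (x := y) (dP _ (huT y hy)) du ξ)
    rw [map_mul, Complex.conj_ofReal, conj_wder_ofReal ξ du, conj_wder_ofReal (f := fun y => P (u y)) ξ
      (DifferentiableAt.comp y (dP _ (huT y hy)) du)] at this
    exact this
  have du := diffAt_of_contDiffOn hD hx hu
  have hc : DifferentiableAt ℝ (fun y => ((deriv P (u y) : ℝ) : ℂ)) x :=
    Complex.ofRealCLM.differentiableAt.comp x (DifferentiableAt.comp x (dP' _ (huT x hx)) du)
  rw [wder_congr ξ h1, wder_mul _ hc (diffAt_of_contDiffOn hD hx (contDiffOn_wderBar hD cu ξ)),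
    wder_comp_real (P := deriv P) (m := u) (dP' _ (huT x hx)) du ξ, ← conj_wder_ofReal ξ du,
    Complex.normSq_eq_conj_mul_self]
  ring

/-- squared Euclidean norm -/
def nsq (z : Fin n → ℂ) : ℝ := ∑ j, Complex.normSq (z j)

theorem nsq_contDiff : ContDiff ℝ ∞ (nsq (n := n)) :=
  ContDiff.sum fun j _ => contDiff_normSq.comp (contDiff_apply ℝ ℂ j)

theorem wder_coord (j : Fin n) (ξ x : Fin n → ℂ) : wder (fun z : Fin n → ℂ => z j) ξ x = ξ j := by
  have h : fderiv ℝ (fun z : Fin n → ℂ => z j) x = (ContinuousLinearMap.proj j : (Fin n → ℂ) →L[ℝ] ℂ) :=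
    (ContinuousLinearMap.proj j : (Fin n → ℂ) →L[ℝ] ℂ).hasFDerivAt.fderiv
  simp only [wder, h]
  simp
  linear_combination (-1/2) * ξ j * Complex.I_sq

theorem wderBar_nsq (ξ x : Fin n → ℂ) :
    wderBar (fun z : Fin n → ℂ => (nsq z : ℂ)) ξ x = ∑ j, (starRingEnd ℂ) (ξ j) * x j := by
  have e : (fun z : Fin n → ℂ => (nsq z : ℂ)) = fun z => ∑ j, z j * (starRingEnd ℂ) (z j) := by
    ext z; simp [nsq, Complex.mul_conj]
  have hd : ∀ j, DifferentiableAt ℝ (fun z : Fin n → ℂ => z j) x := fun j =>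
    differentiableAt_apply j x
  have hd' : ∀ j, DifferentiableAt ℝ (fun z : Fin n → ℂ => (starRingEnd ℂ) (z j)) x := fun j =>
    (Complex.conjCLE : ℂ →L[ℝ] ℂ).differentiableAt.comp x (hd j)
  have h1 : wderBar (fun z : Fin n → ℂ => (nsq z : ℂ)) ξ x =
      ∑ j, wderBar (fun z : Fin n → ℂ => z j * (starRingEnd ℂ) (z j)) ξ x := by
    rw [e]; simp only [wderBar]
    rw [fderiv_fun_sum fun j _ => (hd j).fun_mul (hd' j)]
    simp [Finset.mul_sum, Finset.sum_add_distrib, mul_add]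
  rw [h1]
  refine Finset.sum_congr rfl fun j _ => ?_
  rw [wderBar_mul _ (hd j) (hd' j), wderBar_conj _ (hd j), wder_coord,
    wderBar_holo _ (differentiableAt_apply j x)]
  ring

theorem Levi_nsq (ξ x : Fin n → ℂ) :
    wder (fun y => wderBar (fun z : Fin n → ℂ => (nsq z : ℂ)) ξ y) ξ x = ((nsq ξ : ℝ) : ℂ) := by
  have e : (fun y => wderBar (fun z : Fin n → ℂ => (nsq z : ℂ)) ξ y) =
      fun y => ∑ j, (starRingEnd ℂ) (ξ j) * y j := by ext y; exact wderBar_nsq ξ y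
  rw [e]
  have hd : ∀ j, DifferentiableAt ℝ (fun z : Fin n → ℂ => z j) x := fun j =>
    differentiableAt_apply j x
  have h1 : wder (fun y : Fin n → ℂ => ∑ j, (starRingEnd ℂ) (ξ j) * y j) ξ x =
      ∑ j, wder (fun y : Fin n → ℂ => (starRingEnd ℂ) (ξ j) * y j) ξ x := by
    simp only [wder]
    rw [fderiv_fun_sum fun j _ => (hd j).const_mul _]
    simp [Finset.mul_sum, Finset.sum_sub_distrib, mul_sub]
  rw [h1]
  simp only [nsq, Complex.ofReal_sum]
  refine Finset.sum_congr rfl fun j _ => ?_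
  rw [wder_const_mul _ _ (hd j), wder_coord, Complex.normSq_eq_conj_mul_self]

/-- restriction to slices -/
theorem wder_slice {F : (Fin m → ℂ) × (Fin n → ℂ) → ℂ} {t : Fin m → ℂ} {x : Fin n → ℂ}
    (hF : DifferentiableAt ℝ F (t, x)) (v : Fin n → ℂ) :
    wder (fun z => F (t, z)) v x = wder F ((0 : Fin m → ℂ), v) (t, x) := by
  have h : HasFDerivAt (fun z => F (t, z)) ((fderiv ℝ F (t, x)).comp
      (ContinuousLinearMap.inr ℝ (Fin m → ℂ) (Fin n → ℂ))) x :=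
    hF.hasFDerivAt.comp x (hasFDerivAt_prodMk_right t x)
  simp only [wder, h.fderiv]
  simp

theorem wderBar_slice {F : (Fin m → ℂ) × (Fin n → ℂ) → ℂ} {t : Fin m → ℂ} {x : Fin n → ℂ}
    (hF : DifferentiableAt ℝ F (t, x)) (v : Fin n → ℂ) :
    wderBar (fun z => F (t, z)) v x = wderBar F ((0 : Fin m → ℂ), v) (t, x) := by
  have h : HasFDerivAt (fun z => F (t, z)) ((fderiv ℝ F (t, x)).comp
      (ContinuousLinearMap.inr ℝ (Fin m → ℂ) (Fin n → ℂ))) x :=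
    hF.hasFDerivAt.comp x (hasFDerivAt_prodMk_right t x)
  simp only [wderBar, h.fderiv]
  simp

theorem Levi_slice {U : Set (Fin m → ℂ)} (hU : IsOpen U) (hD : IsOpen D)
    {φ : (Fin m → ℂ) × (Fin n → ℂ) → ℝ} (hφ : ContDiffOn ℝ ∞ φ (U ×ˢ D)) {t x} (ht : t ∈ U) (hx : x ∈ D)
    (a b : Fin n → ℂ) :
    wder (fun y => wderBar (fun z => (φ (t, z) : ℂ)) b y) a x =
    wder (fun y => wderBar (fun q => (φ q : ℂ)) ((0 : Fin m → ℂ), b) y) ((0 : Fin m → ℂ), a) (t, x) := by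
  have hS := hU.prod hD
  have cφ := contDiffOn_ofReal hφ
  rw [← wder_slice (diffAt_of_contDiffOn hS (mk_mem_prod ht hx) (contDiffOn_wderBar hS cφ _))]
  apply wder_congr
  filter_upwards [hD.mem_nhds hx] with y hy
  exact wderBar_slice (F := fun q => (φ q : ℂ)) (diffAt_of_contDiffOn hS (mk_mem_prod ht hy) cφ) b

theorem quad_ineq {C R : ℝ} {b : ℂ} (h : ∀ c : ℂ, 0 ≤ C * Complex.normSq c + 2 * (c * b).re + R) :
    0 ≤ C ∧ 0 ≤ R ∧ ‖b‖ ^ 2 ≤ C * R := by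
  have hR : 0 ≤ R := by simpa using h 0
  have hs : ∀ s : ℝ, 0 ≤ C * s ^ 2 * ‖b‖ ^ 2 - 2 * s * ‖b‖ ^ 2 + R := by
    intro s
    have := h (-(s : ℂ) * (starRingEnd ℂ) b)
    have e : (-(s : ℂ) * (starRingEnd ℂ) b * b).re = - s * ‖b‖ ^ 2 := by
      rw [mul_assoc, ← Complex.normSq_eq_conj_mul_self, Complex.normSq_eq_norm_sq,
        ← Complex.ofReal_neg, ← Complex.ofReal_mul, Complex.ofReal_re]
    rw [e, Complex.normSq_mul, Complex.normSq_conj, Complex.normSq_neg, Complex.normSq_ofReal,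
      Complex.normSq_eq_norm_sq] at this
    linarith
  have hs1 : ∀ s : ℝ, 0 ≤ C * (s ^ 2) + 2 * (s * b.re) + R := by
    intro s
    have := h (s : ℂ)
    rw [Complex.normSq_ofReal] at this
    have e : ((s : ℂ) * b).re = s * b.re := by simp
    rw [e] at this; linarith
  have hC : 0 ≤ C := by
    by_contra hc
    push Not at hc
    have h2 : ∀ s : ℝ, 0 ≤ C * s ^ 2 + R := fun s => by
      have h3 := hs1 s; have h4 := hs1 (-s)
      nlinarith
    have := h2 (Real.sqrt ((R + 1) / (-C)))
    rw [Real.sq_sqrt (div_nonneg (by linarith) (by linarith))] at this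
    have e : C * ((R + 1) / (-C)) = -(R + 1) := by
      have := hc.ne
      field_simp
    linarith
  refine ⟨hC, hR, ?_⟩
  rcases hC.eq_or_lt with h0 | hpos
  · subst h0
    have : ‖b‖ ^ 2 = 0 := by
      by_contra hne
      have hp : 0 < ‖b‖ ^ 2 := lt_of_le_of_ne (by positivity) (Ne.symm hne)
      have h1 := hs ((R + 1) / (‖b‖ ^ 2))
      have e : 2 * ((R + 1) / (‖b‖ ^ 2)) * ‖b‖ ^ 2 = 2 * (R + 1) := by
        rw [mul_assoc, div_mul_cancel₀ _ hne]
      rw [e] at h1; linarith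
    rw [this]; simp
  · have h1 := hs (1 / C)
    have e : C * (1 / C) ^ 2 * ‖b‖ ^ 2 - 2 * (1 / C) * ‖b‖ ^ 2 + R = R - ‖b‖ ^ 2 / C := by
      field_simp; ring
    rw [e] at h1
    have : ‖b‖ ^ 2 / C ≤ R := by linarith
    rw [div_le_iff₀ hpos] at this
    linarith

theorem xi_extract {U : Set (Fin m → ℂ)} (hU : IsOpen U) (hD : IsOpen D)
    {φ : (Fin m → ℂ) × (Fin n → ℂ) → ℝ} (hφ : ContDiffOn ℝ ∞ φ (U ×ˢ D)) {η : (Fin n → ℂ) → ℝ}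
    (hη : ContDiffOn ℝ ∞ η D) {δ : ℝ} (hXi : XiNonneg U D φ η δ) {t x} (ht : t ∈ U) (hx : x ∈ D)
    (w : Fin m → ℂ) (ξ : Fin n → ℂ) :
    0 ≤ (wder (fun y => wderBar (fun q => (φ q : ℂ)) (w, (0 : Fin n → ℂ)) y) (w, (0 : Fin n → ℂ)) (t, x)).re ∧
    0 ≤ δ / (1 + δ) * (Qf (fun y => φ (t, y) + 2 * η y) ξ x
        - (1 + δ) * ‖∑ j, ξ j * wder (fun y => (η y : ℂ)) (ev j) x‖ ^ 2) ∧
    ‖wderBar (fun z => wder (fun q => (φ q : ℂ)) (w, (0 : Fin n → ℂ)) (t, z)) ξ x‖ ^ 2 ≤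
      (wder (fun y => wderBar (fun q => (φ q : ℂ)) (w, (0 : Fin n → ℂ)) y) (w, (0 : Fin n → ℂ)) (t, x)).re *
      (δ / (1 + δ) * (Qf (fun y => φ (t, y) + 2 * η y) ξ x
        - (1 + δ) * ‖∑ j, ξ j * wder (fun y => (η y : ℂ)) (ev j) x‖ ^ 2)) := by
  have hS := hU.prod hD
  have hp : (t, x) ∈ U ×ˢ D := mk_mem_prod ht hx
  have cφ := contDiffOn_ofReal hφ
  apply quad_ineq
  intro c
  have h := hXi (t, x) hp (c • w) ξ
  have hφt : ContDiffOn ℝ ∞ (fun y => φ (t, y)) D :=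
    hφ.comp (contDiffOn_const.prodMk contDiffOn_id) fun y hy => mk_mem_prod ht hy
  have e0 : Qf (fun y => φ (t, y) + 2 * η y) ξ x =
      (wder (fun y => wderBar (fun q => (φ q : ℂ)) ((0 : Fin m → ℂ), ξ) y) ((0 : Fin m → ℂ), ξ) (t, x)
        + 2 * wder (fun y => wderBar (fun w => (η w : ℂ)) ξ y) ξ x).re := by
    rw [Qf_eq hD (hφt.add (contDiffOn_const.mul hη)) hx, Levi_add hD hφt (contDiffOn_const.mul hη) _ _ hx,
      Levi_slice hU hD hφ ht hx, Levi_const_mul hD hη _ _ _ hx]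
    norm_num
  have e1 : ‖∑ j, ξ j * wder (fun y => (η y : ℂ)) (ev j) x‖ ^ 2 =
      Complex.normSq (wder (fun w => (η w : ℂ)) ξ x) := by
    rw [Complex.normSq_eq_norm_sq]
    conv_rhs => rw [sum_ev ξ, wder_sum_dir]
  set v : (Fin m → ℂ) × (Fin n → ℂ) := (w, 0) with hv
  have hcv : ((c • w, 0) : (Fin m → ℂ) × (Fin n → ℂ)) = c • v := by simp [hv]
  set z : (Fin m → ℂ) × (Fin n → ℂ) := (0, ξ) with hz
  -- diagonal
  have d : ∀ a b c', wder (fun y => wderBar (fun q => (φ q : ℂ)) (c' • b) y) a (t, x) =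
      (starRingEnd ℂ) c' * wder (fun y => wderBar (fun q => (φ q : ℂ)) b y) a (t, x) := by
    intro a b c'
    rw [wder_wderBar_comm hS hp cφ, wderBar_smul_dir, ← wder_wderBar_comm hS hp cφ]
  have e2 : wder (fun y => wderBar (fun q => (φ q : ℂ)) z y) v (t, x) =
      wderBar (fun y => wder (fun q => (φ q : ℂ)) v (t, y)) ξ x := by
    rw [wder_wderBar_comm hS hp cφ,
      wderBar_slice (F := fun p => wder (fun q => (φ q : ℂ)) v p) (diffAt_of_contDiffOn hS hp (contDiffOn_wder hS cφ v))]
  have e3 : wder (fun y => wderBar (fun q => (φ q : ℂ)) v y) z (t, x) =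
      (starRingEnd ℂ) (wder (fun y => wderBar (fun q => (φ q : ℂ)) z y) v (t, x)) := by
    rw [← wderBar_conj _ (diffAt_of_contDiffOn hS hp (contDiffOn_wderBar hS cφ z)), wder_wderBar_comm hS hp cφ]
    apply wderBar_congr
    filter_upwards [hS.mem_nhds hp] with y hy
    rw [conj_wderBar_ofReal _ (diffAt_of_contDiffOn hS hy hφ)]
  rw [← e2, e0, e1]
  rw [hcv] at h
  simp only [d, wder_smul_dir, e3] at h
  set X := wder (fun y => wderBar (fun q => (φ q : ℂ)) v y) v (t, x)
  set Y := wder (fun y => wderBar (fun q => (φ q : ℂ)) z y) v (t, x)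
  have h1 : ((starRingEnd ℂ) c * (c * X)).re = X.re * Complex.normSq c := by
    rw [← mul_assoc, ← Complex.normSq_eq_conj_mul_self, Complex.re_ofReal_mul, mul_comm]
  have h2 : ((starRingEnd ℂ) c * (starRingEnd ℂ) Y).re = (c * Y).re := by
    rw [← map_mul, Complex.conj_re]
  simp only [Complex.add_re, h1, h2, Complex.re_ofReal_mul, Complex.sub_re, Complex.ofReal_re] at h ⊢
  linarith

end geo
end

noncomputable section
open MeasureTheory Set Filter
open scoped ENNReal ComplexOrder ContDiff Topology

section dom
variable {n m : ℕ} {Ω : Set (Fin n → ℂ)} {u : (Fin n → ℂ) → ℝ}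

/-- strictly psh exhaustion -/
structure Exh (Ω : Set (Fin n → ℂ)) (u : (Fin n → ℂ) → ℝ) : Prop where
  op : IsOpen Ω
  sm : ContDiffOn ℝ ∞ u Ω
  lv : ∀ x ∈ Ω, ∀ ξ : Fin n → ℂ, nsq ξ ≤ (wder (fun y => wderBar (fun q => (u q : ℂ)) ξ y) ξ x).re
  cp : ∀ c : ℝ, IsCompact {z ∈ Ω | u z ≤ c}

theorem exh_exists (h : Pseudoconvex Ω) : ∃ u, Exh Ω u := by
  obtain ⟨hΩ, u0, hu0, hL, hc⟩ := h
  have hu0' : ContDiffOn ℝ ∞ u0 Ω := hu0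
  have hn : ContDiffOn ℝ ∞ (nsq (n := n)) Ω := nsq_contDiff.contDiffOn
  have hsm : ContDiffOn ℝ ∞ (fun z => u0 z + nsq z) Ω := hu0'.add hn
  refine ⟨fun z => u0 z + nsq z, hΩ, hsm, ?_, ?_⟩
  · intro x hx ξ
    rw [Levi_add hΩ hu0' hn _ _ hx, Levi_nsq, Complex.add_re, Complex.ofReal_re]
    have := hL x hx ξ
    linarith
  · intro c
    have hcl : IsClosed ({z ∈ Ω | u0 z ≤ c} ∩ (fun z => u0 z + nsq z) ⁻¹' Iic c) :=
      (hsm.continuousOn.mono fun z hz => hz.1).preimage_isClosed_of_isClosed (hc c).isClosed isClosed_Iic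
    have he : {z ∈ Ω | u0 z + nsq z ≤ c} = {z ∈ Ω | u0 z ≤ c} ∩ (fun z => u0 z + nsq z) ⁻¹' Iic c := by
      ext z
      have hz : 0 ≤ nsq z := Finset.sum_nonneg fun j _ => Complex.normSq_nonneg _
      simp only [mem_setOf_eq, mem_inter_iff, mem_preimage, mem_Iic]
      constructor
      · rintro ⟨h1, h2⟩; exact ⟨⟨h1, by linarith⟩, h2⟩
      · rintro ⟨⟨h1, _⟩, h3⟩; exact ⟨h1, h3⟩
    simp only [he]
    exact (hc c).of_isClosed_subset hcl inter_subset_left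

/-- sublevel domain -/
def Dc (Ω : Set (Fin n → ℂ)) (u : (Fin n → ℂ) → ℝ) (c : ℝ) : Set (Fin n → ℂ) := {x ∈ Ω | u x < c}

/-- one-variable boundary weight -/
def Pk (c s : ℝ) : ℝ := ((c - s) ^ 3)⁻¹ / 3

/-- boundary weight -/
def kap (u : (Fin n → ℂ) → ℝ) (c : ℝ) (x : Fin n → ℂ) : ℝ := Pk c (u x)

theorem Pk_deriv {c s : ℝ} (hs : s < c) : deriv (Pk c) s = ((c - s) ^ 4)⁻¹ := by
  have h0 : c - s ≠ 0 := by linarith [sub_pos.2 hs]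
  have h1 : HasDerivAt (fun s => c - s) (-1) s := by simpa using (hasDerivAt_id s).const_sub c
  have h2 := ((h1.fun_pow 3).fun_inv (pow_ne_zero 3 h0)).div_const 3
  unfold Pk
  rw [h2.deriv]
  field_simp
  norm_num
  ring

theorem Pk_deriv2 {c s : ℝ} (hs : s < c) : 0 ≤ deriv (deriv (Pk c)) s := by
  have h0 : 0 < c - s := by linarith [sub_pos.2 hs]
  have h1 : HasDerivAt (fun s => c - s) (-1) s := by simpa using (hasDerivAt_id s).const_sub c
  have h2 := ((h1.fun_pow 4).fun_inv (pow_ne_zero 4 h0.ne'))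
  have e : deriv (Pk c) =ᶠ[𝓝 s] fun s => ((c - s) ^ 4)⁻¹ := by
    filter_upwards [Iio_mem_nhds hs] with y hy
    exact Pk_deriv hy
  rw [e.deriv_eq, h2.deriv]
  apply div_nonneg _ (by positivity)
  simp
  positivity

theorem Pk_contDiffOn (c : ℝ) : ContDiffOn ℝ ∞ (Pk c) (Iio c) := by
  unfold Pk
  refine ContDiffOn.div_const (ContDiffOn.inv ?_ ?_) 3
  · exact ((contDiff_const.sub contDiff_id).pow 3).contDiffOn
  · intro x hx
    have : x < c := hx
    exact pow_ne_zero 3 (by linarith [sub_pos.2 this])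

theorem Exh.Dc_open (h : Exh Ω u) (c : ℝ) : IsOpen (Dc Ω u c) := by
  have := h.sm.continuousOn.isOpen_inter_preimage h.op (isOpen_Iio (a := c))
  exact this

theorem Dc_sub (c : ℝ) : Dc Ω u c ⊆ Ω := fun _ h => h.1

theorem Exh.kap_smooth (h : Exh Ω u) (c : ℝ) : ContDiffOn ℝ ∞ (kap u c) (Dc Ω u c) :=
  (Pk_contDiffOn c).comp (h.sm.mono (Dc_sub c)) fun _ hx => hx.2

theorem Exh.kap_levi (h : Exh Ω u) {c : ℝ} {x} (hx : x ∈ Dc Ω u c) (ξ : Fin n → ℂ) :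
    ((c - u x) ^ 4)⁻¹ * nsq ξ ≤ Qf (kap u c) ξ x := by
  have hD := h.Dc_open c
  rw [Qf_eq hD (h.kap_smooth c) hx]
  have := Levi_comp hD (h.sm.mono (Dc_sub c)) isOpen_Iio (Pk_contDiffOn c) (fun _ hx => hx.2) ξ hx
  unfold kap
  rw [this, Pk_deriv hx.2, Complex.add_re, Complex.re_ofReal_mul, Complex.re_ofReal_mul, Complex.ofReal_re]
  have h1 := h.lv x hx.1 ξ
  have h2 : 0 ≤ ((c - u x) ^ 4)⁻¹ := by positivity
  have h3 := Pk_deriv2 hx.2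
  have h4 := Complex.normSq_nonneg (wder (fun q => (u q : ℂ)) ξ x)
  nlinarith [mul_nonneg h3 h4, mul_le_mul_of_nonneg_left h1 h2]

theorem Exh.bdd (h : Exh Ω u) (c : ℝ) {E : Type*} [NormedAddCommGroup E] {F : (Fin n → ℂ) → E} (hF : ContinuousOn F Ω) :
    ∃ M, ∀ x ∈ Dc Ω u c, ‖F x‖ ≤ M := by
  obtain ⟨M, hM⟩ := (h.cp c).exists_bound_of_continuousOn (hF.mono fun x hx => hx.1)
  exact ⟨M, fun x hx => hM x ⟨hx.1, hx.2.le⟩⟩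

theorem Exh.bdd_fam (h : Exh Ω u) (c : ℝ) {F : Fin n → (Fin n → ℂ) → ℂ} (hF : ∀ j, ContinuousOn (F j) Ω) :
    ∃ M, ∀ x ∈ Dc Ω u c, ∀ j, ‖F j x‖ ≤ M := by
  obtain ⟨M, hM⟩ := h.bdd c (F := fun x j => F j x) (continuousOn_pi.2 hF)
  exact ⟨M, fun x hx j => (norm_le_pi_norm (fun j => F j x) j).trans (hM x hx)⟩

/-- derivative in parameter direction -/
def At (φ : (Fin m → ℂ) × (Fin n → ℂ) → ℝ) (w t : Fin m → ℂ) (x : Fin n → ℂ) : ℂ :=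
  wder (fun q => (φ q : ℂ)) (w, (0 : Fin n → ℂ)) (t, x)

/-- Levi form in parameter direction -/
def Ct (φ : (Fin m → ℂ) × (Fin n → ℂ) → ℝ) (w t : Fin m → ℂ) (x : Fin n → ℂ) : ℝ :=
  (wder (fun y => wderBar (fun q => (φ q : ℂ)) (w, (0 : Fin n → ℂ)) y) (w, (0 : Fin n → ℂ)) (t, x)).re

variable {U : Set (Fin m → ℂ)} {φ : (Fin m → ℂ) × (Fin n → ℂ) → ℝ} {η : (Fin n → ℂ) → ℝ} {δ : ℝ}

theorem slice_smooth {F : Type*} [NormedAddCommGroup F] [NormedSpace ℝ F] {φ : (Fin m → ℂ) × (Fin n → ℂ) → F} (hφ : ContDiffOn ℝ ∞ φ (U ×ˢ Ω)) {t} (ht : t ∈ U) :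
    ContDiffOn ℝ ∞ (fun x => φ (t, x)) Ω :=
  hφ.comp (contDiffOn_const.prodMk contDiffOn_id) fun _ hy => mk_mem_prod ht hy

theorem At_smooth (hU : IsOpen U) (hΩ : IsOpen Ω) (hφ : ContDiffOn ℝ ∞ φ (U ×ˢ Ω)) {t} (ht : t ∈ U) (w : Fin m → ℂ) :
    ContDiffOn ℝ ∞ (At φ w t) Ω :=
  slice_smooth (contDiffOn_wder (hU.prod hΩ) (contDiffOn_ofReal hφ) _) ht

theorem Ct_cont (hU : IsOpen U) (hΩ : IsOpen Ω) (hφ : ContDiffOn ℝ ∞ φ (U ×ˢ Ω)) {t} (ht : t ∈ U) (w : Fin m → ℂ) :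
    ContinuousOn (Ct φ w t) Ω :=
  Complex.continuous_re.comp_continuousOn (slice_smooth (contDiffOn_wder (hU.prod hΩ)
    (contDiffOn_wderBar (hU.prod hΩ) (contDiffOn_ofReal hφ) _) _) ht).continuousOn

theorem core_apply (hE : Exh Ω u) (hU : IsOpen U) (hφ : ContDiffOn ℝ ∞ φ (U ×ˢ Ω)) (hη : ContDiffOn ℝ ∞ η Ω)
    (hδ : 0 < δ) (hXi : XiNonneg U Ω φ η δ) {t : Fin m → ℂ} (ht : t ∈ U) (w : Fin m → ℂ) (α : ℂ) (c : ℝ)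
    {f : (Fin n → ℂ) → ℂ} (hf : DifferentiableOn ℂ f (Dc Ω u c))
    (hfm : MemLp (fun x => f x * hx (fun x => φ (t, x) + kap u c x) x) 2 (volume.restrict (Dc Ω u c))) :
    ∃ g, DifferentiableOn ℂ g (Dc Ω u c) ∧
      MemLp (fun x => g x * hx (fun x => φ (t, x) + kap u c x) x) 2 (volume.restrict (Dc Ω u c)) ∧
      ∫ x in Dc Ω u c, ‖((At φ w t x - α) * f x - g x) * hx (fun x => φ (t, x) + kap u c x) x‖ ^ 2 ≤
        ∫ x in Dc Ω u c, Ct φ w t x * ‖f x * hx (fun x => φ (t, x) + kap u c x) x‖ ^ 2 := by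
  have hD := hE.Dc_open c
  set D := Dc Ω u c with hDd
  have hsub : D ⊆ Ω := Dc_sub c
  have hφt : ContDiffOn ℝ ∞ (fun x => φ (t, x)) Ω := slice_smooth hφ ht
  have hA : ContDiffOn ℝ ∞ (At φ w t) Ω := At_smooth hU hE.op hφ ht w
  have hA' : ContDiffOn ℝ ∞ (fun x => At φ w t x - α) Ω := hA.sub contDiffOn_const
  have hCt := Ct_cont hU hE.op hφ ht w
  have hηc := contDiffOn_ofReal hη
  have huc := contDiffOn_ofReal hE.sm
  obtain ⟨M1, hM1⟩ := hE.bdd c hη.continuousOn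
  obtain ⟨M2, hM2⟩ := hE.bdd_fam c fun j => (contDiffOn_wder hE.op hηc (ev j)).continuousOn
  obtain ⟨M3, hM3⟩ := hE.bdd c (F := fun x => c - u x) (continuousOn_const.sub hE.sm.continuousOn)
  obtain ⟨M4, hM4⟩ := hE.bdd_fam c fun j => (contDiffOn_wder hE.op (contDiffOn_ofReal
    (contDiffOn_const.sub hE.sm : ContDiffOn ℝ ∞ (fun x => c - u x) Ω)) (ev j)).continuousOn
  obtain ⟨M5, hM5⟩ := hE.bdd c hA'.continuousOn
  obtain ⟨M6, hM6⟩ := hE.bdd_fam c fun j => (contDiffOn_wderBar hE.op hA' (ev j)).continuousOn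
  obtain ⟨M7, hM7⟩ := hE.bdd c hCt
  set M := max M1 (max M2 (max M3 (max M4 (max M5 (max M6 M7))))) with hM
  have l1 : M1 ≤ M := le_max_left _ _
  have l2 : M2 ≤ M := by simp [hM]
  have l3 : M3 ≤ M := by simp [hM]
  have l4 : M4 ≤ M := by simp [hM]
  have l5 : M5 ≤ M := by simp [hM]
  have l6 : M6 ≤ M := by simp [hM]
  have l7 : M7 ≤ M := by simp [hM]
  have hk := hE.kap_smooth c
  have hφD := hφt.mono hsub
  have hηD := hη.mono hsub
  have hQ : ∀ x ∈ D, ∀ ξ : Fin n → ℂ, Qf (fun y => (φ (t, y) + kap u c y) + 2 * η y) ξ x =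
      Qf (fun y => φ (t, y) + 2 * η y) ξ x + Qf (kap u c) ξ x := by
    intro x hx ξ
    have h1 : ContDiffOn ℝ ∞ (fun y => φ (t, y) + 2 * η y) D := hφD.add (contDiffOn_const.mul hηD)
    rw [show (fun y => (φ (t, y) + kap u c y) + 2 * η y) = fun y => (φ (t, y) + 2 * η y) + kap u c y by
      ext y; ring]
    rw [Qf_eq hD (h1.add hk) hx, Levi_add hD h1 hk _ _ hx, Complex.add_re, ← Qf_eq hD h1 hx, ← Qf_eq hD hk hx]
  have hpos : 0 < δ / (1 + δ) := by positivity
  have hX : ∀ x ∈ D, ∀ ξ : Fin n → ℂ, _ := fun x hx ξ => xi_extract hU hE.op hφ hη hXi ht (hsub hx) w ξ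
  have hB0 : ∀ x ∈ D, ∀ ξ : Fin n → ℂ, 0 ≤ Qf (fun y => φ (t, y) + 2 * η y) ξ x
        - (1 + δ) * ‖∑ j, ξ j * wder (fun y => (η y : ℂ)) (ev j) x‖ ^ 2 := fun x hx ξ =>
    nonneg_of_mul_nonneg_right (hX x hx ξ).2.1 hpos
  have hm0 : ∀ x ∈ D, 0 < c - u x := fun x hx => sub_pos.2 hx.2
  have hnsq : ∀ ξ : Fin n → ℂ, ∑ j, ‖ξ j‖ ^ 2 = nsq ξ := fun ξ => by
    simp only [nsq, Complex.normSq_eq_norm_sq]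
  have hnn : ∀ ξ : Fin n → ℂ, 0 ≤ nsq ξ := fun ξ => Finset.sum_nonneg fun j _ => Complex.normSq_nonneg _
  refine core_thm hD (hφD.add hk) hηD (M := M) hδ (fun x hx => (hM1 x hx).trans l1)
    (fun x hx j => (hM2 x hx j).trans l2) (m := fun x => c - u x)
    (contDiffOn_const.sub (hE.sm.mono hsub)) hm0 (fun x hx => ((le_abs_self _).trans (hM3 x hx)).trans l3)
    (fun x hx j => (hM4 x hx j).trans l4) ?_ ?_ (hA'.mono hsub) (fun x hx => (hM5 x hx).trans l5)
    (fun x hx j => (hM6 x hx j).trans l6) (fun x hx => (hX x hx 0).1)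
    (fun x hx => ((le_abs_self _).trans (hM7 x hx)).trans l7) (hCt.mono hsub) ?_ hf hfm
  · intro ε hε
    have : {x ∈ D | ε ≤ c - u x} = {z ∈ Ω | u z ≤ c - ε} := by
      ext x; simp only [hDd, Dc, mem_setOf_eq]
      constructor
      · rintro ⟨⟨h1, _⟩, h2⟩; exact ⟨h1, by linarith⟩
      · rintro ⟨h1, h2⟩; exact ⟨⟨h1, by linarith⟩, by linarith⟩
    rw [this]; exact hE.cp _
  · intro x hx ξ
    rw [hnsq, hQ x hx]
    have h1 := hE.kap_levi hx ξ
    have h2 := hB0 x hx ξ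
    have h3 := hm0 x hx
    have h4 : nsq ξ = (c - u x) ^ 4 * (((c - u x) ^ 4)⁻¹ * nsq ξ) := by field_simp
    rw [h4]
    gcongr
    linarith
  · intro x hx ξ
    have h1 := (hX x hx ξ).2.2
    have h0 := (hX x hx ξ).1
    have h2 : 0 ≤ Qf (kap u c) ξ x := le_trans (mul_nonneg (by have := hm0 x hx; positivity) (hnn ξ)) (hE.kap_levi hx ξ)
    have e : ∑ j, (starRingEnd ℂ) (ξ j) * wderBar (fun x => At φ w t x - α) (ev j) x =
        wderBar (At φ w t) ξ x := by
      have : wderBar (fun x => At φ w t x - α) ξ x = wderBar (At φ w t) ξ x := by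
        simp [wderBar, fderiv_sub_const]
      rw [← this]
      conv_rhs => rw [sum_ev ξ, wderBar_sum_dir]
    rw [e, hQ x hx, mul_assoc]
    refine h1.trans ?_
    change Ct φ w t x * _ ≤ _
    have h0' : 0 ≤ Ct φ w t x := h0
    refine mul_le_mul_of_nonneg_left (mul_le_mul_of_nonneg_left ?_ hpos.le) h0'
    linarith

end dom
end

noncomputable section
open MeasureTheory Set Filter
open scoped ENNReal ComplexOrder ContDiff Topology
section ker
variable {n : ℕ} {D D' : Set (Fin n → ℂ)} {W W' : (Fin n → ℂ) → ℝ} {f : (Fin n → ℂ) → ℂ} {z : Fin n → ℂ}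

theorem enorm_mul_hx (W : (Fin n → ℂ) → ℝ) (f : (Fin n → ℂ) → ℂ) (x) :
    ENNReal.ofReal (‖f x‖ ^ 2 * Real.exp (-(W x))) = ‖f x * hx W x‖ₑ ^ 2 := by
  rw [← norm_hx_sq, ← mul_pow, ← norm_mul, ENNReal.ofReal_pow (norm_nonneg _), ofReal_norm]

theorem bns_eq (D : Set (Fin n → ℂ)) (W : (Fin n → ℂ) → ℝ) (f : (Fin n → ℂ) → ℂ) :
    bergNormSq D W volume f = ∫⁻ x in D, ‖f x * hx W x‖ₑ ^ 2 := by
  simp only [bergNormSq, enorm_mul_hx]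

theorem hx_cont (hW : ContinuousOn W D) : ContinuousOn (hx W) D := by
  unfold hx
  exact Complex.continuous_ofReal.comp_continuousOn (Real.continuous_exp.comp_continuousOn (hW.neg.div_const 2))

theorem memLp_of_bns (hD : IsOpen D) (hW : ContinuousOn W D) (hf : DifferentiableOn ℂ f D)
    (h : bergNormSq D W volume f ≠ ⊤) : MemLp (fun x => f x * hx W x) 2 (volume.restrict D) := by
  have hm : AEStronglyMeasurable (fun x => f x * hx W x) (volume.restrict D) :=
    (hf.continuousOn.mul (hx_cont hW)).aestronglyMeasurable hD.measurableSet
  refine ⟨hm, ?_⟩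
  rw [bns_eq, ← eLpNorm_two_sq] at h
  by_contra hh
  rw [not_lt, top_le_iff] at hh
  exact h (by rw [hh]; rfl)

theorem bns_of_memLp (h : MemLp (fun x => f x * hx W x) 2 (volume.restrict D)) :
    bergNormSq D W volume f = ENNReal.ofReal (∫ x in D, ‖f x * hx W x‖ ^ 2) := by
  rw [bergNormSq, ofReal_integral_eq_lintegral_ofReal (h.integrable_norm_pow (by simp))
    (Eventually.of_forall fun x => by positivity)]
  refine lintegral_congr fun x => ?_
  rw [norm_mul, mul_pow, norm_hx_sq]

theorem bns_ne_top (h : MemLp (fun x => f x * hx W x) 2 (volume.restrict D)) :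
    bergNormSq D W volume f ≠ ⊤ := by
  rw [bns_of_memLp h]; exact ENNReal.ofReal_ne_top

theorem ptbound (hD : IsOpen D) (hW : ContinuousOn W D) (hz : z ∈ D) :
    ∃ M : NNReal, ∀ f, DifferentiableOn ℂ f D → ENNReal.ofReal (‖f z‖ ^ 2) ≤ M * bergNormSq D W volume f := by
  obtain ⟨ε, hε, hb⟩ := Metric.nhds_basis_closedBall.mem_iff.1 (hD.mem_nhds hz)
  obtain ⟨M, hM⟩ := bergman_bound (n := n) hε
  obtain ⟨B, hB⟩ := (isCompact_closedBall z ε).exists_bound_of_continuousOn (hW.mono hb)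
  refine ⟨M * (Real.exp B).toNNReal, fun f hf => ?_⟩
  have h1 := hM f D z hD hf hb
  rw [ENNReal.ofReal_pow (norm_nonneg _), ofReal_norm]
  refine h1.trans ?_
  rw [ENNReal.coe_mul, mul_assoc]
  gcongr
  have h2 : (((Real.exp B).toNNReal : NNReal) : ℝ≥0∞) = ENNReal.ofReal (Real.exp B) := rfl
  rw [h2, bergNormSq, ← lintegral_const_mul' _ _ ENNReal.ofReal_ne_top]
  refine le_trans ?_ (lintegral_mono_set hb)
  refine setLIntegral_mono' measurableSet_closedBall fun x hxx => ?_
  rw [← ENNReal.ofReal_mul (Real.exp_pos _).le, ← ofReal_norm, ← ENNReal.ofReal_pow (norm_nonneg _)]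
  refine ENNReal.ofReal_le_ofReal ?_
  have h3 := (abs_le.1 (hB x hxx)).2
  have h4 : 1 ≤ Real.exp B * Real.exp (-(W x)) := by
    rw [← Real.exp_add]; exact Real.one_le_exp (by linarith)
  nlinarith [sq_nonneg ‖f x‖]

theorem le_ker (hD : IsOpen D) (hW : ContinuousOn W D) (hz : z ∈ D) (hf : DifferentiableOn ℂ f D)
    (h : bergNormSq D W volume f ≠ ⊤) :
    ENNReal.ofReal (‖f z‖ ^ 2) ≤ bergKernel D W volume z * bergNormSq D W volume f := by
  by_cases h0 : bergNormSq D W volume f = 0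
  · obtain ⟨M, hM⟩ := ptbound hD hW hz
    have := hM f hf
    rw [h0, mul_zero] at this ⊢
    exact this
  · have h1 : ENNReal.ofReal (‖f z‖ ^ 2) / bergNormSq D W volume f ≤ bergKernel D W volume z := by
      unfold bergKernel
      exact le_iSup_of_le f (le_iSup_of_le hf (le_iSup_of_le h0 (le_iSup_of_le h le_rfl)))
    rwa [ENNReal.div_le_iff h0 h] at h1

theorem ker_le {c : ℝ≥0∞} (H : ∀ f, DifferentiableOn ℂ f D → bergNormSq D W volume f ≠ 0 → bergNormSq D W volume f ≠ ⊤ →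
    ENNReal.ofReal (‖f z‖ ^ 2) ≤ c * bergNormSq D W volume f) : bergKernel D W volume z ≤ c := by
  unfold bergKernel
  refine iSup_le fun f => iSup_le fun hf => iSup_le fun h0 => iSup_le fun h => ?_
  rw [ENNReal.div_le_iff h0 h]
  exact H f hf h0 h

theorem ker_lt_top (hD : IsOpen D) (hW : ContinuousOn W D) (hz : z ∈ D) : bergKernel D W volume z < ⊤ := by
  obtain ⟨M, hM⟩ := ptbound hD hW hz
  exact (ker_le fun f hf _ _ => hM f hf).trans_lt ENNReal.coe_lt_top

theorem bns_mono (hD : IsOpen D) (hsub : D ⊆ D') {s : ℝ} (h : ∀ x ∈ D, W' x ≤ W x + s) (f) :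
    bergNormSq D W volume f ≤ ENNReal.ofReal (Real.exp s) * bergNormSq D' W' volume f := by
  rw [bergNormSq, bergNormSq, ← lintegral_const_mul' _ _ ENNReal.ofReal_ne_top]
  refine le_trans ?_ (lintegral_mono_set hsub)
  refine setLIntegral_mono' hD.measurableSet fun x hxx => ?_
  rw [← ENNReal.ofReal_mul (Real.exp_pos _).le]
  refine ENNReal.ofReal_le_ofReal ?_
  have h4 : Real.exp (-(W x)) ≤ Real.exp s * Real.exp (-(W' x)) := by
    rw [← Real.exp_add]; exact Real.exp_le_exp.2 (by linarith [h x hxx])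
  nlinarith [sq_nonneg ‖f x‖]

theorem ker_mono (hD : IsOpen D) (hW : ContinuousOn W D) (hz : z ∈ D) (hsub : D ⊆ D') {s : ℝ}
    (h : ∀ x ∈ D, W' x ≤ W x + s) :
    bergKernel D' W' volume z ≤ ENNReal.ofReal (Real.exp s) * bergKernel D W volume z := by
  refine ker_le fun f hf h0 ht => ?_
  have h1 := bns_mono hD hsub h f
  have h2 : bergNormSq D W volume f ≠ ⊤ :=
    (h1.trans_lt (ENNReal.mul_lt_top ENNReal.ofReal_lt_top (lt_top_iff_ne_top.2 ht))).ne
  refine (le_ker hD hW hz (hf.mono hsub) h2).trans ?_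
  calc _ ≤ bergKernel D W volume z * (ENNReal.ofReal (Real.exp s) * bergNormSq D' W' volume f) := by gcongr
    _ = _ := by ring

theorem ker_pos (hD : IsOpen D) (hW : ContinuousOn W D) (hz : z ∈ D) (hm : volume D ≠ ⊤) {B : ℝ}
    (hB : ∀ x ∈ D, -B ≤ W x) : bergKernel D W volume z ≠ 0 := by
  have h : bergNormSq D W volume (fun _ => 1) ≠ ⊤ := by
    have : bergNormSq D W volume (fun _ => 1) ≤ ENNReal.ofReal (Real.exp B) * volume D := by
      rw [bergNormSq, ← setLIntegral_const]
      refine setLIntegral_mono' hD.measurableSet fun x hxx => ENNReal.ofReal_le_ofReal ?_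
      simp only [norm_one, one_pow, one_mul]
      exact Real.exp_le_exp.2 (by linarith [hB x hxx])
    exact (this.trans_lt (ENNReal.mul_lt_top ENNReal.ofReal_lt_top (lt_top_iff_ne_top.2 hm))).ne
  intro h0
  have := le_ker hD hW hz (differentiableOn_const 1) h
  simp [h0] at this

theorem elog_eq : elog = ENNReal.log := by
  ext x
  unfold elog ENNReal.log
  rfl

end ker
end

noncomputable section
open MeasureTheory Set Filter
open scoped ENNReal ComplexOrder ContDiff Topology
section kn
variable {n m : ℕ} {Ω : Set (Fin n → ℂ)} {u : (Fin n → ℂ) → ℝ}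
variable {U : Set (Fin m → ℂ)} {φ : (Fin m → ℂ) × (Fin n → ℂ) → ℝ} {z : Fin n → ℂ} {c : ℝ}

/-- approximating kernels -/
def KN (Ω : Set (Fin n → ℂ)) (u : (Fin n → ℂ) → ℝ) (φ : (Fin m → ℂ) × (Fin n → ℂ) → ℝ) (z : Fin n → ℂ) (c : ℝ)
    (t : Fin m → ℂ) : ℝ≥0∞ :=
  bergKernel (Dc Ω u c) (fun x => φ (t, x) + kap u c x) volume z

/-- logarithms of approximating kernels -/
def SN (Ω : Set (Fin n → ℂ)) (u : (Fin n → ℂ) → ℝ) (φ : (Fin m → ℂ) × (Fin n → ℂ) → ℝ) (z : Fin n → ℂ) (c : ℝ)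
    (t : Fin m → ℂ) : ℝ := Real.log (KN Ω u φ z c t).toReal

theorem kap_nonneg {x} (hx : x ∈ Dc Ω u c) : 0 ≤ kap u c x := by
  have : 0 < c - u x := sub_pos.2 hx.2
  unfold kap Pk; positivity

theorem kap_anti {c c' : ℝ} (h : c ≤ c') {x} (hx : x ∈ Dc Ω u c) : kap u c' x ≤ kap u c x := by
  have : 0 < c - u x := sub_pos.2 hx.2
  unfold kap Pk
  have h1 : (c - u x) ^ 3 ≤ (c' - u x) ^ 3 := by gcongr
  gcongr

theorem Exh.W_smooth (hE : Exh Ω u) (hφ : ContDiffOn ℝ ∞ φ (U ×ˢ Ω)) {t} (ht : t ∈ U) (c : ℝ) :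
    ContDiffOn ℝ ∞ (fun x => φ (t, x) + kap u c x) (Dc Ω u c) :=
  ((slice_smooth hφ ht).mono (Dc_sub c)).add (hE.kap_smooth c)

theorem Exh.vol_Dc (hE : Exh Ω u) (c : ℝ) : volume (Dc Ω u c) ≠ ⊤ :=
  ((measure_mono (t := {z ∈ Ω | u z ≤ c}) fun _ hx => ⟨hx.1, hx.2.le⟩).trans_lt (hE.cp c).measure_lt_top).ne

theorem KN_lt_top (hE : Exh Ω u) (hφ : ContDiffOn ℝ ∞ φ (U ×ˢ Ω)) {t} (ht : t ∈ U) (hz : z ∈ Dc Ω u c) :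
    KN Ω u φ z c t < ⊤ :=
  ker_lt_top (hE.Dc_open c) (hE.W_smooth hφ ht c).continuousOn hz

theorem KN_ne_zero (hE : Exh Ω u) (hφ : ContDiffOn ℝ ∞ φ (U ×ˢ Ω)) {t} (ht : t ∈ U) (hz : z ∈ Dc Ω u c) :
    KN Ω u φ z c t ≠ 0 := by
  obtain ⟨B, hB⟩ := hE.bdd c (slice_smooth hφ ht).continuousOn
  refine ker_pos (hE.Dc_open c) (hE.W_smooth hφ ht c).continuousOn hz (hE.vol_Dc c) (B := B) fun x hx => ?_
  have := (abs_le.1 (hB x hx)).1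
  have := kap_nonneg hx
  linarith

theorem KN_toReal_pos (hE : Exh Ω u) (hφ : ContDiffOn ℝ ∞ φ (U ×ˢ Ω)) {t} (ht : t ∈ U) (hz : z ∈ Dc Ω u c) :
    0 < (KN Ω u φ z c t).toReal :=
  ENNReal.toReal_pos (KN_ne_zero hE hφ ht hz) (KN_lt_top hE hφ ht hz).ne

theorem K_le_KN (hE : Exh Ω u) (hφ : ContDiffOn ℝ ∞ φ (U ×ˢ Ω)) {t} (ht : t ∈ U) (hz : z ∈ Dc Ω u c) :
    bergKernel Ω (fun x => φ (t, x)) volume z ≤ KN Ω u φ z c t := by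
  have := ker_mono (hE.Dc_open c) (hE.W_smooth hφ ht c).continuousOn hz (Dc_sub c) (s := 0)
    (W' := fun x => φ (t, x)) fun x hx => by have := kap_nonneg hx; linarith
  simpa [KN] using this

theorem KN_anti (hE : Exh Ω u) (hφ : ContDiffOn ℝ ∞ φ (U ×ˢ Ω)) {t} (ht : t ∈ U) (hz : z ∈ Dc Ω u c) {c' : ℝ} (hc : c ≤ c') :
    KN Ω u φ z c' t ≤ KN Ω u φ z c t := by
  have := ker_mono (hE.Dc_open c) (hE.W_smooth hφ ht c).continuousOn hz (D' := Dc Ω u c')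
    (fun x hx => ⟨hx.1, hx.2.trans_le hc⟩) (s := 0)
    (W' := fun x => φ (t, x) + kap u c' x) fun x hx => by have := kap_anti hc hx; linarith
  simpa [KN] using this

theorem KN_cmp (hE : Exh Ω u) (hφ : ContDiffOn ℝ ∞ φ (U ×ˢ Ω)) {t t'} (ht : t ∈ U) (ht' : t' ∈ U) (hz : z ∈ Dc Ω u c) {s : ℝ}
    (h : ∀ x ∈ Dc Ω u c, φ (t', x) ≤ φ (t, x) + s) :
    SN Ω u φ z c t' ≤ s + SN Ω u φ z c t := by
  have h1 := ker_mono (hE.Dc_open c) (hE.W_smooth hφ ht c).continuousOn hz (D' := Dc Ω u c) subset_rfl (s := s)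
    (W' := fun x => φ (t', x) + kap u c x) fun x hx => by have := h x hx; linarith
  have h2 : KN Ω u φ z c t' ≤ ENNReal.ofReal (Real.exp s) * KN Ω u φ z c t := h1
  have h3 := ENNReal.toReal_mono (ENNReal.mul_ne_top ENNReal.ofReal_ne_top (KN_lt_top hE hφ ht hz).ne) h2
  rw [ENNReal.toReal_mul, ENNReal.toReal_ofReal (Real.exp_pos _).le] at h3
  have p1 := KN_toReal_pos hE hφ ht hz
  have p2 := KN_toReal_pos hE hφ ht' hz
  have h4 := Real.log_le_log p2 h3
  rwa [Real.log_mul (Real.exp_pos _).ne' p1.ne', Real.log_exp] at h4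

theorem SN_cont (hE : Exh Ω u) (hU : IsOpen U) (hφ : ContDiffOn ℝ ∞ φ (U ×ˢ Ω)) (hz : z ∈ Dc Ω u c) :
    ContinuousOn (SN Ω u φ z c) U := by
  intro t0 ht0
  refine ContinuousAt.continuousWithinAt ?_
  rw [Metric.continuousAt_iff']
  intro ε hε
  have key : ∀ᶠ t in 𝓝 t0, ∀ x ∈ {x ∈ Ω | u x ≤ c}, |φ (t, x) - φ (t0, x)| ≤ ε / 2 := by
    refine (hE.cp c).eventually_forall_of_forall_eventually fun x hx => ?_
    have h1 : ContinuousAt (fun p : (Fin m → ℂ) × (Fin n → ℂ) => φ p) (t0, x) :=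
      hφ.continuousOn.continuousAt ((hU.prod hE.op).mem_nhds ⟨ht0, hx.1⟩)
    have h2 : ContinuousAt (fun p : (Fin m → ℂ) × (Fin n → ℂ) => φ (t0, p.2)) (t0, x) :=
      ContinuousAt.comp (g := φ) (f := fun p : (Fin m → ℂ) × (Fin n → ℂ) => (t0, p.2)) h1 (by fun_prop)
    have h3 := (h1.sub h2).abs
    have h4 : ∀ᶠ p : (Fin m → ℂ) × (Fin n → ℂ) in 𝓝 (t0, x), |φ p - φ (t0, p.2)| < ε / 2 := by
      apply h3.eventually_lt continuousAt_const
      simpa using hε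
    filter_upwards [h4] with p hp using hp.le
  filter_upwards [key, hU.mem_nhds ht0] with t h1 ht
  have a1 := KN_cmp hE hφ ht0 ht hz (s := ε / 2) fun x hx => by
    linarith [(abs_le.1 (h1 x ⟨hx.1, hx.2.le⟩)).2]
  have a2 := KN_cmp hE hφ ht ht0 hz (s := ε / 2) fun x hx => by
    linarith [(abs_le.1 (h1 x ⟨hx.1, hx.2.le⟩)).1]
  rw [Real.dist_eq]
  exact (abs_le.2 ⟨by linarith, by linarith⟩ : _ ≤ ε / 2).trans_lt (by linarith)

end kn
end

noncomputable section
open MeasureTheory Set Filter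
open scoped ENNReal ComplexOrder ContDiff Topology
section tay

theorem taylor_1d {p0 p1 p2 p3 : ℝ → ℝ} {r M : ℝ} (hr : 0 ≤ r)
    (h0 : ∀ s ∈ Icc 0 r, HasDerivAt p0 (p1 s) s) (h1 : ∀ s ∈ Icc 0 r, HasDerivAt p1 (p2 s) s)
    (h2 : ∀ s ∈ Icc 0 r, HasDerivAt p2 (p3 s) s) (hM : ∀ s ∈ Icc 0 r, |p3 s| ≤ M) :
    |p0 r - p0 0 - r * p1 0 - r ^ 2 / 2 * p2 0| ≤ M * r ^ 3 := by
  have M0 : 0 ≤ M := (abs_nonneg _).trans (hM 0 ⟨le_rfl, hr⟩)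
  have a2 : ∀ s ∈ Icc 0 r, |p2 s - p2 0| ≤ M * r := by
    intro s hs
    have := norm_image_sub_le_of_norm_deriv_le_segment' (fun x hx => (h2 x hx).hasDerivWithinAt)
      (fun x hx => hM x ⟨hx.1, hx.2.le⟩) s hs
    refine this.trans ?_
    rw [sub_zero]
    exact mul_le_mul_of_nonneg_left hs.2 M0
  have a1 : ∀ s ∈ Icc 0 r, |p1 s - p1 0 - s * p2 0| ≤ M * r * r := by
    intro s hs
    have := norm_image_sub_le_of_norm_deriv_le_segment' (f := fun s => p1 s - s * p2 0)
      (f' := fun s => p2 s - p2 0) (a := 0) (b := r) (C := M * r)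
      (fun x hx => by
        have := ((h1 x hx).fun_sub ((hasDerivAt_id x).mul_const (p2 0))).hasDerivWithinAt (s := Icc 0 r)
        simpa using this)
      (fun x hx => a2 x ⟨hx.1, hx.2.le⟩) s hs
    have e : p1 s - p1 0 - s * p2 0 = p1 s - s * p2 0 - (p1 0 - 0 * p2 0) := by ring
    rw [e]
    refine this.trans ?_
    rw [sub_zero]
    exact mul_le_mul_of_nonneg_left hs.2 (mul_nonneg M0 hr)
  have := norm_image_sub_le_of_norm_deriv_le_segment' (f := fun s => p0 s - s * p1 0 - s ^ 2 / 2 * p2 0)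
      (f' := fun s => p1 s - p1 0 - s * p2 0) (a := 0) (b := r) (C := M * r * r)
      (fun x hx => by
        have := (((h0 x hx).fun_sub ((hasDerivAt_id' x).mul_const (p1 0))).fun_sub
          ((((hasDerivAt_id' x).fun_pow 2).div_const 2).mul_const (p2 0))).hasDerivWithinAt (s := Icc 0 r)
        convert this using 1
        norm_num)
      (fun x hx => a1 x ⟨hx.1, hx.2.le⟩) r ⟨hr, le_rfl⟩
  have e : p0 r - p0 0 - r * p1 0 - r ^ 2 / 2 * p2 0 =
    p0 r - r * p1 0 - r ^ 2 / 2 * p2 0 - (p0 0 - 0 * p1 0 - 0 ^ 2 / 2 * p2 0) := by ring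
  rw [e]
  refine this.trans (le_of_eq ?_)
  ring

theorem taylor_nd {E : Type*} [NormedAddCommGroup E] [NormedSpace ℂ E] {S K : Set E} (hS : IsOpen S)
    (hK : IsCompact K) (hKS : K ⊆ S) {f : E → ℝ} (hf : ContDiffOn ℝ ∞ f S) (v : E) :
    ∃ M, ∀ p, ∀ r, 0 ≤ r → (∀ s ∈ Icc 0 r, p + s • v ∈ K) →
      |fderiv ℝ f p v| ≤ M ∧ |hess f p v v| ≤ M ∧
      |f (p + r • v) - f p - r * fderiv ℝ f p v - r ^ 2 / 2 * hess f p v v| ≤ M * r ^ 3 := by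
  have s1 := contDiffOn_fderiv_apply hS hf v
  have s2 := contDiffOn_fderiv_apply hS s1 v
  have s3 := contDiffOn_fderiv_apply hS s2 v
  obtain ⟨M1, hM1⟩ := hK.exists_bound_of_continuousOn (s1.continuousOn.mono hKS)
  obtain ⟨M2, hM2⟩ := hK.exists_bound_of_continuousOn (s2.continuousOn.mono hKS)
  obtain ⟨M3, hM3⟩ := hK.exists_bound_of_continuousOn (s3.continuousOn.mono hKS)
  refine ⟨max M1 (max M2 M3), fun p r hr hp => ?_⟩
  have hp0 : p ∈ K := by simpa using hp 0 ⟨le_rfl, hr⟩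
  refine ⟨(hM1 p hp0).trans (le_max_left _ _),
    (hM2 p hp0).trans ((le_max_left _ _).trans (le_max_right _ _)), ?_⟩
  have hd : ∀ {F : E → ℝ}, ContDiffOn ℝ ∞ F S → ∀ s ∈ Icc 0 r,
      HasDerivAt (fun s : ℝ => F (p + s • v)) (fderiv ℝ F (p + s • v) v) s := by
    intro F hF s hs
    have h1 := (diffAt_of_contDiffOn hS (hKS (hp s hs)) hF).hasFDerivAt
    have h2 : HasDerivAt (fun s : ℝ => p + s • v) v s := by
      simpa using ((hasDerivAt_id s).smul_const v).const_add p
    exact h1.comp_hasDerivAt s h2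
  have := taylor_1d hr (hd hf) (hd s1) (hd s2) (fun s hs => hM3 _ (hp s hs))
  simp only [zero_smul, add_zero] at this
  refine this.trans ?_
  gcongr
  exact (le_max_right _ _).trans (le_max_right _ _)

theorem exp_scalar {M r a b G : ℝ} (hM : 1 ≤ M) (hr : 0 ≤ r) (hr1 : 3 * M * r ≤ 1) (ha : |a| ≤ M) (hb : |b| ≤ M)
    (hG : |G - r * a - r ^ 2 / 2 * b| ≤ M * r ^ 3) :
    Real.exp (-G) ≤ 1 - r * a + r ^ 2 / 2 * (a ^ 2 - b) + 31 * M ^ 3 * r ^ 3 := by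
  have hr2 : r ≤ 1 := by nlinarith
  have hr3 : r ^ 3 ≤ r := by nlinarith [mul_nonneg hr hr, mul_nonneg (mul_nonneg hr hr) (sub_nonneg.2 hr2)]
  have hr4 : r ^ 2 ≤ r := by nlinarith
  have ha' : |r * a| ≤ r * M := by rw [abs_mul, abs_of_nonneg hr]; gcongr
  have hb' : |r ^ 2 / 2 * b| ≤ r ^ 2 / 2 * M := by
    rw [abs_mul, abs_of_nonneg (by positivity : (0:ℝ) ≤ r ^ 2 / 2)]; gcongr
  have hG1 : |G - r * a| ≤ M * r ^ 3 + r ^ 2 / 2 * M := by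
    have := abs_add_le (G - r * a - r ^ 2 / 2 * b) (r ^ 2 / 2 * b)
    rw [sub_add_cancel] at this
    linarith
  have hG2 : |G| ≤ 3 * M * r := by
    have := abs_add_le (G - r * a) (r * a)
    rw [sub_add_cancel] at this
    nlinarith
  have hG3 : |G| ≤ 1 := hG2.trans hr1
  have h1 := Real.exp_bound (x := -G) (by rwa [abs_neg]) (n := 3) (by norm_num)
  simp [Finset.sum_range_succ, Nat.factorial] at h1
  have h2 := (abs_le.1 h1).2
  have h3 : |G| ^ 3 ≤ 27 * M ^ 3 * r ^ 3 := by
    calc |G| ^ 3 ≤ (3 * M * r) ^ 3 := by gcongr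
      _ = _ := by ring
  have h4 : G ^ 2 - (r * a) ^ 2 ≤ 6 * M ^ 3 * r ^ 3 := by
    have e : G ^ 2 - (r * a) ^ 2 = (G - r * a) * (G + r * a) := by ring
    rw [e]
    refine (le_abs_self _).trans ?_
    rw [abs_mul]
    have q1 : |G - r * a| ≤ 3 / 2 * M * r ^ 2 := by
      refine hG1.trans ?_
      have : r ^ 3 ≤ r ^ 2 := by nlinarith [mul_nonneg hr hr]
      nlinarith
    have q2 : |G + r * a| ≤ 4 * M * r := by
      refine (abs_add_le _ _).trans ?_
      linarith
    calc _ ≤ (3 / 2 * M * r ^ 2) * (4 * M * r) := by gcongr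
      _ = 6 * (M ^ 2 * r ^ 3) := by ring
      _ ≤ 6 * (M ^ 3 * r ^ 3) := by
        gcongr
        · norm_num
      _ = _ := by ring
  have h5 := (abs_le.1 hG).1
  have h6 : M * r ^ 3 ≤ M ^ 3 * r ^ 3 := by
    gcongr
    nlinarith [mul_nonneg (by linarith : 0 ≤ M) (by nlinarith : 0 ≤ M ^ 2 - 1)]
  have h7 : 0 ≤ |G| ^ 3 := by positivity
  nlinarith

/-- four directions -/
def om : Fin 4 → ℂ := ![1, Complex.I, -1, -Complex.I]

theorem four_point (f g : ℂ) {r a1 ai b1 bi E : ℝ} {e : Fin 4 → ℝ}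
    (e0 : e 0 ≤ 1 - r * a1 + r ^ 2 / 2 * (a1 ^ 2 - b1) + E)
    (e1 : e 1 ≤ 1 - r * ai + r ^ 2 / 2 * (ai ^ 2 - bi) + E)
    (e2 : e 2 ≤ 1 + r * a1 + r ^ 2 / 2 * (a1 ^ 2 - b1) + E)
    (e3 : e 3 ≤ 1 + r * ai + r ^ 2 / 2 * (ai ^ 2 - bi) + E) :
    ∑ k, ‖f + r * om k * g‖ ^ 2 * e k ≤ 4 * (‖f‖ ^ 2 + r ^ 2 *
      (‖(1 / 2 : ℂ) * (a1 - Complex.I * ai) * f - g‖ ^ 2 - (1 / 4) * (b1 + bi) * ‖f‖ ^ 2)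
      + r ^ 4 * (1 / 4) * (a1 ^ 2 + ai ^ 2 - (b1 + bi)) * ‖g‖ ^ 2 + E * (‖f‖ ^ 2 + r ^ 2 * ‖g‖ ^ 2)) := by
  rw [Fin.sum_univ_four]
  have k0 := mul_le_mul_of_nonneg_left e0 (sq_nonneg ‖f + r * om 0 * g‖)
  have k1 := mul_le_mul_of_nonneg_left e1 (sq_nonneg ‖f + r * om 1 * g‖)
  have k2 := mul_le_mul_of_nonneg_left e2 (sq_nonneg ‖f + r * om 2 * g‖)
  have k3 := mul_le_mul_of_nonneg_left e3 (sq_nonneg ‖f + r * om 3 * g‖)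
  refine (add_le_add (add_le_add (add_le_add k0 k1) k2) k3).trans (le_of_eq ?_)
  simp only [← Complex.normSq_eq_norm_sq, Complex.normSq_apply]
  simp [om]
  ring

end tay
end

noncomputable section
open MeasureTheory Set Filter
open scoped ENNReal ComplexOrder ContDiff Topology
section nomax

theorem hess_ofReal {E : Type*} [NormedAddCommGroup E] [NormedSpace ℂ E] {f : E → ℝ} {S : Set E} {x : E}
    (hS : IsOpen S) (hx : x ∈ S) (hf : ContDiffOn ℝ ∞ f S) (v w : E) :
    hess (fun y => (f y : ℂ)) x v w = ((hess f x v w : ℝ) : ℂ) := by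
  simp only [hess]
  have e : (fun y => fderiv ℝ (fun y => (f y : ℂ)) y w) =ᶠ[𝓝 x] fun y => ((fderiv ℝ f y w : ℝ) : ℂ) := by
    filter_upwards [hS.mem_nhds hx] with y hy
    exact fderiv_ofReal' w (diffAt_of_contDiffOn hS hy hf)
  rw [e.fderiv_eq, fderiv_ofReal' _ (diffAt_of_contDiffOn hS hx (contDiffOn_fderiv_apply hS hf w))]

theorem Levi_hess {E : Type*} [NormedAddCommGroup E] [NormedSpace ℂ E] {f : E → ℝ} {S : Set E} {x : E}
    (hS : IsOpen S) (hx : x ∈ S) (hf : ContDiffOn ℝ ∞ f S) (v : E) :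
    (wder (fun y => wderBar (fun q => (f q : ℂ)) v y) v x).re =
      1 / 4 * (hess f x v v + hess f x (Complex.I • v) (Complex.I • v)) := by
  rw [wder_wderBar_eq_hess hS hx (contDiffOn_ofReal hf), hess_ofReal hS hx hf, hess_ofReal hS hx hf,
    hess_ofReal hS hx hf, hess_ofReal hS hx hf]
  rw [show ((1:ℂ)/4) = ((1/4 : ℝ) : ℂ) by norm_num, Complex.re_ofReal_mul]
  simp

theorem hess_neg_neg {E : Type*} [NormedAddCommGroup E] [NormedSpace ℂ E] (f : E → ℝ) (x v : E) :
    hess f x (-v) (-v) = hess f x v v := by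
  simp [hess, fderiv_fun_neg]

theorem norm_om (k : Fin 4) : ‖om k‖ = 1 := by
  fin_cases k <;> simp [om]

variable {n m : ℕ} {Ω : Set (Fin n → ℂ)} {u : (Fin n → ℂ) → ℝ}
variable {U : Set (Fin m → ℂ)} {φ : (Fin m → ℂ) × (Fin n → ℂ) → ℝ} {z : Fin n → ℂ} {c : ℝ} {η : (Fin n → ℂ) → ℝ} {δ : ℝ}

theorem phi_expand (hE : Exh Ω u) (hU : IsOpen U) (hφ : ContDiffOn ℝ ∞ φ (U ×ˢ Ω)) {t0 : Fin m → ℂ} (ht : t0 ∈ U)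
    (w : Fin m → ℂ) (c : ℝ) : ∃ M r0 : ℝ, 0 < r0 ∧ ∀ k : Fin 4, ∀ r ∈ Icc 0 r0, t0 + ((r : ℂ) * om k) • w ∈ U ∧
      ∀ x ∈ Dc Ω u c,
      |fderiv ℝ φ (t0, x) (om k • w, 0)| ≤ M ∧ |hess φ (t0, x) (om k • w, 0) (om k • w, 0)| ≤ M ∧
      |φ (t0 + ((r : ℂ) * om k) • w, x) - φ (t0, x) - r * fderiv ℝ φ (t0, x) (om k • w, 0)
        - r ^ 2 / 2 * hess φ (t0, x) (om k • w, 0) (om k • w, 0)| ≤ M * r ^ 3 := by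
  have hc : Continuous fun σ : ℂ => t0 + σ • w := by fun_prop
  have hU' : (fun σ : ℂ => t0 + σ • w) ⁻¹' U ∈ 𝓝 (0 : ℂ) := hc.continuousAt.preimage_mem_nhds (hU.mem_nhds (by simpa using ht))
  obtain ⟨r0, hr0, hb⟩ := Metric.nhds_basis_closedBall.mem_iff.1 hU'
  set K : Set ((Fin m → ℂ) × (Fin n → ℂ)) :=
    (fun p : ℂ × (Fin n → ℂ) => (t0 + p.1 • w, p.2)) '' (Metric.closedBall (0:ℂ) r0 ×ˢ {x ∈ Ω | u x ≤ c}) with hK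
  have hKc : IsCompact K := ((isCompact_closedBall _ _).prod (hE.cp c)).image (by fun_prop)
  have hKS : K ⊆ U ×ˢ Ω := by
    rintro _ ⟨⟨σ, x⟩, ⟨h1, h2⟩, rfl⟩
    exact ⟨hb h1, h2.1⟩
  have hmem : ∀ k : Fin 4, ∀ r ∈ Icc 0 r0, (r : ℂ) * om k ∈ Metric.closedBall (0:ℂ) r0 := by
    intro k r hr
    rw [mem_closedBall_zero_iff, norm_mul, norm_om, mul_one, Complex.norm_real, Real.norm_eq_abs, abs_of_nonneg hr.1]
    exact hr.2
  choose M hM using fun k : Fin 4 => taylor_nd (hU.prod hE.op) hKc hKS hφ (om k • w, (0 : Fin n → ℂ))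
  refine ⟨∑ k, |M k|, r0, hr0, fun k r hr => ⟨hb (hmem k r hr), fun x hxx => ?_⟩⟩
  have hle : M k ≤ ∑ k, |M k| :=
    (le_abs_self _).trans (Finset.single_le_sum (f := fun k => |M k|) (fun _ _ => abs_nonneg _) (Finset.mem_univ k))
  have hs : ∀ s : ℝ, ((t0, x) : (Fin m → ℂ) × (Fin n → ℂ)) + s • (om k • w, (0 : Fin n → ℂ)) =
      (t0 + ((s : ℂ) * om k) • w, x) := by
    intro s
    ext i
    · simp [mul_assoc]
    · simp
  obtain ⟨h1, h2, h3⟩ := hM k (t0, x) r hr.1 fun s hs' => by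
    rw [hs]
    exact ⟨((s : ℂ) * om k, x), ⟨hmem k s ⟨hs'.1, hs'.2.trans hr.2⟩, hxx.1, hxx.2.le⟩, rfl⟩
  rw [hs] at h3
  refine ⟨h1.trans hle, h2.trans hle, h3.trans ?_⟩
  have := pow_nonneg hr.1 3
  gcongr

theorem h_expand {h : ℂ → ℝ} (hh : ContDiff ℝ ∞ h) : ∃ M : ℝ, ∀ k : Fin 4, ∀ r ∈ Icc (0:ℝ) 1, 
      |fderiv ℝ h 0 (om k)| ≤ M ∧ |hess h 0 (om k) (om k)| ≤ M ∧
      |h ((r : ℂ) * om k) - h 0 - r * fderiv ℝ h 0 (om k)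
        - r ^ 2 / 2 * hess h 0 (om k) (om k)| ≤ M * r ^ 3 := by
  choose M hM using fun k : Fin 4 => taylor_nd isOpen_univ (isCompact_closedBall (0:ℂ) 1) (subset_univ _) hh.contDiffOn (om k)
  refine ⟨∑ k, |M k|, fun k r hr => ?_⟩
  have hle : M k ≤ ∑ k, |M k| :=
    (le_abs_self _).trans (Finset.single_le_sum (f := fun k => |M k|) (fun _ _ => abs_nonneg _) (Finset.mem_univ k))
  obtain ⟨h1, h2, h3⟩ := hM k 0 r hr.1 fun s hs' => by
    rw [mem_closedBall_zero_iff, zero_add, norm_smul, norm_om, mul_one, Real.norm_eq_abs, abs_of_nonneg hs'.1]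
    exact hs'.2.trans hr.2
  rw [zero_add, Complex.real_smul] at h3
  refine ⟨h1.trans hle, h2.trans hle, h3.trans ?_⟩
  have := pow_nonneg hr.1 3
  gcongr

end nomax
end

noncomputable section
open MeasureTheory Set Filter
open scoped ENNReal ComplexOrder ContDiff Topology
section nomax

theorem pw_avg (f g : ℂ) {M r ε Ctx : ℝ} {a b G : Fin 4 → ℝ} (hM : 1 ≤ M) (hr : 0 ≤ r) (hr1 : 3 * M * r ≤ 1)
    (ha : ∀ k, |a k| ≤ M) (hb : ∀ k, |b k| ≤ M)
    (hG : ∀ k, |G k - r * a k - r ^ 2 / 2 * b k| ≤ M * r ^ 3)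
    (a2 : a 2 = -a 0) (a3 : a 3 = -a 1) (b2 : b 2 = b 0) (b3 : b 3 = b 1)
    (hC : Ctx + ε ≤ 1 / 4 * (b 0 + b 1)) :
    ∑ k, ‖f + r * om k * g‖ ^ 2 * Real.exp (-(G k)) ≤ 4 * (‖f‖ ^ 2 + r ^ 2 *
      (‖(1 / 2 : ℂ) * (a 0 - Complex.I * a 1) * f - g‖ ^ 2 - (Ctx + ε) * ‖f‖ ^ 2)
      + 33 * M ^ 3 * r ^ 3 * (‖f‖ ^ 2 + ‖g‖ ^ 2)) := by
  have e0 := exp_scalar hM hr hr1 (ha 0) (hb 0) (hG 0)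
  have e1 := exp_scalar hM hr hr1 (ha 1) (hb 1) (hG 1)
  have e2 := exp_scalar hM hr hr1 (ha 2) (hb 2) (hG 2)
  have e3 := exp_scalar hM hr hr1 (ha 3) (hb 3) (hG 3)
  rw [a2, b2] at e2
  rw [a3, b3] at e3
  refine (four_point f g (e := fun k => Real.exp (-(G k))) e0 e1 (e2.trans (le_of_eq (by ring)))
    (e3.trans (le_of_eq (by ring)))).trans ?_
  have hr2 : r ≤ 1 := by nlinarith
  have h1 : (1 / 4 : ℝ) * (a 0 ^ 2 + a 1 ^ 2 - (b 0 + b 1)) ≤ M ^ 3 := by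
    have := sq_le_sq' (abs_le.1 (ha 0)).1 (abs_le.1 (ha 0)).2
    have := sq_le_sq' (abs_le.1 (ha 1)).1 (abs_le.1 (ha 1)).2
    have := (abs_le.1 (hb 0)).1
    have := (abs_le.1 (hb 1)).1
    have : M ^ 2 ≤ M ^ 3 := by gcongr <;> norm_num
    nlinarith
  have h2 : r ^ 4 * (1 / 4) * (a 0 ^ 2 + a 1 ^ 2 - (b 0 + b 1)) * ‖g‖ ^ 2 ≤ M ^ 3 * r ^ 3 * ‖g‖ ^ 2 := by
    have hh : r ^ 4 ≤ r ^ 3 := pow_le_pow_of_le_one hr hr2 (by norm_num)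
    calc _ = ‖g‖ ^ 2 * (r ^ 4 * ((1 / 4) * (a 0 ^ 2 + a 1 ^ 2 - (b 0 + b 1)))) := by ring
      _ ≤ ‖g‖ ^ 2 * (r ^ 3 * M ^ 3) := by
        gcongr ?_ * ?_
        calc _ ≤ r ^ 4 * M ^ 3 := by gcongr
          _ ≤ _ := by gcongr
      _ = _ := by ring
  have h3 : 31 * M ^ 3 * r ^ 3 * (‖f‖ ^ 2 + r ^ 2 * ‖g‖ ^ 2) ≤ 31 * M ^ 3 * r ^ 3 * (‖f‖ ^ 2 + 1 * ‖g‖ ^ 2) := by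
    gcongr
    nlinarith
  have h4 : r ^ 2 * (Ctx + ε) * ‖f‖ ^ 2 ≤ r ^ 2 * (1 / 4 * (b 0 + b 1)) * ‖f‖ ^ 2 := by gcongr
  have h5 : 0 ≤ M ^ 3 * r ^ 3 * ‖f‖ ^ 2 := by positivity
  have h6 : 0 ≤ M ^ 3 * r ^ 3 * ‖g‖ ^ 2 := by positivity
  nlinarith

variable {n m : ℕ} {Ω : Set (Fin n → ℂ)} {u : (Fin n → ℂ) → ℝ}
variable {U : Set (Fin m → ℂ)} {φ : (Fin m → ℂ) × (Fin n → ℂ) → ℝ} {z : Fin n → ℂ} {c : ℝ} {η : (Fin n → ℂ) → ℝ} {δ : ℝ}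

theorem int_avg {D : Set (Fin n → ℂ)} (hD : IsOpen D) {W C : (Fin n → ℂ) → ℝ} {A f g : (Fin n → ℂ) → ℂ} {M r ε : ℝ}
    (hM : 1 ≤ M) (hr : 0 ≤ r) (hr1 : 3 * M * r ≤ 1) (hr2 : 330 * M ^ 5 * r ≤ ε) (hC : ContinuousOn C D)
    (hA : ∀ x ∈ D, ‖A x‖ ≤ M) (hCM : ∀ x ∈ D, |C x| ≤ M) (hAm : ContinuousOn A D)
    (hf : MemLp (fun x => f x * hx W x) 2 (volume.restrict D))
    (hg : MemLp (fun x => g x * hx W x) 2 (volume.restrict D))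
    (hR : ∫ x in D, ‖(A x * f x - g x) * hx W x‖ ^ 2 ≤ ∫ x in D, C x * ‖f x * hx W x‖ ^ 2) :
    Integrable (fun x => 4 * (‖f x * hx W x‖ ^ 2 + r ^ 2 * (‖(A x * f x - g x) * hx W x‖ ^ 2
      - (C x + ε) * ‖f x * hx W x‖ ^ 2) + 33 * M ^ 3 * r ^ 3 * (‖f x * hx W x‖ ^ 2 + ‖g x * hx W x‖ ^ 2))) (volume.restrict D) ∧
    ∫ x in D, 4 * (‖f x * hx W x‖ ^ 2 + r ^ 2 * (‖(A x * f x - g x) * hx W x‖ ^ 2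
      - (C x + ε) * ‖f x * hx W x‖ ^ 2) + 33 * M ^ 3 * r ^ 3 * (‖f x * hx W x‖ ^ 2 + ‖g x * hx W x‖ ^ 2)) ≤
      4 * (1 - ε / 2 * r ^ 2) * ∫ x in D, ‖f x * hx W x‖ ^ 2 := by
  have hAf : MemLp (fun x => A x * (f x * hx W x)) 2 (volume.restrict D) :=
    memLp_bdd hD hAm hA hf
  have hRm : MemLp (fun x => (A x * f x - g x) * hx W x) 2 (volume.restrict D) := by
    have := hAf.sub hg
    refine (memLp_congr_ae (Eventually.of_forall fun x => ?_)).1 this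
    simp only [Pi.sub_apply]; ring
  have iP := hf.integrable_norm_pow (p := 2) (by simp)
  have iQ := hg.integrable_norm_pow (p := 2) (by simp)
  have iR := hRm.integrable_norm_pow (p := 2) (by simp)
  have iAf := hAf.integrable_norm_pow (p := 2) (by simp)
  have iC : Integrable (fun x => C x * ‖f x * hx W x‖ ^ 2) (volume.restrict D) := by
    refine Integrable.bdd_mul (c := M) iP (hC.aestronglyMeasurable hD.measurableSet) ?_
    filter_upwards [ae_restrict_mem hD.measurableSet] with x hxx
    exact hCM x hxx
  set P := fun x => ‖f x * hx W x‖ ^ 2 with hP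
  set Q := fun x => ‖g x * hx W x‖ ^ 2 with hQ
  set R := fun x => ‖(A x * f x - g x) * hx W x‖ ^ 2 with hRR
  have iS : Integrable (fun x => (4 * (1 - ε * r ^ 2 + 33 * M ^ 3 * r ^ 3)) * P x + (4 * r ^ 2) * R x - (4 * r ^ 2) * (C x * P x)
      + (4 * (33 * M ^ 3 * r ^ 3)) * Q x) (volume.restrict D) :=
    (((iP.const_mul _).add (iR.const_mul _)).sub (iC.const_mul _)).add (iQ.const_mul _)
  have e : (fun x => 4 * (P x + r ^ 2 * (R x - (C x + ε) * P x) + 33 * M ^ 3 * r ^ 3 * (P x + Q x))) =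
      fun x => (4 * (1 - ε * r ^ 2 + 33 * M ^ 3 * r ^ 3)) * P x + (4 * r ^ 2) * R x - (4 * r ^ 2) * (C x * P x)
      + (4 * (33 * M ^ 3 * r ^ 3)) * Q x := by
    ext x; ring
  have iS1 : Integrable (fun x => (4 * (1 - ε * r ^ 2 + 33 * M ^ 3 * r ^ 3)) * P x + (4 * r ^ 2) * R x) (volume.restrict D) :=
    (iP.const_mul _).add (iR.const_mul _)
  have iS2 : Integrable (fun x => (4 * (1 - ε * r ^ 2 + 33 * M ^ 3 * r ^ 3)) * P x + (4 * r ^ 2) * R x - (4 * r ^ 2) * (C x * P x))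
      (volume.restrict D) := iS1.sub (iC.const_mul _)
  have hgoal : Integrable (fun x => 4 * (P x + r ^ 2 * (R x - (C x + ε) * P x) + 33 * M ^ 3 * r ^ 3 * (P x + Q x))) (volume.restrict D) := by
    rw [e]; exact iS
  refine ⟨hgoal, ?_⟩
  have ei : ∫ x in D, 4 * (P x + r ^ 2 * (R x - (C x + ε) * P x) + 33 * M ^ 3 * r ^ 3 * (P x + Q x)) =
      (4 * (1 - ε * r ^ 2 + 33 * M ^ 3 * r ^ 3)) * (∫ x in D, P x) + (4 * r ^ 2) * (∫ x in D, R x) - (4 * r ^ 2) * (∫ x in D, C x * P x)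
      + (4 * (33 * M ^ 3 * r ^ 3)) * ∫ x in D, Q x := by
    rw [e, integral_add iS2 (iQ.const_mul _), integral_sub iS1 (iC.const_mul _), integral_add (iP.const_mul _) (iR.const_mul _),
      integral_const_mul, integral_const_mul, integral_const_mul, integral_const_mul]
  have hP0 : 0 ≤ ∫ x in D, P x := integral_nonneg fun x => by positivity
  have hCP : ∫ x in D, C x * P x ≤ M * ∫ x in D, P x := by
    rw [← integral_const_mul]
    refine setIntegral_mono_on iC (iP.const_mul _) hD.measurableSet fun x hxx => ?_
    have := (abs_le.1 (hCM x hxx)).2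
    have h0 : 0 ≤ P x := by positivity
    exact mul_le_mul_of_nonneg_right this h0
  have hQP : ∫ x in D, Q x ≤ 4 * M ^ 2 * ∫ x in D, P x := by
    have h1 : ∫ x in D, Q x ≤ ∫ x in D, (2 * R x + 2 * M ^ 2 * P x) := by
      refine setIntegral_mono_on iQ ((iR.const_mul _).add (iP.const_mul _)) hD.measurableSet fun x hxx => ?_
      have h2 : g x * hx W x = A x * (f x * hx W x) - (A x * f x - g x) * hx W x := by ring
      have h3 : ‖g x * hx W x‖ ≤ ‖A x‖ * ‖f x * hx W x‖ + ‖(A x * f x - g x) * hx W x‖ := by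
        conv_lhs => rw [h2]
        refine (norm_sub_le _ _).trans ?_
        rw [norm_mul (A x)]
      have h4 : ‖A x‖ * ‖f x * hx W x‖ ≤ M * ‖f x * hx W x‖ := by gcongr; exact hA x hxx
      have h5 : ‖g x * hx W x‖ ≤ M * ‖f x * hx W x‖ + ‖(A x * f x - g x) * hx W x‖ := by linarith
      have h6 : Q x ≤ (M * ‖f x * hx W x‖ + ‖(A x * f x - g x) * hx W x‖) ^ 2 := by
        simp only [hQ]; gcongr
      refine h6.trans ?_
      simp only [hRR, hP]
      nlinarith [sq_nonneg (M * ‖f x * hx W x‖ - ‖(A x * f x - g x) * hx W x‖)]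
    rw [integral_add (iR.const_mul _) (iP.const_mul _), integral_const_mul, integral_const_mul] at h1
    have : M ≤ M ^ 2 := by nlinarith
    nlinarith
  rw [ei]
  have k1 : (4 * r ^ 2) * (∫ x in D, R x) ≤ (4 * r ^ 2) * (∫ x in D, C x * P x) := by gcongr
  have k2 : (4 * (33 * M ^ 3 * r ^ 3)) * ∫ x in D, Q x ≤ (4 * (33 * M ^ 3 * r ^ 3)) * (4 * M ^ 2 * ∫ x in D, P x) := by
    gcongr
  have k3 : 33 * M ^ 3 * r ^ 3 * (1 + 4 * M ^ 2) ≤ ε / 2 * r ^ 2 := by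
    have : 1 + 4 * M ^ 2 ≤ 5 * M ^ 2 := by nlinarith
    calc _ ≤ 33 * M ^ 3 * r ^ 3 * (5 * M ^ 2) := by gcongr
      _ = (330 * M ^ 5 * r) / 2 * r ^ 2 := by ring
      _ ≤ _ := by gcongr
  have k4 := mul_le_mul_of_nonneg_right k3 hP0
  nlinarith

end nomax
end

noncomputable section
open MeasureTheory Set Filter
open scoped ENNReal ComplexOrder ContDiff Topology
section nomax
variable {n m : ℕ} {Ω : Set (Fin n → ℂ)} {u : (Fin n → ℂ) → ℝ}
variable {U : Set (Fin m → ℂ)} {φ : (Fin m → ℂ) × (Fin n → ℂ) → ℝ} {z : Fin n → ℂ} {c : ℝ} {η : (Fin n → ℂ) → ℝ} {δ : ℝ}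

theorem no_max (hE : Exh Ω u) (hU : IsOpen U) (hφ : ContDiffOn ℝ ∞ φ (U ×ˢ Ω)) (hη : ContDiffOn ℝ ∞ η Ω)
    (hδ : 0 < δ) (hXi : XiNonneg U Ω φ η δ) {t0 : Fin m → ℂ} (ht : t0 ∈ U) (w : Fin m → ℂ) (hz : z ∈ Dc Ω u c)
    {h : ℂ → ℝ} (hh : ContDiff ℝ ∞ h) {ε : ℝ} (hε : 0 < ε)
    (hL : hess h 0 1 1 + hess h 0 Complex.I Complex.I ≤ -(4 * ε))
    (hmax : ∀ᶠ σ : ℂ in 𝓝 0, SN Ω u φ z c (t0 + σ • w) - h σ ≤ SN Ω u φ z c t0 - h 0) : False := by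
  obtain ⟨M1, r1, hr1, hX1⟩ := phi_expand hE hU hφ ht w c
  obtain ⟨M2, hX2⟩ := h_expand hh
  obtain ⟨r2, hr2, hX3⟩ := Metric.eventually_nhds_iff_ball.1 hmax
  set M := |M1| + |M2| + 1 with hMdef
  have hM : 1 ≤ M := by have := abs_nonneg M1; have := abs_nonneg M2; linarith
  have hM0 : 0 < M := by linarith
  set r := min (min r1 (r2 / 2)) (min (min 1 (1 / (3 * M))) (ε / (330 * M ^ 5))) with hrdef
  have hr : 0 < r := by
    have : 0 < ε / (330 * M ^ 5) := by positivity
    have : 0 < 1 / (3 * M) := by positivity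
    simp only [hrdef, lt_min_iff]
    refine ⟨⟨hr1, by linarith⟩, ⟨one_pos, this⟩, by assumption⟩
  have hrr1 : r ≤ r1 := (min_le_left _ _).trans (min_le_left _ _)
  have hrr2 : r ≤ r2 / 2 := (min_le_left _ _).trans (min_le_right _ _)
  have hrr3 : r ≤ 1 := (min_le_right _ _).trans ((min_le_left _ _).trans (min_le_left _ _))
  have hrr4 : r ≤ 1 / (3 * M) := (min_le_right _ _).trans ((min_le_left _ _).trans (min_le_right _ _))
  have hrr5 : r ≤ ε / (330 * M ^ 5) := (min_le_right _ _).trans (min_le_right _ _)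
  have hr3M : 3 * M * r ≤ 1 := by
    rw [le_div_iff₀ (by positivity)] at hrr4; linarith
  have hr5M : 330 * M ^ 5 * r ≤ ε := by
    rw [le_div_iff₀ (by positivity)] at hrr5; linarith
  clear_value r
  have hD := hE.Dc_open c
  have hS := hU.prod hE.op
  set D := Dc Ω u c with hDd
  have hsub : D ⊆ Ω := Dc_sub c
  set W : (Fin n → ℂ) → ℝ := fun x => φ (t0, x) + kap u c x with hW
  set a : (Fin n → ℂ) → Fin 4 → ℝ := fun x k => fderiv ℝ φ (t0, x) (om k • w, 0) - fderiv ℝ h 0 (om k) with ha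
  set b : (Fin n → ℂ) → Fin 4 → ℝ := fun x k => hess φ (t0, x) (om k • w, 0) (om k • w, 0) - hess h 0 (om k) (om k) with hb
  set G : (Fin n → ℂ) → Fin 4 → ℝ := fun x k => φ (t0 + ((r : ℂ) * om k) • w, x) - φ (t0, x) - (h (r * om k) - h 0) with hG
  set α : ℂ := (1 / 2 : ℂ) * ((fderiv ℝ h 0 1 : ℝ) - Complex.I * (fderiv ℝ h 0 Complex.I : ℝ)) with hα
  set A : (Fin n → ℂ) → ℂ := fun x => At φ w t0 x - α with hAdef
  have am : ∀ x ∈ D, ∀ k, |a x k| ≤ M := fun x hx k => by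
    have h1 := ((hX1 k r ⟨hr.le, hrr1⟩).2 x hx).1
    have h2 := (hX2 k r ⟨hr.le, hrr3⟩).1
    refine (abs_sub _ _).trans ?_
    linarith [le_abs_self M1, le_abs_self M2]
  have bm : ∀ x ∈ D, ∀ k, |b x k| ≤ M := fun x hx k => by
    have h1 := ((hX1 k r ⟨hr.le, hrr1⟩).2 x hx).2.1
    have h2 := (hX2 k r ⟨hr.le, hrr3⟩).2.1
    refine (abs_sub _ _).trans ?_
    linarith [le_abs_self M1, le_abs_self M2]
  have hGm : ∀ x ∈ D, ∀ k, |G x k - r * a x k - r ^ 2 / 2 * b x k| ≤ M * r ^ 3 := fun x hx k => by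
    have h1 := ((hX1 k r ⟨hr.le, hrr1⟩).2 x hx).2.2
    have h2 := (hX2 k r ⟨hr.le, hrr3⟩).2.2
    have e : G x k - r * a x k - r ^ 2 / 2 * b x k =
      (φ (t0 + ((r : ℂ) * om k) • w, x) - φ (t0, x) - r * fderiv ℝ φ (t0, x) (om k • w, 0)
        - r ^ 2 / 2 * hess φ (t0, x) (om k • w, 0) (om k • w, 0)) - (h ((r : ℂ) * om k) - h 0 - r * fderiv ℝ h 0 (om k)
        - r ^ 2 / 2 * hess h 0 (om k) (om k)) := by simp only [ha, hb, hG]; ring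
    rw [e]
    refine (abs_sub _ _).trans ?_
    have h3 : 0 ≤ r ^ 3 := by positivity
    have h4 : M1 * r ^ 3 ≤ |M1| * r ^ 3 := by gcongr; exact le_abs_self _
    have h5 : M2 * r ^ 3 ≤ |M2| * r ^ 3 := by gcongr; exact le_abs_self _
    rw [hMdef]
    linarith
  have om0 : om 0 = 1 := rfl
  have om1 : om 1 = Complex.I := rfl
  have om2 : om 2 = -1 := rfl
  have om3 : om 3 = -Complex.I := rfl
  have ng : ∀ v : Fin m → ℂ, ((-v, 0) : (Fin m → ℂ) × (Fin n → ℂ)) = -(v, 0) := fun v => by simp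
  have a2 : ∀ x, a x 2 = -a x 0 := fun x => by
    simp only [ha, om0, om2, neg_smul, ng, map_neg]; ring
  have a3 : ∀ x, a x 3 = -a x 1 := fun x => by
    simp only [ha, om1, om3, neg_smul, ng, map_neg]; ring
  have b2 : ∀ x, b x 2 = b x 0 := fun x => by
    simp only [hb, om0, om2, neg_smul, ng, hess_neg_neg]
  have b3 : ∀ x, b x 3 = b x 1 := fun x => by
    simp only [hb, om1, om3, neg_smul, ng, hess_neg_neg]
  have Isw : (Complex.I • ((w, 0) : (Fin m → ℂ) × (Fin n → ℂ))) = (Complex.I • w, 0) := by simp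
  have hAe : ∀ x ∈ D, A x = (1 / 2 : ℂ) * (a x 0 - Complex.I * a x 1) := fun x hx => by
    have hd : DifferentiableAt ℝ φ (t0, x) := diffAt_of_contDiffOn hS ⟨ht, hsub hx⟩ hφ
    simp only [hAdef, At, ha, om0, om1]
    rw [wder_ofReal_eq _ hd, Isw, hα, one_smul]
    push_cast
    ring
  have hCe : ∀ x ∈ D, Ct φ w t0 x = 1 / 4 * (hess φ (t0, x) (om 0 • w, 0) (om 0 • w, 0) + hess φ (t0, x) (om 1 • w, 0) (om 1 • w, 0)) := by
    intro x hx
    unfold Ct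
    rw [Levi_hess hS (⟨ht, hsub hx⟩ : (t0, x) ∈ U ×ˢ Ω) hφ, Isw, om0, om1, one_smul]
  have hCx : ∀ x ∈ D, Ct φ w t0 x + ε ≤ 1 / 4 * (b x 0 + b x 1) := fun x hx => by
    rw [hCe x hx]
    simp only [hb, om0, om1] at hL ⊢
    linarith
  have hAM : ∀ x ∈ D, ‖A x‖ ≤ M := fun x hx => by
    rw [hAe x hx, norm_mul]
    have h1 := norm_sub_le ((a x 0 : ℝ) : ℂ) (Complex.I * (a x 1 : ℝ))
    rw [norm_mul, Complex.norm_I, one_mul, Complex.norm_real, Complex.norm_real, Real.norm_eq_abs, Real.norm_eq_abs] at h1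
    have h2 := am x hx 0
    have h3 := am x hx 1
    have h4 : ‖(1 / 2 : ℂ)‖ = 1 / 2 := by norm_num
    rw [h4]
    linarith
  have hCM : ∀ x ∈ D, |Ct φ w t0 x| ≤ M := fun x hx => by
    have h0 := ((hX1 0 r ⟨hr.le, hrr1⟩).2 x hx).2.1
    have h1 := ((hX1 1 r ⟨hr.le, hrr1⟩).2 x hx).2.1
    rw [hCe x hx, abs_mul]
    have h2 := abs_add_le (hess φ (t0, x) (om 0 • w, 0) (om 0 • w, 0)) (hess φ (t0, x) (om 1 • w, 0) (om 1 • w, 0))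
    have h3 : |(1 / 4 : ℝ)| = 1 / 4 := by norm_num
    rw [h3]
    linarith [le_abs_self M1, abs_nonneg M2, abs_nonneg M1]
  have hAc : ContinuousOn A D := ((At_smooth hU hE.op hφ ht w).continuousOn.mono hsub).sub continuousOn_const
  have hCc : ContinuousOn (Ct φ w t0) D := (Ct_cont hU hE.op hφ ht w).mono hsub
  have htk : ∀ k, t0 + ((r : ℂ) * om k) • w ∈ U := fun k => (hX1 k r ⟨hr.le, hrr1⟩).1
  have hWc : ContinuousOn W D := (hE.W_smooth hφ ht c).continuousOn
  have hK0 := KN_ne_zero hE hφ ht hz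
  have hKt := (KN_lt_top hE hφ ht hz).ne
  -- kernel comparison
  have hKk : ∀ k, KN Ω u φ z c (t0 + ((r : ℂ) * om k) • w) ≤
      ENNReal.ofReal (Real.exp (h (r * om k) - h 0)) * KN Ω u φ z c t0 := by
    intro k
    have hmem : (r : ℂ) * om k ∈ Metric.ball (0:ℂ) r2 := by
      rw [mem_ball_zero_iff, norm_mul, norm_om, mul_one, Complex.norm_real, Real.norm_eq_abs, abs_of_pos hr]
      linarith
    have h1 := hX3 _ hmem
    have p1 := KN_toReal_pos hE hφ (htk k) hz
    have p0 := KN_toReal_pos hE hφ ht hz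
    have h2 : Real.log (KN Ω u φ z c (t0 + ((r : ℂ) * om k) • w)).toReal ≤
        (h (r * om k) - h 0) + Real.log (KN Ω u φ z c t0).toReal := by
      unfold SN at h1; linarith
    have h3 := Real.exp_le_exp.2 h2
    rw [Real.exp_add, Real.exp_log p1, Real.exp_log p0] at h3
    rw [← ENNReal.ofReal_toReal (KN_lt_top hE hφ (htk k) hz).ne]
    conv_rhs => rw [← ENNReal.ofReal_toReal hKt]
    rw [← ENNReal.ofReal_mul (Real.exp_pos _).le]
    exact ENNReal.ofReal_le_ofReal h3
  -- main estimate
  have main : KN Ω u φ z c t0 ≤ KN Ω u φ z c t0 * ENNReal.ofReal (1 - ε / 2 * r ^ 2) := by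
    refine ker_le fun f hf hf0 hft => ?_
    have hfm := memLp_of_bns hD hWc hf hft
    obtain ⟨g, hg, hgm, hR⟩ := core_apply hE hU hφ hη hδ hXi ht w α c hf hfm
    obtain ⟨hintg, hle⟩ := int_avg hD hM hr.le hr3M hr5M hCc hAM hCM hAc hfm hgm hR
    have hFd : ∀ k, DifferentiableOn ℂ (fun x => f x + r * om k * g x) D := fun k =>
      hf.add (hg.const_mul _)
    have hWkc : ∀ k, ContinuousOn (fun x => φ (t0 + ((r : ℂ) * om k) • w, x) + kap u c x) D := fun k =>
      (hE.W_smooth hφ (htk k) c).continuousOn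
    have hsum : ∑ k, ENNReal.ofReal (Real.exp (h (r * om k) - h 0)) *
        bergNormSq D (fun x => φ (t0 + ((r : ℂ) * om k) • w, x) + kap u c x) volume (fun x => f x + r * om k * g x) ≤
        ENNReal.ofReal (4 * (1 - ε / 2 * r ^ 2) * ∫ x in D, ‖f x * hx W x‖ ^ 2) := by
      have hpt : ∀ x ∈ D, ∑ k, Real.exp (h (r * om k) - h 0) * (‖f x + r * om k * g x‖ ^ 2 *
          Real.exp (-(φ (t0 + ((r : ℂ) * om k) • w, x) + kap u c x))) ≤
          4 * (‖f x * hx W x‖ ^ 2 + r ^ 2 * (‖(A x * f x - g x) * hx W x‖ ^ 2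
      - (Ct φ w t0 x + ε) * ‖f x * hx W x‖ ^ 2) + 33 * M ^ 3 * r ^ 3 * (‖f x * hx W x‖ ^ 2 + ‖g x * hx W x‖ ^ 2)) := by
        intro x hx
        have h1 := pw_avg (f x) (g x) hM hr.le hr3M (am x hx) (bm x hx) (hGm x hx) (a2 x) (a3 x) (b2 x) (b3 x) (hCx x hx)
        rw [← hAe x hx] at h1
        have h2 := mul_le_mul_of_nonneg_left h1 (Real.exp_pos (-(W x))).le
        rw [Finset.mul_sum] at h2
        have h3 : ∀ k, Real.exp (h (r * om k) - h 0) * (‖f x + r * om k * g x‖ ^ 2 *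
          Real.exp (-(φ (t0 + ((r : ℂ) * om k) • w, x) + kap u c x))) =
            Real.exp (-(W x)) * (‖f x + r * om k * g x‖ ^ 2 * Real.exp (-(G x k))) := by
          intro k
          have : Real.exp (h (r * om k) - h 0) * Real.exp (-(φ (t0 + ((r : ℂ) * om k) • w, x) + kap u c x)) =
              Real.exp (-(W x)) * Real.exp (-(G x k)) := by
            rw [← Real.exp_add, ← Real.exp_add]; congr 1; simp only [hW, hG]; ring
          linear_combination ‖f x + r * om k * g x‖ ^ 2 * this
        simp only [h3]
        refine h2.trans (le_of_eq ?_)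
        simp only [norm_mul, mul_pow, norm_hx_sq]
        ring
      have hlin : ∑ k, ENNReal.ofReal (Real.exp (h (r * om k) - h 0)) *
        bergNormSq D (fun x => φ (t0 + ((r : ℂ) * om k) • w, x) + kap u c x) volume (fun x => f x + r * om k * g x) =
          ∫⁻ x in D, ENNReal.ofReal (∑ k, Real.exp (h (r * om k) - h 0) * (‖f x + r * om k * g x‖ ^ 2 *
          Real.exp (-(φ (t0 + ((r : ℂ) * om k) • w, x) + kap u c x)))) := by
        have e1 : ∀ k, ENNReal.ofReal (Real.exp (h (r * om k) - h 0)) *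
          bergNormSq D (fun x => φ (t0 + ((r : ℂ) * om k) • w, x) + kap u c x) volume (fun x => f x + r * om k * g x) =
          ∫⁻ x in D, ENNReal.ofReal (Real.exp (h (r * om k) - h 0) * (‖f x + r * om k * g x‖ ^ 2 *
          Real.exp (-(φ (t0 + ((r : ℂ) * om k) • w, x) + kap u c x)))) := by
          intro k
          rw [bergNormSq, ← lintegral_const_mul' _ _ ENNReal.ofReal_ne_top]
          refine lintegral_congr fun x => ?_
          rw [ENNReal.ofReal_mul (Real.exp_pos _).le]
        simp only [e1]
        rw [← lintegral_finsetSum']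
        · refine lintegral_congr fun x => ?_
          rw [ENNReal.ofReal_sum_of_nonneg]
          intro k _
          positivity
        · intro k _
          have hc : ContinuousOn (fun x => Real.exp (h (r * om k) - h 0) * (‖f x + r * om k * g x‖ ^ 2 *
              Real.exp (-(φ (t0 + ((r : ℂ) * om k) • w, x) + kap u c x)))) D :=
            continuousOn_const.mul (((hFd k).continuousOn.norm.pow 2).mul
              (Real.continuous_exp.comp_continuousOn (hWkc k).neg))
          exact (hc.aemeasurable hD.measurableSet).ennreal_ofReal
      rw [hlin]
      refine le_trans ?_ (ENNReal.ofReal_le_ofReal hle)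
      rw [ofReal_integral_eq_lintegral_ofReal hintg]
      · exact setLIntegral_mono' hD.measurableSet fun x hxx => ENNReal.ofReal_le_ofReal (hpt x hxx)
      · filter_upwards [ae_restrict_mem hD.measurableSet] with x hxx
        refine le_trans ?_ (hpt x hxx)
        exact Finset.sum_nonneg fun k _ => by positivity
    have hfin : ∀ k, bergNormSq D (fun x => φ (t0 + ((r : ℂ) * om k) • w, x) + kap u c x) volume (fun x => f x + r * om k * g x) ≠ ⊤ := by
      intro k htop
      have h1 := (Finset.single_le_sum (f := fun k => ENNReal.ofReal (Real.exp (h (r * om k) - h 0)) *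
        bergNormSq D (fun x => φ (t0 + ((r : ℂ) * om k) • w, x) + kap u c x) volume (fun x => f x + r * om k * g x))
        (fun _ _ => zero_le) (Finset.mem_univ k)).trans hsum
      simp only [htop] at h1
      rw [ENNReal.mul_top (by simpa using Real.exp_pos _)] at h1
      exact absurd h1 (by simp)
    have hk : ∀ k, ENNReal.ofReal (‖f z + r * om k * g z‖ ^ 2) ≤ KN Ω u φ z c t0 *
        (ENNReal.ofReal (Real.exp (h (r * om k) - h 0)) *
        bergNormSq D (fun x => φ (t0 + ((r : ℂ) * om k) • w, x) + kap u c x) volume (fun x => f x + r * om k * g x)) := by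
      intro k
      refine (le_ker hD (hWkc k) hz (hFd k) (hfin k)).trans ?_
      calc _ ≤ (ENNReal.ofReal (Real.exp (h (r * om k) - h 0)) * KN Ω u φ z c t0) * _ := mul_le_mul_left (hKk k) _
        _ = _ := by ring
    have hz4 : ENNReal.ofReal (4 * ‖f z‖ ^ 2) ≤ ∑ k, ENNReal.ofReal (‖f z + r * om k * g z‖ ^ 2) := by
      rw [← ENNReal.ofReal_sum_of_nonneg fun k _ => by positivity]
      refine ENNReal.ofReal_le_ofReal ?_
      rw [Fin.sum_univ_four]
      simp only [← Complex.normSq_eq_norm_sq, Complex.normSq_apply]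
      simp only [om0, om1, om2, om3]
      simp
      nlinarith [sq_nonneg (r * (g z).re), sq_nonneg (r * (g z).im)]
    have hfinal : ENNReal.ofReal (4 * ‖f z‖ ^ 2) ≤ KN Ω u φ z c t0 *
        ENNReal.ofReal (4 * (1 - ε / 2 * r ^ 2) * ∫ x in D, ‖f x * hx W x‖ ^ 2) := by
      refine hz4.trans ((Finset.sum_le_sum fun k _ => hk k).trans ?_)
      rw [← Finset.mul_sum]
      gcongr
    have e4 : (0:ℝ) ≤ 1 - ε / 2 * r ^ 2 ∨ 1 - ε / 2 * r ^ 2 ≤ 0 := le_total _ _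
    rw [bns_of_memLp hfm]
    have hI : 0 ≤ ∫ x in D, ‖f x * hx W x‖ ^ 2 := integral_nonneg fun x => by positivity
    rw [mul_assoc, ← ENNReal.ofReal_mul' hI]
    rw [mul_assoc, ENNReal.ofReal_mul (by norm_num : (0:ℝ) ≤ 4), ENNReal.ofReal_mul (by norm_num : (0:ℝ) ≤ 4)] at hfinal
    have h4 : ENNReal.ofReal 4 ≠ 0 := by simp
    refine (ENNReal.mul_le_mul_iff_right h4 ENNReal.ofReal_ne_top).1 (hfinal.trans (le_of_eq ?_))
    ring
  have hlt : ENNReal.ofReal (1 - ε / 2 * r ^ 2) < 1 := by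
    rw [← ENNReal.ofReal_one]
    refine (ENNReal.ofReal_lt_ofReal_iff one_pos).2 ?_
    have : 0 < ε / 2 * r ^ 2 := by positivity
    linarith
  have := ENNReal.mul_lt_mul_right hK0 hKt hlt
  rw [mul_one] at this
  exact absurd main (not_le.2 this)

end nomax
end

noncomputable section
open MeasureTheory Set Filter
open scoped ENNReal ComplexOrder ContDiff Topology
section trig

theorem trig_poly {r : ℝ} (hr : 0 < r) (q : C(AddCircle (1:ℝ), ℂ)) (hq : q ∈ Submodule.span ℂ (range (@fourier (1:ℝ)))) :
    ∀ c : ℂ, ∃ p : ℂ → ℂ, Differentiable ℂ p ∧ ∀ x : AddCircle (1:ℝ),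
      (p (r * (AddCircle.toCircle x : ℂ))).re = (c * q x).re := by
  have hr0 : (r : ℂ) ≠ 0 := by exact_mod_cast hr.ne'
  induction hq using Submodule.span_induction with
  | mem q h =>
    obtain ⟨k, rfl⟩ := h
    intro c
    have hk : ∀ x : AddCircle (1:ℝ), (fourier k x : ℂ) = (AddCircle.toCircle x : ℂ) ^ k := by
      intro x
      rw [fourier_apply, AddCircle.toCircle_zsmul, Circle.coe_zpow]
    have hdiv : ∀ x : AddCircle (1:ℝ), (r * (AddCircle.toCircle x : ℂ)) / r = (AddCircle.toCircle x : ℂ) := by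
      intro x; field_simp
    rcases le_total 0 k with h0 | h0
    · lift k to ℕ using h0
      refine ⟨fun τ => c * (τ / r) ^ k, by fun_prop, fun x => ?_⟩
      simp only [hk, hdiv, zpow_natCast]
    · obtain ⟨j, rfl⟩ : ∃ j : ℕ, k = -(j : ℤ) := ⟨k.natAbs, by omega⟩
      refine ⟨fun τ => (starRingEnd ℂ) c * (τ / r) ^ j, by fun_prop, fun x => ?_⟩
      simp only [hk, hdiv, zpow_neg, zpow_natCast]
      have : ((AddCircle.toCircle x : ℂ) ^ j)⁻¹ = (starRingEnd ℂ) ((AddCircle.toCircle x : ℂ) ^ j) := by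
        rw [← inv_pow, ← Circle.coe_inv, Circle.coe_inv_eq_conj, map_pow]
      rw [this]
      simp only [Complex.mul_re, Complex.conj_re, Complex.conj_im]
      ring
  | zero => exact fun c => ⟨0, differentiable_const 0, fun x => by simp⟩
  | add q1 q2 _ _ h1 h2 =>
    intro c
    obtain ⟨p1, d1, e1⟩ := h1 c
    obtain ⟨p2, d2, e2⟩ := h2 c
    refine ⟨fun τ => p1 τ + p2 τ, d1.fun_add d2, fun x => ?_⟩
    simp only [ContinuousMap.add_apply, mul_add, Complex.add_re, e1, e2]
  | smul a q _ h =>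
    intro c
    obtain ⟨p, d, e⟩ := h (c * a)
    refine ⟨p, d, fun x => ?_⟩
    rw [e, ContinuousMap.smul_apply, smul_eq_mul, mul_assoc]

theorem trig_approx {r ε : ℝ} (hr : 0 < r) (hε : 0 < ε) {F : ℂ → ℝ} (hF : ContinuousOn F (Metric.sphere 0 r)) :
    ∃ p : ℂ → ℂ, Differentiable ℂ p ∧ ∀ τ ∈ Metric.sphere (0:ℂ) r, |(p τ).re - F τ| ≤ ε := by
  have hs : ∀ x : AddCircle (1:ℝ), (r : ℂ) * (AddCircle.toCircle x : ℂ) ∈ Metric.sphere (0:ℂ) r := by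
    intro x
    rw [mem_sphere_zero_iff_norm, norm_mul, Circle.norm_coe, mul_one, Complex.norm_real, Real.norm_of_nonneg hr.le]
  have hc : Continuous fun x : AddCircle (1:ℝ) => ((F (r * (AddCircle.toCircle x : ℂ)) : ℝ) : ℂ) := by
    refine Complex.continuous_ofReal.comp (hF.comp_continuous ?_ hs)
    exact continuous_const.mul (continuous_induced_dom.comp AddCircle.continuous_toCircle)
  let f : C(AddCircle (1:ℝ), ℂ) := ⟨_, hc⟩
  have hf : f ∈ (Submodule.span ℂ (range (@fourier (1:ℝ)))).topologicalClosure := by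
    rw [span_fourier_closure_eq_top]; trivial
  have hf' : f ∈ closure ((Submodule.span ℂ (range (@fourier (1:ℝ))) : Set C(AddCircle (1:ℝ), ℂ))) := hf
  obtain ⟨q, hq, hd⟩ := Metric.mem_closure_iff.1 hf' ε hε
  obtain ⟨p, hp, he⟩ := trig_poly hr q hq 1
  refine ⟨p, hp, fun τ hτ => ?_⟩
  obtain ⟨x, rfl⟩ : ∃ x : AddCircle (1:ℝ), τ = r * (AddCircle.toCircle x : ℂ) := by
    have hτ' : ‖τ‖ = r := by simpa using hτ
    refine ⟨((τ.arg / (2 * Real.pi) : ℝ) : AddCircle (1:ℝ)), ?_⟩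
    rw [AddCircle.toCircle_apply_mk, Circle.coe_exp]
    conv_lhs => rw [← Complex.norm_mul_exp_arg_mul_I τ, hτ']
    congr 3
    have := Real.pi_ne_zero
    norm_cast
    field_simp
  rw [he, one_mul]
  have h1 : ‖f x - q x‖ ≤ ε := by
    have := ContinuousMap.dist_apply_le_dist (f := f) (g := q) x
    rw [dist_eq_norm] at this
    exact this.trans hd.le
  have h2 := (Complex.abs_re_le_norm (f x - q x)).trans h1
  have h3 : (f x - q x).re = F (r * (AddCircle.toCircle x : ℂ)) - (q x).re := by
    simp [f]
  rw [h3, abs_sub_comm] at h2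
  exact h2

theorem mean_re {r : ℝ} {p : ℂ → ℂ} (hp : Differentiable ℂ p) :
    (1 / (2 * Real.pi)) * ∫ θ in (0:ℝ)..(2 * Real.pi), (p (r * Complex.exp (θ * Complex.I))).re = (p 0).re := by
  have h := DiffContOnCl.circleAverage (f := p) (c := 0) (R := r) hp.diffContOnCl
  rw [Real.circleAverage_def] at h
  rw [← h, Complex.smul_re]
  have hc : Continuous fun θ : ℝ => p (circleMap 0 r θ) := hp.continuous.comp (continuous_circleMap 0 r)
  have h2 := Complex.reCLM.intervalIntegral_comp_comm (hc.intervalIntegrable (μ := volume) 0 (2 * Real.pi))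
  simp only [Complex.reCLM_apply] at h2
  rw [← h2, smul_eq_mul, one_div]
  simp [circleMap]

theorem fderiv_re_holo {p : ℂ → ℂ} {y : ℂ} (hp : DifferentiableAt ℂ p y) :
    HasFDerivAt (fun y => (p y).re) (Complex.reCLM.comp ((fderiv ℂ p y).restrictScalars ℝ)) y :=
  Complex.reCLM.hasFDerivAt.comp y (hp.hasFDerivAt.restrictScalars ℝ)

theorem h_hess {p : ℂ → ℂ} (hp : Differentiable ℂ p) (ε : ℝ) (τ : ℂ) :
    ContDiff ℝ ∞ (fun σ : ℂ => (p (τ + σ)).re - ε * Complex.normSq (τ + σ)) ∧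
    hess (fun σ : ℂ => (p (τ + σ)).re - ε * Complex.normSq (τ + σ)) 0 1 1 +
      hess (fun σ : ℂ => (p (τ + σ)).re - ε * Complex.normSq (τ + σ)) 0 Complex.I Complex.I = -(4 * ε) := by
  set P : ℂ → ℂ := fun σ => p (τ + σ) with hP
  have hPd : Differentiable ℂ P := hp.comp (by fun_prop)
  have hPs : ContDiff ℂ ∞ P := hPd.contDiff
  have hdP : Differentiable ℂ (deriv P) := by
    exact (hPd.contDiff (n := 2)).differentiable_deriv_two
  have hsm : ContDiff ℝ ∞ (fun σ : ℂ => (P σ).re - ε * Complex.normSq (τ + σ)) := by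
    refine ContDiff.sub (Complex.reCLM.contDiff.comp (hPs.restrict_scalars ℝ)) (contDiff_const.mul ?_)
    simp only [Complex.normSq_apply]
    exact ((Complex.reCLM.contDiff.comp (contDiff_const.add contDiff_id)).mul (Complex.reCLM.contDiff.comp (contDiff_const.add contDiff_id))).add
      ((Complex.imCLM.contDiff.comp (contDiff_const.add contDiff_id)).mul (Complex.imCLM.contDiff.comp (contDiff_const.add contDiff_id)))
  refine ⟨hsm, ?_⟩
  have hre : ∀ y : ℂ, HasFDerivAt (fun σ : ℂ => (τ + σ).re) Complex.reCLM y := fun y => by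
    simpa using (Complex.reCLM.hasFDerivAt (x := y)).const_add τ.re
  have him : ∀ y : ℂ, HasFDerivAt (fun σ : ℂ => (τ + σ).im) Complex.imCLM y := fun y => by
    simpa using (Complex.imCLM.hasFDerivAt (x := y)).const_add τ.im
  have h1 : ∀ v y : ℂ, fderiv ℝ (fun σ : ℂ => (P σ).re - ε * Complex.normSq (τ + σ)) y v =
      (deriv P y * v).re - ε * (2 * ((τ + y).re * v.re) + 2 * ((τ + y).im * v.im)) := by
    intro v y
    simp only [Complex.normSq_apply]
    have := (fderiv_re_holo (hPd y)).fun_sub ((((hre y).fun_mul (hre y)).fun_add ((him y).fun_mul (him y))).const_mul ε)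
    rw [this.fderiv]
    have e : fderiv ℂ P y v = deriv P y * v := by
      have := (fderiv ℂ P y).map_smul v 1
      simp only [smul_eq_mul, mul_one] at this
      rw [this, fderiv_apply_one_eq_deriv, mul_comm]
    simp [e]
    ring
  have h2 : ∀ v : ℂ, hess (fun σ : ℂ => (P σ).re - ε * Complex.normSq (τ + σ)) 0 v v =
      (deriv (deriv P) 0 * v * v).re - ε * (2 * (v.re * v.re) + 2 * (v.im * v.im)) := by
    intro v
    unfold hess
    simp only [h1]
    have hd : DifferentiableAt ℂ (fun y => deriv P y * v) 0 := (hdP 0).mul_const v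
    have := (fderiv_re_holo hd).fun_sub (((((hre 0).mul_const v.re).const_mul 2).fun_add (((him 0).mul_const v.im).const_mul 2)).const_mul ε)
    rw [this.fderiv]
    have e : fderiv ℂ (fun y => deriv P y * v) 0 v = deriv (deriv P) 0 * v * v := by
      have h3 := (fderiv ℂ (fun y => deriv P y * v) 0).map_smul v 1
      simp only [smul_eq_mul, mul_one] at h3
      rw [h3, fderiv_apply_one_eq_deriv, deriv_mul_const (hdP 0), mul_comm]
    simp [e]
    ring
  rw [h2, h2]
  simp
  ring

end trig
end

noncomputable section
open MeasureTheory Set Filter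
open scoped ENNReal ComplexOrder ContDiff Topology
section submean

theorem SN_submean {m n : ℕ} {U : Set (Fin m → ℂ)} {Ω : Set (Fin n → ℂ)} {u : (Fin n → ℂ) → ℝ}
    {φ : (Fin m → ℂ) × (Fin n → ℂ) → ℝ} {η : (Fin n → ℂ) → ℝ} {δ c : ℝ} {z : Fin n → ℂ}
    (hE : Exh Ω u) (hU : IsOpen U) (hφ : ContDiffOn ℝ ∞ φ (U ×ˢ Ω)) (hη : ContDiffOn ℝ ∞ η Ω)
    (hδ : 0 < δ) (hXi : XiNonneg U Ω φ η δ) (hz : z ∈ Dc Ω u c)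
    {a w : Fin m → ℂ} {r : ℝ} (hr : 0 < r) (hd : ∀ τ : ℂ, ‖τ‖ ≤ r → a + τ • w ∈ U) :
    ContinuousOn (fun τ : ℂ => SN Ω u φ z c (a + τ • w)) (Metric.closedBall 0 r) ∧
    SN Ω u φ z c a ≤ (1 / (2 * Real.pi)) *
      ∫ θ in (0:ℝ)..(2 * Real.pi), SN Ω u φ z c (a + ((r:ℂ) * Complex.exp (θ * Complex.I)) • w) := by
  set S : ℂ → ℝ := fun τ : ℂ => SN Ω u φ z c (a + τ • w) with hS
  have hcont : ContinuousOn S (Metric.closedBall 0 r) := by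
    refine (SN_cont hE hU hφ hz).comp (Continuous.continuousOn (by fun_prop)) ?_
    intro τ hτ
    exact hd τ (by simpa using hτ)
  refine ⟨hcont, ?_⟩
  have hcirc : ∀ θ : ℝ, (r:ℂ) * Complex.exp (θ * Complex.I) ∈ Metric.sphere (0:ℂ) r := by
    intro θ
    rw [mem_sphere_zero_iff_norm, norm_mul, Complex.norm_exp_ofReal_mul_I, mul_one, Complex.norm_real, Real.norm_of_nonneg hr.le]
  have hcS : Continuous fun θ : ℝ => S ((r:ℂ) * Complex.exp (θ * Complex.I)) :=
    (hcont.mono Metric.sphere_subset_closedBall).comp_continuous (by fun_prop) hcirc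
  have hpi := Real.pi_pos
  set Mn : ℝ := (1 / (2 * Real.pi)) * ∫ θ in (0:ℝ)..(2 * Real.pi), S ((r:ℂ) * Complex.exp (θ * Complex.I)) with hMn
  have key : ∀ ε : ℝ, 0 < ε → S 0 ≤ Mn + (2 + r ^ 2) * ε := by
    intro ε hε
    obtain ⟨p, hp, hpF⟩ := trig_approx hr hε (hcont.mono Metric.sphere_subset_closedBall)
    set h : ℂ → ℝ := fun τ => (p τ).re - ε * Complex.normSq τ with hh
    have hhc : Continuous h := by
      have := hp.continuous
      exact (Complex.continuous_re.comp this).sub (continuous_const.mul Complex.continuous_normSq)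
    obtain ⟨τ, hτ, hmx⟩ := (isCompact_closedBall (0:ℂ) r).exists_isMaxOn ⟨0, by simp [hr.le]⟩ (hcont.sub hhc.continuousOn)
    have hmx' : ∀ σ ∈ Metric.closedBall (0:ℂ) r, S σ - h σ ≤ S τ - h τ := fun σ hσ => hmx hσ
    have hτr : ‖τ‖ = r := by
      by_contra hne
      have hlt : ‖τ‖ < r := lt_of_le_of_ne (by simpa using hτ) hne
      obtain ⟨hsm, hhess⟩ := h_hess hp ε τ
      have ht0 : a + τ • w ∈ U := hd τ hlt.le
      refine no_max hE hU hφ hη hδ hXi ht0 w hz hsm hε hhess.le ?_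
      have hev : ∀ᶠ σ : ℂ in 𝓝 0, τ + σ ∈ Metric.ball (0:ℂ) r := by
        have : Continuous fun σ : ℂ => τ + σ := by fun_prop
        exact this.continuousAt.eventually_mem (Metric.isOpen_ball.mem_nhds (by simpa using hlt))
      filter_upwards [hev] with σ hσ
      have h1 := hmx' _ (Metric.ball_subset_closedBall hσ)
      simp only [hS, hh] at h1
      rw [add_smul, ← add_assoc] at h1
      simpa using h1
    have h0 := hmx' 0 (by simp [hr.le])
    have hb := hpF τ (by simpa using hτr)
    rw [abs_le] at hb
    have hn : Complex.normSq τ = r ^ 2 := by rw [Complex.normSq_eq_norm_sq, hτr]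
    simp only [hh, hn, Complex.normSq_zero] at h0
    have hmean := mean_re (r := r) hp
    have hle : (p 0).re ≤ Mn + ε := by
      rw [← hmean]
      have hi : ∫ θ in (0:ℝ)..(2 * Real.pi), (p (r * Complex.exp (θ * Complex.I))).re ≤
          ∫ θ in (0:ℝ)..(2 * Real.pi), (S ((r:ℂ) * Complex.exp (θ * Complex.I)) + ε) := by
        refine intervalIntegral.integral_mono_on (by positivity) ?_ ?_ ?_
        · refine Continuous.intervalIntegrable ?_ _ _
          have := hp.continuous
          exact Complex.continuous_re.comp (this.comp (by fun_prop))
        · exact (hcS.add continuous_const).intervalIntegrable _ _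
        · intro θ _
          have := (abs_le.1 (hpF _ (hcirc θ))).2
          linarith
      rw [intervalIntegral.integral_add (hcS.intervalIntegrable _ _) (by simp), intervalIntegral.integral_const] at hi
      rw [hMn]
      calc _ ≤ 1 / (2 * Real.pi) * ((∫ θ in (0:ℝ)..(2 * Real.pi), S ((r:ℂ) * Complex.exp (θ * Complex.I))) + (2 * Real.pi - 0) • ε) := by gcongr
        _ = _ := by rw [smul_eq_mul, sub_zero, mul_add]; congr 1; field_simp
    simp only [mul_zero, sub_zero] at h0
    nlinarith [h0, hb.1, hle]
  have h00 : S 0 = SN Ω u φ z c a := by simp [hS]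
  rw [← h00]
  by_contra hlt
  push Not at hlt
  have hq : 0 < 2 + r ^ 2 := by positivity
  have := key ((S 0 - Mn) / (2 * (2 + r ^ 2))) (div_pos (by linarith) (by positivity))
  have e : (2 + r ^ 2) * ((S 0 - Mn) / (2 * (2 + r ^ 2))) = (S 0 - Mn) / 2 := by field_simp
  rw [e] at this
  linarith

end submean
end

noncomputable section
open MeasureTheory Set Filter
open scoped ENNReal ComplexOrder ContDiff Topology
section lim

theorem weak_limit {H : Type*} [NormedAddCommGroup H] [InnerProductSpace ℂ H] [CompleteSpace H]
    (v : ℕ → H) {C : ℝ} (hv : ∀ k, ‖v k‖ ≤ C) :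
    ∃ F : Filter ℕ, F.NeBot ∧ F ≤ atTop ∧ ∃ x : H, ‖x‖ ≤ C ∧
      ∀ y, Tendsto (fun k => inner ℂ y (v k)) F (𝓝 (inner ℂ y x)) := by
  have hc := WeakDual.isCompact_closedBall (𝕜 := ℂ) (E := H) 0 C
  let q : ℕ → WeakDual ℂ H := fun k => StrongDual.toWeakDual (InnerProductSpace.toDual ℂ H (v k))
  have hq : ∀ k, q k ∈ WeakDual.toStrongDual ⁻¹' Metric.closedBall (0 : StrongDual ℂ H) C := by
    intro k
    simp only [mem_preimage, mem_closedBall_zero_iff]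
    have : WeakDual.toStrongDual (q k) = InnerProductSpace.toDual ℂ H (v k) := rfl
    rw [this, LinearIsometryEquiv.norm_map]
    exact hv k
  obtain ⟨l, hl, hle⟩ := hc.ultrafilter_le_nhds (Ultrafilter.map q (Filter.hyperfilter ℕ))
    (by
      rw [Filter.le_principal_iff]
      exact Filter.mem_map.2 (Filter.univ_mem' hq))
  refine ⟨(Filter.hyperfilter ℕ : Filter ℕ), inferInstance, ?_, (InnerProductSpace.toDual ℂ H).symm (WeakDual.toStrongDual l), ?_, ?_⟩
  · rw [← Nat.cofinite_eq_atTop]; exact Filter.hyperfilter_le_cofinite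
  · rw [LinearIsometryEquiv.norm_map]
    simpa using hl
  · intro y
    have h1 : Tendsto q (Filter.hyperfilter ℕ : Filter ℕ) (𝓝 l) := hle
    have h2 := (tendsto_iff_forall_eval_tendsto_topDualPairing.1 h1) y
    have h3 := (Complex.continuous_conj.tendsto _).comp h2
    have e1 : ∀ k, (starRingEnd ℂ) (topDualPairing ℂ H (q k) y) = inner ℂ y (v k) := by
      intro k
      have : topDualPairing ℂ H (q k) y = inner ℂ (v k) y := rfl
      rw [this, inner_conj_symm]
    have e2 : (starRingEnd ℂ) (topDualPairing ℂ H l y) = inner ℂ y ((InnerProductSpace.toDual ℂ H).symm (WeakDual.toStrongDual l)) := by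
      rw [← inner_conj_symm, InnerProductSpace.toDual_symm_apply]
      rfl
    rw [e2] at h3
    refine h3.congr fun k => ?_
    exact e1 k

variable {n : ℕ} {Ω D : Set (Fin n → ℂ)} {W u : (Fin n → ℂ) → ℝ} {z : Fin n → ℂ}

theorem ker_extract (hD : IsOpen D) (hW : ContinuousOn W D) {ℓ : ℝ} (hℓ : 0 < ℓ)
    (h : ENNReal.ofReal ℓ < bergKernel D W volume z) :
    ∃ g, DifferentiableOn ℂ g D ∧ g z = 1 ∧ MemLp (fun x => g x * hx W x) 2 (volume.restrict D) ∧
      ∫ x in D, ‖g x * hx W x‖ ^ 2 ≤ 1 / ℓ := by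
  unfold bergKernel at h
  simp only [lt_iSup_iff] at h
  obtain ⟨f, hf, h0, ht, hlt⟩ := h
  have hm := memLp_of_bns hD hW hf ht
  rw [bns_of_memLp hm] at hlt h0
  set A := ∫ x in D, ‖f x * hx W x‖ ^ 2 with hA
  have hA0 : 0 < A := by
    by_contra hh
    exact h0 (ENNReal.ofReal_eq_zero.2 (not_lt.1 hh))
  rw [← ENNReal.ofReal_div_of_pos hA0, ENNReal.ofReal_lt_ofReal_iff_of_nonneg hℓ.le, lt_div_iff₀ hA0] at hlt
  have hfz : f z ≠ 0 := by
    intro hh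
    rw [hh] at hlt
    have := mul_pos hℓ hA0
    simp at hlt
    linarith
  refine ⟨fun x => (f z)⁻¹ * f x, hf.const_mul _, by simp [hfz], ?_, ?_⟩
  · simp only [mul_assoc]
    exact hm.const_mul _
  · simp only [mul_assoc]
    have : ∀ x, ‖(f z)⁻¹ * (f x * hx W x)‖ ^ 2 = (‖f z‖ ^ 2)⁻¹ * ‖f x * hx W x‖ ^ 2 := by
      intro x; rw [norm_mul, mul_pow, norm_inv, inv_pow]
    simp only [this]
    rw [integral_const_mul, ← hA]
    have hp : 0 < ‖f z‖ ^ 2 := by positivity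
    rw [inv_mul_eq_div, div_le_div_iff₀ hp hℓ]
    linarith

theorem norm_sq_LD {x : LD D} {f : (Fin n → ℂ) → ℂ} (h : x =ᵐ[volume.restrict D] f) :
    ‖x‖ ^ 2 = ∫ y in D, ‖f y‖ ^ 2 := by
  have h1 := inner_eq h h
  rw [inner_self_eq_norm_sq_to_K] at h1
  have h2 : ∀ y, f y * (starRingEnd ℂ) (f y) = ((‖f y‖ ^ 2 : ℝ) : ℂ) := by
    intro y; rw [Complex.mul_conj, Complex.normSq_eq_norm_sq]
  simp only [h2] at h1
  rw [integral_complex_ofReal] at h1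
  apply Complex.ofReal_injective
  rw [← h1]
  simp

theorem ker_exhaust (hE : Exh Ω u) (hW : ContDiffOn ℝ ∞ W Ω) (hz : z ∈ Ω) {L : ℝ≥0∞}
    (hL : ∀ k : ℕ, L ≤ bergKernel (Dc Ω u (u z + 1 + k)) W volume z) : L ≤ bergKernel Ω W volume z := by
  refine le_of_forall_lt fun L' hL' => ?_
  obtain ⟨L1, hL1, hL1'⟩ := exists_between hL'
  refine lt_of_lt_of_le hL1 ?_
  have hL1top : L1 ≠ ⊤ := (hL1'.trans_le le_top).ne
  obtain ⟨ℓ, rfl⟩ : ∃ ℓ : ℝ, L1 = ENNReal.ofReal ℓ := ⟨L1.toReal, (ENNReal.ofReal_toReal hL1top).symm⟩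
  have hℓ : 0 < ℓ := ENNReal.ofReal_pos.1 (zero_le.trans_lt hL1)
  have hΩ := hE.op
  set E : ℕ → Set (Fin n → ℂ) := fun k => Dc Ω u (u z + 1 + k) with hEd
  have hEo : ∀ k, IsOpen (E k) := fun k => hE.Dc_open _
  have hEs : ∀ k, E k ⊆ Ω := fun k => Dc_sub _
  choose g hg hgz hgm hgi using fun k => ker_extract (hEo k) (hW.continuousOn.mono (hEs k)) hℓ (hL1'.trans_le (hL k))
  set v : ℕ → (Fin n → ℂ) → ℂ := fun k => (E k).indicator fun x => g k x * hx W x with hv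
  have hvm0 : ∀ k, MemLp (v k) 2 volume := fun k => by
    rw [hv]; simp only
    rw [memLp_indicator_iff_restrict (hEo k).measurableSet]
    exact hgm k
  have hvm : ∀ k, MemLp (v k) 2 (volume.restrict Ω) := fun k => (hvm0 k).mono_measure Measure.restrict_le_self
  have hvn : ∀ k, ‖(hvm k).toLp (v k)‖ ≤ Real.sqrt (1 / ℓ) := by
    intro k
    refine Real.le_sqrt_of_sq_le ?_
    rw [norm_sq_LD (MemLp.coeFn_toLp (hvm k))]
    have e : ∀ y, ‖v k y‖ ^ 2 = (E k).indicator (fun x => ‖g k x * hx W x‖ ^ 2) y := by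
      intro y
      by_cases hy : y ∈ E k <;> simp [hv, hy]
    simp only [e]
    rw [setIntegral_indicator (hEo k).measurableSet, inter_eq_self_of_subset_right (hEs k)]
    exact hgi k
  obtain ⟨F, hF, hFt, V, hVn, hVt⟩ := weak_limit (fun k => (hvm k).toLp (v k)) hvn
  -- pairing with test functions
  have hpair : ∀ T, IsTest Ω T → Tendsto (fun k => ∫ y, v k y * T y) F (𝓝 (∫ y, V y * T y)) := by
    intro T hT
    have hTm : MemLp (fun y => (starRingEnd ℂ) (T y)) 2 (volume.restrict Ω) :=
      (hT.memLp.mono_measure Measure.restrict_le_self).star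
    have h1 := hVt (hTm.toLp _)
    have h2 : ∀ k, inner ℂ (hTm.toLp _) ((hvm k).toLp (v k)) = ∫ y, v k y * T y := fun k =>
      inner_test hT (MemLp.coeFn_toLp hTm) (MemLp.coeFn_toLp (hvm k))
    have h3 : inner ℂ (hTm.toLp _) V = ∫ y, V y * T y :=
      inner_test hT (MemLp.coeFn_toLp hTm) (ae_eq_refl _)
    simp only [h2, h3] at h1
    exact h1
  have hvT : ∀ T k, IsTest Ω T → tsupport T ⊆ E k → ∫ y, v k y * T y = ∫ y, (g k y * hx W y) * T y := by
    intro T k hT hs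
    refine integral_congr_ae (Eventually.of_forall fun y => ?_)
    by_cases hy : y ∈ E k
    · simp [hv, hy]
    · have : T y = 0 := image_eq_zero_of_notMem_tsupport fun h' => hy (hs h')
      simp [this]
  have hVm : MemLp V 2 (volume.restrict Ω) := Lp.memLp V
  have hweak : ∀ θ, IsTest Ω θ → ∀ j, ∫ x, V x * Tb W j θ x = 0 := by
    intro θ hθ j
    have hT := IsTest.Tb hΩ hW hθ j
    have h1 := hpair _ hT
    refine tendsto_nhds_unique h1 ?_
    obtain ⟨M, hM⟩ := hθ.2.1.exists_bound_of_continuousOn (hE.sm.continuousOn.mono hθ.2.2)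
    obtain ⟨k0, hk0⟩ := exists_nat_gt (M - (u z + 1))
    have hev : ∀ᶠ k in F, (0:ℂ) = ∫ y, v k y * Tb W j θ y := by
      filter_upwards [hFt (eventually_ge_atTop k0)] with k hk
      have hkk : (k0 : ℝ) ≤ k := by exact_mod_cast hk
      have hs : tsupport θ ⊆ E k := by
        intro x hx
        refine ⟨hθ.2.2 hx, ?_⟩
        have := (le_abs_self (u x)).trans (hM x hx)
        linarith
      have hθk : IsTest (E k) θ := ⟨hθ.1, hθ.2.1, hs⟩
      have hWk : ContDiffOn ℝ ∞ W (E k) := hW.mono (hEs k)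
      rw [hvT _ k hT (IsTest.Tb (hEo k) hWk hθk j).2.2]
      exact (holo_W1 (hEo k) (hg k) hWk θ hθk j).symm
    exact tendsto_const_nhds.congr' hev
  obtain ⟨f, hf, hVf⟩ := weyl_Tb hΩ hW hVm hweak
  have hzE : z ∈ E 0 := ⟨hz, by simp⟩
  obtain ⟨ε, hε, hb⟩ := Metric.nhds_basis_closedBall.mem_iff.1 ((hEo 0).mem_nhds hzE)
  have hEmono : ∀ k, E 0 ⊆ E k := by
    intro k x hx
    refine ⟨hx.1, hx.2.trans_le ?_⟩
    have : (0:ℝ) ≤ k := Nat.cast_nonneg k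
    simp; 
  have hinv : ∀ x, hx W x * hx (fun x => - W x) x = 1 := by
    intro x; unfold hx; rw [← Complex.ofReal_mul, ← Real.exp_add]
    norm_cast; rw [← Real.exp_zero]; congr 1; ring
  have hR0 : IsTest (E 0) (fun y => hx (fun x => - W x) y * rhoC n ε (z - y)) :=
    IsTest.mul_left (hEo 0) (hx_contDiffOn (hW.mono (hEs 0)).neg) (rhoC_test hε z hb)
  have hR : IsTest Ω (fun y => hx (fun x => - W x) y * rhoC n ε (z - y)) := ⟨hR0.1, hR0.2.1, hR0.2.2.trans (hEs 0)⟩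
  have hcancel : ∀ (G : (Fin n → ℂ) → ℂ) y, G y * hx W y * (hx (fun x => - W x) y * rhoC n ε (z - y)) = G y * rhoC n ε (z - y) := by
    intro G y
    calc _ = G y * (hx W y * hx (fun x => - W x) y) * rhoC n ε (z - y) := by ring
      _ = _ := by rw [hinv, mul_one]
  have hfz : f z = 1 := by
    have h1 := hpair _ hR
    have h2 : ∀ k, ∫ y, v k y * (hx (fun x => - W x) y * rhoC n ε (z - y)) = 1 := by
      intro k
      rw [hvT _ k hR (hR0.2.2.trans (hEmono k))]
      simp only [hcancel]
      have := mo_mean_value hε (hEo k) (hg k) (hb.trans (hEmono k))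
      rw [mo, hgz k] at this
      exact this
    simp only [h2] at h1
    have h3 := tendsto_nhds_unique h1 tendsto_const_nhds
    have h4 : ∫ y, V y * (hx (fun x => - W x) y * rhoC n ε (z - y)) = ∫ y, f y * rhoC n ε (z - y) := by
      have e1 : ∀ G : (Fin n → ℂ) → ℂ, ∫ y, G y * (hx (fun x => - W x) y * rhoC n ε (z - y)) =
          ∫ y in Ω, G y * (hx (fun x => - W x) y * rhoC n ε (z - y)) := by
        intro G
        refine (setIntegral_eq_integral_of_forall_compl_eq_zero fun y hy => ?_).symm
        have := hR.eq_zero hy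
        rw [this, mul_zero]
      rw [e1]
      have e2 : ∫ y in Ω, V y * (hx (fun x => - W x) y * rhoC n ε (z - y)) =
          ∫ y in Ω, (f y * hx W y) * (hx (fun x => - W x) y * rhoC n ε (z - y)) := by
        refine integral_congr_ae ?_
        filter_upwards [hVf] with y hy
        rw [hy]
      rw [e2, ← e1 (fun y => f y * hx W y)]
      simp only [hcancel]
    have h5 := mo_mean_value hε hΩ hf (hb.trans (hEs 0))
    rw [mo] at h5
    rw [← h5, ← h4, h3]
  have hfm : MemLp (fun x => f x * hx W x) 2 (volume.restrict Ω) := (memLp_congr_ae hVf).1 hVm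
  have hle := le_ker hΩ hW.continuousOn hz hf (bns_ne_top hfm)
  rw [bns_of_memLp hfm, ← norm_sq_LD hVf, hfz] at hle
  have hVn2 : ‖V‖ ^ 2 ≤ 1 / ℓ := by
    have := pow_le_pow_left₀ (norm_nonneg _) hVn 2
    rwa [Real.sq_sqrt (by positivity)] at this
  have h6 : (1 : ℝ≥0∞) ≤ bergKernel Ω W volume z * ENNReal.ofReal (1 / ℓ) := by
    calc (1:ℝ≥0∞) = ENNReal.ofReal (‖(1:ℂ)‖ ^ 2) := by simp
      _ ≤ _ := hle
      _ ≤ _ := by gcongr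
  rw [one_div, ENNReal.ofReal_inv_of_pos hℓ] at h6
  have h7 := (ENNReal.le_div_iff_mul_le (a := 1) (b := ENNReal.ofReal ℓ) (c := bergKernel Ω W volume z) (Or.inl (ENNReal.ofReal_pos.2 hℓ).ne') (Or.inl ENNReal.ofReal_ne_top)).1 (by rwa [div_eq_mul_inv])
  rwa [one_mul] at h7

end lim
end

noncomputable section
open MeasureTheory Set Filter
open scoped ENNReal ComplexOrder ContDiff Topology
section final1
variable {m n : ℕ} {U : Set (Fin m → ℂ)} {Ω : Set (Fin n → ℂ)} {u : (Fin n → ℂ) → ℝ}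
    {φ : (Fin m → ℂ) × (Fin n → ℂ) → ℝ} {η : (Fin n → ℂ) → ℝ} {δ c : ℝ} {z : Fin n → ℂ}

theorem KN_inf (hE : Exh Ω u) (hφ : ContDiffOn ℝ ∞ φ (U ×ˢ Ω)) {t} (ht : t ∈ U) (hz : z ∈ Ω) {L : ℝ≥0∞}
    (hL : ∀ k : ℕ, L ≤ KN Ω u φ z (u z + 1 + k) t) : L ≤ bergKernel Ω (fun x => φ (t, x)) volume z := by
  have hW := slice_smooth hφ ht
  refine ker_exhaust hE hW hz fun k => ?_
  have hzk : z ∈ Dc Ω u (u z + 1 + k) := ⟨hz, by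
    have : (0:ℝ) ≤ k := Nat.cast_nonneg k
    linarith⟩
  have hWk := hW.continuousOn.mono (Dc_sub (u := u) (u z + 1 + k))
  have hlt := ker_lt_top (hE.Dc_open (u z + 1 + k)) hWk hzk
  have hM : ∀ M : ℕ, L ≤ ENNReal.ofReal (Real.exp ((((M:ℝ) + 1) ^ 3)⁻¹ / 3)) *
      bergKernel (Dc Ω u (u z + 1 + k)) (fun x => φ (t, x)) volume z := by
    intro M
    refine (hL (k + (M + 1))).trans ?_
    have hM0 : (0:ℝ) ≤ M := Nat.cast_nonneg M
    refine ker_mono (hE.Dc_open _) hWk hzk ?_ ?_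
    · intro x hx
      refine ⟨hx.1, hx.2.trans_le ?_⟩
      push_cast
      linarith
    · intro x hx
      have h2 : (M:ℝ) + 1 ≤ u z + 1 + ((k + (M + 1) : ℕ) : ℝ) - u x := by
        have := hx.2
        push_cast
        linarith
      unfold kap Pk
      gcongr
  have hs : Tendsto (fun M : ℕ => (((M:ℝ) + 1) ^ 3)⁻¹ / 3) atTop (𝓝 0) := by
    have h1 : Tendsto (fun M : ℕ => 1 / ((M:ℝ) + 1)) atTop (𝓝 0) := tendsto_one_div_add_atTop_nhds_zero_nat
    have h2 := (h1.pow 3).div_const 3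
    simpa using h2
  have hs2 := ENNReal.tendsto_ofReal ((Real.continuous_exp.tendsto 0).comp hs)
  have hs3 := ENNReal.Tendsto.mul_const (b := bergKernel (Dc Ω u (u z + 1 + k)) (fun x => φ (t, x)) volume z) hs2 (Or.inr hlt.ne)
  rw [Real.exp_zero, ENNReal.ofReal_one, one_mul] at hs3
  exact ge_of_tendsto' hs3 hM

theorem elog_KN (hE : Exh Ω u) (hφ : ContDiffOn ℝ ∞ φ (U ×ˢ Ω)) {t} (ht : t ∈ U) (hz : z ∈ Dc Ω u c) :
    elog (KN Ω u φ z c t) = ((SN Ω u φ z c t : ℝ) : EReal) := by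
  unfold elog SN
  rw [if_neg (KN_ne_zero hE hφ ht hz), if_neg (KN_lt_top hE hφ ht hz).ne]

theorem elog_mono {x y : ℝ≥0∞} (h : x ≤ y) : elog x ≤ elog y := by
  rw [elog_eq]; exact ENNReal.log_monotone h

theorem elog_K_le (hE : Exh Ω u) (hφ : ContDiffOn ℝ ∞ φ (U ×ˢ Ω)) {t} (ht : t ∈ U) (hz : z ∈ Dc Ω u c) :
    elog (bergKernel Ω (fun x => φ (t, x)) volume z) ≤ ((SN Ω u φ z c t : ℝ) : EReal) := by
  rw [← elog_KN hE hφ ht hz]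
  exact elog_mono (K_le_KN hE hφ ht hz)

theorem exists_SN_lt (hE : Exh Ω u) (hφ : ContDiffOn ℝ ∞ φ (U ×ˢ Ω)) {t} (ht : t ∈ U) (hz : z ∈ Ω) {y : ℝ}
    (hy : elog (bergKernel Ω (fun x => φ (t, x)) volume z) < (y : EReal)) :
    ∃ k : ℕ, SN Ω u φ z (u z + 1 + k) t < y := by
  by_contra hcon
  push Not at hcon
  have hel : elog (ENNReal.ofReal (Real.exp y)) = (y : EReal) := by
    unfold elog
    rw [if_neg (ENNReal.ofReal_pos.2 (Real.exp_pos y)).ne', if_neg ENNReal.ofReal_ne_top,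
      ENNReal.toReal_ofReal (Real.exp_pos y).le, Real.log_exp]
  have hle := KN_inf hE hφ ht hz (L := ENNReal.ofReal (Real.exp y)) fun k => by
    have hzk : z ∈ Dc Ω u (u z + 1 + k) := ⟨hz, by
      have : (0:ℝ) ≤ k := Nat.cast_nonneg k
      linarith⟩
    have p := KN_toReal_pos hE hφ ht hzk
    refine ENNReal.ofReal_le_of_le_toReal ?_
    rw [← Real.le_log_iff_exp_le p]
    exact hcon k
  have := elog_mono hle
  rw [hel] at this
  exact absurd hy (not_lt.2 this)

theorem psh_main (hE : Exh Ω u) (hU : IsOpen U) (hφ : ContDiffOn ℝ ∞ φ (U ×ˢ Ω)) (hη : ContDiffOn ℝ ∞ η Ω)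
    (hδ : 0 < δ) (hXi : XiNonneg U Ω φ η δ) (hz : z ∈ Ω) :
    PshOn U (fun t => elog (bergKernel Ω (fun w => φ (t, w)) volume z)) := by
  have hzk : ∀ k : ℕ, z ∈ Dc Ω u (u z + 1 + k) := fun k => ⟨hz, by
    have : (0:ℝ) ≤ k := Nat.cast_nonneg k
    linarith⟩
  refine ⟨?_, ?_⟩
  · intro t ht y hy
    obtain ⟨y', h1, h2⟩ := EReal.lt_iff_exists_real_btwn.1 hy
    obtain ⟨k, hk⟩ := exists_SN_lt hE hφ ht hz h1
    have hc := SN_cont hE hU hφ (hzk k) t ht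
    filter_upwards [hc.eventually_lt_const hk, self_mem_nhdsWithin] with t' ht' htU
    refine (elog_K_le hE hφ htU (hzk k)).trans_lt (lt_trans ?_ h2)
    exact_mod_cast ht'
  · intro a ha w r hr hd g hg hle
    by_contra hcon
    push Not at hcon
    obtain ⟨y, h1, h2⟩ := EReal.lt_iff_exists_real_btwn.1 hcon
    set Mg := 1 / (2 * Real.pi) * ∫ θ in (0:ℝ)..(2 * Real.pi), g θ with hMg
    have h1' : Mg < y := by exact_mod_cast h1
    have hpi := Real.pi_pos
    have hcirc : ∀ θ : ℝ, ‖(r:ℂ) * Complex.exp (θ * Complex.I)‖ = r := by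
      intro θ
      rw [norm_mul, Complex.norm_exp_ofReal_mul_I, mul_one, Complex.norm_real, Real.norm_of_nonneg hr.le]
    have hUc : ∀ θ : ℝ, a + ((r:ℂ) * Complex.exp (θ * Complex.I)) • w ∈ U := fun θ => hd _ (hcirc θ).le
    set s : ℕ → ℝ → ℝ := fun k θ => SN Ω u φ z (u z + 1 + k) (a + ((r:ℂ) * Complex.exp (θ * Complex.I)) • w) with hs
    have hsc : ∀ k, Continuous (s k) := fun k =>
      (SN_cont hE hU hφ (hzk k)).comp_continuous (by fun_prop) hUc
    have hsmono : ∀ k l : ℕ, k ≤ l → ∀ θ, s l θ ≤ s k θ := by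
      intro k l hkl θ
      refine Real.log_le_log (KN_toReal_pos hE hφ (hUc θ) (hzk l)) ?_
      refine ENNReal.toReal_mono (KN_lt_top hE hφ (hUc θ) (hzk k)).ne ?_
      refine KN_anti hE hφ (hUc θ) (hzk k) ?_
      have : (k:ℝ) ≤ l := by exact_mod_cast hkl
      linarith
    obtain ⟨k, hk⟩ := (isCompact_Icc (a := (0:ℝ)) (b := 2 * Real.pi)).elim_directed_cover
      (fun k : ℕ => {θ : ℝ | s k θ < g θ + (y - Mg)})
      (fun k => isOpen_lt (hsc k) (hg.add continuous_const))
      (by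
        intro θ _
        rw [mem_iUnion]
        have hlt : elog (bergKernel Ω (fun x => φ (a + ((r:ℂ) * Complex.exp (θ * Complex.I)) • w, x)) volume z) <
            ((g θ + (y - Mg) : ℝ) : EReal) := by
          refine (hle θ).trans_lt ?_
          exact_mod_cast (by linarith : g θ < g θ + (y - Mg))
        exact exists_SN_lt hE hφ (hUc θ) hz hlt)
      (by
        intro i j
        refine ⟨max i j, fun θ hθ => ?_, fun θ hθ => ?_⟩
        · exact (hsmono i _ (le_max_left _ _) θ).trans_lt hθ
        · exact (hsmono j _ (le_max_right _ _) θ).trans_lt hθ)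
    have hsub := (SN_submean hE hU hφ hη hδ hXi (hzk k) hr hd).2
    have hi : ∫ θ in (0:ℝ)..(2 * Real.pi), s k θ ≤ ∫ θ in (0:ℝ)..(2 * Real.pi), (g θ + (y - Mg)) := by
      refine intervalIntegral.integral_mono_on (by positivity) ((hsc k).intervalIntegrable _ _)
        ((hg.add continuous_const).intervalIntegrable _ _) fun θ hθ => (hk hθ).le
    rw [intervalIntegral.integral_add (hg.intervalIntegrable _ _) (by simp), intervalIntegral.integral_const] at hi
    have hfin : SN Ω u φ z (u z + 1 + k) a ≤ y := by
      refine hsub.trans ?_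
      calc _ ≤ 1 / (2 * Real.pi) * ((∫ θ in (0:ℝ)..(2 * Real.pi), g θ) + (2 * Real.pi - 0) • (y - Mg)) := by gcongr
        _ = Mg + (y - Mg) := by
          rw [smul_eq_mul, sub_zero, mul_add, ← hMg]; congr 1; field_simp
        _ = y := by ring
    have h3 : elog (bergKernel Ω (fun x => φ (a, x)) volume z) ≤ (y : EReal) :=
      (elog_K_le hE hφ ha (hzk k)).trans (by exact_mod_cast hfin)
    exact absurd h2 (not_lt.2 h3)

end final1
end

/-- **Twisted log-plurisubharmonic variation of weighted Bergman kernels** for product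
domains: if `Ξ_{δ,η}(e^{−φ}) ≥ 0` on `U × Ω`, then `t ↦ log K_t(z)` is
plurisubharmonic or identically `−∞`. -/
theorem bergKernel_log_psh_product {m n : ℕ}
    (U : Set (Fin m → ℂ)) (hUo : IsOpen U) (hUc : IsConnected U)
    (Ω : Set (Fin n → ℂ)) (hΩ : Pseudoconvex Ω)
    (φ : (Fin m → ℂ) × (Fin n → ℂ) → ℝ) (hφ : ContDiffOn ℝ (⊤ : ℕ∞) φ (U ×ˢ Ω))
    (η : (Fin n → ℂ) → ℝ) (hη : ContDiffOn ℝ (⊤ : ℕ∞) η Ω)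
    (δ : ℝ) (hδ : 0 < δ) (hXi : XiNonneg U Ω φ η δ) :
    ∀ z ∈ Ω,
      (∀ t ∈ U, bergKernel Ω (fun w => φ (t, w)) volume z = 0) ∨
      PshOn U (fun t => elog (bergKernel Ω (fun w => φ (t, w)) volume z)) := by
  intro z hz
  obtain ⟨u, hE⟩ := exh_exists hΩ
  exact Or.inr (psh_main hE hUo hφ hη hδ hXi hz)
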